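/- Let G_n be an inhomogeneous random graph with type dependence on n vertices. Suppose: (a) the empirical type distributions F_n satisfy the large deviation principle on M([0,1]) (weak topology) with rate ℓ(n) and lower-semicontinuous rate function K; (b) the map F ↦ g^{[F]} is continuous from M([0,1]) to the space of graphons with the L¹-norm; (c) lim_n ℓ(n)/(n(n−1)/2) = c for some c ∈ (0,∞); and (d) there exists η > 0 such that η ≤ g^{[F]}(x,y) ≤ 1 − η for all F ∈ M([0,1]) and a.e. (x,y) ∈ [0,1]². Then the laws of the classes h̃^{G_n} satisfy the LDP on (W̃, δ_□) with rate n(n−1)/2 and rate function I*(h̃) = inf_{g̃ ∈ W̃} [ c J(g̃) + Ĩ_g(h̃) ], where J(g̃) = inf{ K(F) : g̃^{[F]} = g̃ } and g is any representative of g̃. -/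

import Mathlib

open MeasureTheory Filter
open scoped ENNReal

noncomputable section

/-- The unit square `[0,1]² ⊆ ℝ²`. -/
def unitSq : Set (ℝ × ℝ) := Set.Icc (0:ℝ) 1 ×ˢ Set.Icc (0:ℝ) 1

/-- A graphon: a symmetric measurable function `[0,1]² → [0,1]` (extended to `ℝ²`). -/
def IsGraphon (h : ℝ → ℝ → ℝ) : Prop :=
  Measurable (Function.uncurry h) ∧ (∀ x y, h x y = h y x) ∧ ∀ x y, h x y ∈ Set.Icc (0:ℝ) 1

def GraphonSet : Set (ℝ → ℝ → ℝ) := {h | IsGraphon h}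

/-- The cut distance `d_□`. -/
def cutDist (h₁ h₂ : ℝ → ℝ → ℝ) : ℝ :=
  ⨆ S : {S : Set ℝ // MeasurableSet S ∧ S ⊆ Set.Icc 0 1},
    ⨆ T : {T : Set ℝ // MeasurableSet T ∧ T ⊆ Set.Icc 0 1},
      |∫ p in S.1 ×ˢ T.1, (h₁ p.1 p.2 - h₂ p.1 p.2)|

/-- A measure-preserving bijection of `[0,1]`. -/
structure MPBij where
  toFun : ℝ → ℝ
  bijOn : Set.BijOn toFun (Set.Icc 0 1) (Set.Icc 0 1)
  mp : MeasurePreserving toFun (volume.restrict (Set.Icc 0 1)) (volume.restrict (Set.Icc 0 1))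

instance : Nonempty MPBij := ⟨⟨id, Set.bijOn_id _, MeasurePreserving.id _⟩⟩

/-- Relabelling of a graphon: `h^σ(x,y) = h(σ x, σ y)`. -/
def relabel (σ : MPBij) (h : ℝ → ℝ → ℝ) : ℝ → ℝ → ℝ := fun x y => h (σ.toFun x) (σ.toFun y)

/-- The cut metric `δ_□`. -/
def cutMetric (h₁ h₂ : ℝ → ℝ → ℝ) : ℝ :=
  ⨅ σ₁ : MPBij, ⨅ σ₂ : MPBij, cutDist (relabel σ₁ h₁) (relabel σ₂ h₂)

/-- `L¹` distance of (graphon-type) kernels over the unit square. -/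
def L1dist (h₁ h₂ : ℝ → ℝ → ℝ) : ℝ := ∫ p in unitSq, |h₁ p.1 p.2 - h₂ p.1 p.2|

/-- Bernoulli relative entropy `R(a|b)`, with the conventions `0 log 0 = 0`,
`R(a|0) = ∞` for `a > 0`, `R(a|1) = ∞` for `a < 1`. -/
def relEnt (a b : ℝ) : ℝ≥0∞ :=
  if b ≤ 0 then (if a ≤ 0 then 0 else ∞)
  else if 1 ≤ b then (if 1 ≤ a then 0 else ∞)
  else ENNReal.ofReal (a * Real.log (a / b) + (1 - a) * Real.log ((1 - a) / (1 - b)))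

/-- The rate function `I_r(h) = ∫_{[0,1]²} R(h(x,y)|r(x,y)) dx dy`. -/
def Irate (r h : ℝ → ℝ → ℝ) : ℝ≥0∞ := ∫⁻ p in unitSq, relEnt (h p.1 p.2) (r p.1 p.2)

/-- `Ĩ_r(h̃) = inf_σ I_r(h^σ)`. -/
def IrateTilde (r h : ℝ → ℝ → ℝ) : ℝ≥0∞ := ⨅ σ : MPBij, Irate r (relabel σ h)

/-- Closed subsets of graphon space for the (pseudo)metric `δ_□`; these correspond exactly to
the closed subsets of the quotient space `(W̃, δ_□)`. -/
def DeltaClosedIn (C : Set (ℝ → ℝ → ℝ)) : Prop :=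
  C ⊆ GraphonSet ∧ ∀ h ∈ GraphonSet, h ∉ C → ∃ ε > 0, ∀ g ∈ GraphonSet, cutMetric g h < ε → g ∉ C

/-- Open subsets of graphon space for the (pseudo)metric `δ_□`; these correspond exactly to
the open subsets of the quotient space `(W̃, δ_□)`. -/
def DeltaOpenIn (O : Set (ℝ → ℝ → ℝ)) : Prop :=
  O ⊆ GraphonSet ∧ ∀ h ∈ O, ∃ ε > 0, ∀ g ∈ GraphonSet, cutMetric g h < ε → g ∈ O

/-- `M([0,1])`: Borel probability measures on `[0,1]` with the topology of weak convergence. -/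
abbrev M01 := ProbabilityMeasure ↥(Set.Icc (0:ℝ) 1)

/-- empirical measure of a type vector -/
def empMeasAux {n : ℕ} (x : Fin n → ↥(Set.Icc (0:ℝ) 1)) : Measure ↥(Set.Icc (0:ℝ) 1) :=
  (n : ℝ≥0∞)⁻¹ • ∑ i : Fin n, Measure.dirac (x i)

lemma empMeasAux_isProb {n : ℕ} (hn : n ≠ 0) (x : Fin n → ↥(Set.Icc (0:ℝ) 1)) :
    IsProbabilityMeasure (empMeasAux x) := by
  constructor
  simp only [empMeasAux, Measure.smul_apply, Measure.coe_finset_sum, Finset.sum_apply,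
    measure_univ, Finset.sum_const, Finset.card_univ, Fintype.card_fin, nsmul_eq_mul, mul_one,
    smul_eq_mul]
  exact ENNReal.inv_mul_cancel (by exact_mod_cast hn) (by simp)

/-- The empirical type distribution `F_n` as an element of `M([0,1])`. -/
def empMeas {n : ℕ} (x : Fin n → ↥(Set.Icc (0:ℝ) 1)) : M01 :=
  if h : n = 0 then ⟨Measure.dirac ⟨0, Set.left_mem_Icc.mpr zero_le_one⟩, inferInstance⟩
  else ⟨empMeasAux x, empMeasAux_isProb h x⟩

/-- The cumulative distribution function of `F ∈ M([0,1])`. -/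
def cdfM (F : M01) (x : ℝ) : ℝ :=
  ((F : Measure ↥(Set.Icc (0:ℝ) 1)) {t | (t : ℝ) ≤ x}).toReal

/-- The right-continuous generalised inverse `F̄(u) = inf{x ∈ [0,1] : F(x) > u}`. -/
def geninv (F : M01) (u : ℝ) : ℝ := sInf {x | x ∈ Set.Icc (0:ℝ) 1 ∧ u < cdfM F x}

/-- The induced reference graphon `g^{[F]}(x,y) = H(F̄(x), F̄(y), F)`. -/
def inducedGraphon (Hfun : ℝ → ℝ → M01 → ℝ) (F : M01) : ℝ → ℝ → ℝ :=
  fun x y => Hfun (geninv F x) (geninv F y) F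

/-- The vertex `⌈n x⌉` containing the point `x`. -/
def vertexOf (n : ℕ) (x : ℝ) : ℕ := (⌈(n : ℝ) * x⌉).toNat

open Classical in
/-- The empirical graphon of the graph on `[n]` with adjacency relation `A`. -/
def empGraphon {n : ℕ} (A : Fin n → Fin n → Prop) : ℝ → ℝ → ℝ :=
  fun x y =>
    if h : vertexOf n x - 1 < n ∧ vertexOf n y - 1 < n then
      (if A ⟨vertexOf n x - 1, h.1⟩ ⟨vertexOf n y - 1, h.2⟩ then 1 else 0)
    else 0

/-- Adjacency of the IRGT: given the types `x` and i.i.d. uniforms `u`, the edge `ij` is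
active iff `u_{ij} ≤ H(X_i, X_j, F_n)`. -/
def irgtAdj (Hfun : ℝ → ℝ → M01 → ℝ) {n : ℕ} (x : Fin n → ↥(Set.Icc (0:ℝ) 1))
    (u : Fin n × Fin n → ℝ) (i j : Fin n) : Prop :=
  i ≠ j ∧ u (min i j, max i j) ≤ Hfun (x i : ℝ) (x j : ℝ) (empMeas x)

/-- Adjacency of the inhomogeneous Erdős–Rényi graph with reference graphon `r`: the edge `ij`
(`i,j ∈ {1,…,n}`) is active iff `u_{ij} ≤ r(i/n, j/n)`. -/
def erAdj (r : ℝ → ℝ → ℝ) {n : ℕ} (u : Fin n × Fin n → ℝ) (i j : Fin n) : Prop :=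
  i ≠ j ∧ u (min i j, max i j) ≤ r (((i : ℕ) + 1 : ℝ) / n) (((j : ℕ) + 1 : ℝ) / n)

/-- i.i.d. uniforms on `[0,1]`, one for each (potential) edge. -/
def cubeMeasure (n : ℕ) : Measure (Fin n × Fin n → ℝ) :=
  Measure.pi fun _ => volume.restrict (Set.Icc 0 1)

/-- `n(n-1)/2` as a real-valued rate. -/
def binom2 (n : ℕ) : ℝ := (n : ℝ) * ((n : ℝ) - 1) / 2

/-- The large deviation principle, with speed `a` and rate function `R`, for the laws of the
random elements `f n` (defined on the probability spaces `(Ω n, μ n)`) of a topological space. -/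
def SatisfiesLDP {Λ : Type*} [TopologicalSpace Λ] {Ω : ℕ → Type*} [∀ n, MeasurableSpace (Ω n)]
    (μ : ∀ n, Measure (Ω n)) (f : ∀ n, Ω n → Λ) (a : ℕ → ℝ) (R : Λ → ℝ≥0∞) : Prop :=
  Tendsto a atTop atTop ∧
  (∀ C : Set Λ, IsClosed C →
    atTop.limsup (fun n => (((a n)⁻¹ : ℝ) : EReal) * ENNReal.log (μ n (f n ⁻¹' C)))
      ≤ -(⨅ x ∈ C, (R x : EReal))) ∧
  (∀ O : Set Λ, IsOpen O →
    -(⨅ x ∈ O, (R x : EReal)) ≤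
      atTop.liminf (fun n => (((a n)⁻¹ : ℝ) : EReal) * ENNReal.log (μ n (f n ⁻¹' O))))

/-- The large deviation principle on `(W̃, δ_□)`, with speed `a` and rate function `R`, for the
laws of the equivalence classes of the graphon-valued random elements `f n`. -/
def GraphonLDP {Ω : ℕ → Type*} [∀ n, MeasurableSpace (Ω n)]
    (μ : ∀ n, Measure (Ω n)) (f : ∀ n, Ω n → (ℝ → ℝ → ℝ)) (a : ℕ → ℝ)
    (R : (ℝ → ℝ → ℝ) → ℝ≥0∞) : Prop :=
  Tendsto a atTop atTop ∧
  (∀ C : Set (ℝ → ℝ → ℝ), DeltaClosedIn C →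
    atTop.limsup (fun n => (((a n)⁻¹ : ℝ) : EReal) * ENNReal.log (μ n (f n ⁻¹' C)))
      ≤ -(⨅ h ∈ C, (R h : EReal))) ∧
  (∀ O : Set (ℝ → ℝ → ℝ), DeltaOpenIn O →
    -(⨅ h ∈ O, (R h : EReal)) ≤
      atTop.liminf (fun n => (((a n)⁻¹ : ℝ) : EReal) * ENNReal.log (μ n (f n ⁻¹' O))))

end


/-! ### Measure-preserving bijections and the cut distance -/

noncomputable section

/-- Lebesgue measure on `[0,1]`. -/
def unitMeas : Measure ℝ := volume.restrict (Set.Icc 0 1)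

/-- Lebesgue measure on the unit square. -/
def sqMeas : Measure (ℝ × ℝ) := unitMeas.prod unitMeas

instance isProbabilityMeasure_unitMeas : IsProbabilityMeasure unitMeas :=
  ⟨by simp [unitMeas]⟩

instance isProbabilityMeasure_sqMeas : IsProbabilityMeasure sqMeas := by
  unfold sqMeas; infer_instance

lemma restrict_unitSq : (volume : Measure (ℝ × ℝ)).restrict unitSq = sqMeas := by
  rw [sqMeas, unitMeas, Measure.prod_restrict]; rfl

lemma ae_mem_Icc : ∀ᵐ x ∂unitMeas, x ∈ Set.Icc (0:ℝ) 1 :=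
  ae_restrict_mem measurableSet_Icc

lemma ae_mem_Ioc : ∀ᵐ x ∂unitMeas, x ∈ Set.Ioc (0:ℝ) 1 := by
  have h : unitMeas = volume.restrict (Set.Ioc 0 1) := by
    rw [unitMeas, restrict_Ioc_eq_restrict_Icc]
  rw [h]
  exact ae_restrict_mem measurableSet_Ioc

lemma ae_sq_of_ae {P : ℝ → Prop} (h : ∀ᵐ x ∂unitMeas, P x) :
    ∀ᵐ p ∂sqMeas, P p.1 ∧ P p.2 := by
  have h1 : ∀ᵐ p ∂sqMeas, P p.1 := Measure.quasiMeasurePreserving_fst.ae h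
  have h2 : ∀ᵐ p ∂sqMeas, P p.2 := Measure.quasiMeasurePreserving_snd.ae h
  filter_upwards [h1, h2] with p a b using ⟨a, b⟩

lemma setIntegral_rect {S T : Set ℝ} (hS : MeasurableSet S) (hT : MeasurableSet T)
    (hS1 : S ⊆ Set.Icc 0 1) (hT1 : T ⊆ Set.Icc 0 1) (f : ℝ × ℝ → ℝ) :
    ∫ p in S ×ˢ T, f p = ∫ p in S ×ˢ T, f p ∂sqMeas := by
  rw [← restrict_unitSq, Measure.restrict_restrict (hS.prod hT), unitSq,
    Set.prod_inter_prod, Set.inter_eq_left.2 hS1, Set.inter_eq_left.2 hT1]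

lemma setIntegral_rect_inter {S T : Set ℝ} (hS : MeasurableSet S) (hT : MeasurableSet T)
    (f : ℝ × ℝ → ℝ) :
    ∫ p in (S ∩ Set.Icc 0 1) ×ˢ (T ∩ Set.Icc 0 1), f p = ∫ p in S ×ˢ T, f p ∂sqMeas := by
  rw [← restrict_unitSq, Measure.restrict_restrict (hS.prod hT), unitSq, Set.prod_inter_prod]

/-- Bounded measurable kernels. -/
def IsKer (h : ℝ → ℝ → ℝ) : Prop :=
  Measurable (Function.uncurry h) ∧ ∃ B, ∀ x y, |h x y| ≤ B

lemma IsGraphon.isKer {h : ℝ → ℝ → ℝ} (hh : IsGraphon h) : IsKer h :=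
  ⟨hh.1, 1, fun x y => abs_le.2 ⟨by linarith [(hh.2.2 x y).1], (hh.2.2 x y).2⟩⟩

lemma IsKer.measurable {h : ℝ → ℝ → ℝ} (hh : IsKer h) : Measurable fun p : ℝ × ℝ => h p.1 p.2 :=
  hh.1

lemma integrable_of_bound {f : ℝ × ℝ → ℝ} (hf : Measurable f) {B : ℝ} (hB : ∀ p, |f p| ≤ B) :
    Integrable f sqMeas :=
  Integrable.of_bound hf.aestronglyMeasurable B (Eventually.of_forall hB)

lemma IsKer.integrable {h : ℝ → ℝ → ℝ} (hh : IsKer h) :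
    Integrable (fun p : ℝ × ℝ => h p.1 p.2) sqMeas := by
  obtain ⟨B, hB⟩ := hh.2
  exact integrable_of_bound hh.measurable fun p => hB p.1 p.2

lemma IsKer.sub {h k : ℝ → ℝ → ℝ} (hh : IsKer h) (hk : IsKer k) :
    IsKer fun x y => h x y - k x y := by
  obtain ⟨B, hB⟩ := hh.2
  obtain ⟨C, hC⟩ := hk.2
  exact ⟨hh.1.sub hk.1, B + C, fun x y => (abs_sub _ _).trans (add_le_add (hB x y) (hC x y))⟩

lemma IsKer.mul {h k : ℝ → ℝ → ℝ} (hh : IsKer h) (hk : IsKer k) :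
    IsKer fun x y => h x y * k x y := by
  obtain ⟨B, hB⟩ := hh.2
  obtain ⟨C, hC⟩ := hk.2
  refine ⟨hh.1.mul hk.1, B * C, fun x y => ?_⟩
  rw [abs_mul]
  exact mul_le_mul (hB x y) (hC x y) (abs_nonneg _) ((abs_nonneg _).trans (hB x y))

lemma IsKer.relabel {h : ℝ → ℝ → ℝ} (hh : IsKer h) (σ : MPBij) : IsKer (relabel σ h) := by
  obtain ⟨B, hB⟩ := hh.2
  refine ⟨?_, B, fun x y => hB _ _⟩
  have := σ.mp.measurable
  exact hh.1.comp ((this.comp measurable_fst).prodMk (this.comp measurable_snd))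

lemma IsGraphon.relabel {h : ℝ → ℝ → ℝ} (hh : IsGraphon h) (σ : MPBij) :
    IsGraphon (relabel σ h) :=
  ⟨(hh.isKer.relabel σ).1, fun _ _ => hh.2.1 _ _, fun _ _ => hh.2.2 _ _⟩

lemma L1dist_eq (h k : ℝ → ℝ → ℝ) : L1dist h k = ∫ p, |h p.1 p.2 - k p.1 p.2| ∂sqMeas := by
  rw [L1dist, restrict_unitSq]

lemma L1dist_nonneg (h k : ℝ → ℝ → ℝ) : 0 ≤ L1dist h k :=
  integral_nonneg fun _ => abs_nonneg _

lemma L1dist_comm (h k : ℝ → ℝ → ℝ) : L1dist h k = L1dist k h := by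
  simp only [L1dist, abs_sub_comm]

lemma L1dist_triangle {h k l : ℝ → ℝ → ℝ} (hh : IsKer h) (hk : IsKer k) (hl : IsKer l) :
    L1dist h l ≤ L1dist h k + L1dist k l := by
  simp only [L1dist_eq]
  rw [← integral_add (hh.sub hk).integrable.abs (hk.sub hl).integrable.abs]
  exact integral_mono (hh.sub hl).integrable.abs
    ((hh.sub hk).integrable.abs.add (hk.sub hl).integrable.abs) fun p => abs_sub_le _ _ _

lemma abs_rectInt_le_L1dist {h k : ℝ → ℝ → ℝ} (hh : IsKer h) (hk : IsKer k)
    (A : Set (ℝ × ℝ)) :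
    |∫ p in A, (h p.1 p.2 - k p.1 p.2) ∂sqMeas| ≤ L1dist h k := by
  rw [L1dist_eq]
  refine abs_integral_le_integral_abs.trans ?_
  exact setIntegral_le_integral (hh.sub hk).integrable.abs
    (Eventually.of_forall fun _ => abs_nonneg _)

instance nonempty_measurableSubset : Nonempty {S : Set ℝ // MeasurableSet S ∧ S ⊆ Set.Icc 0 1} :=
  ⟨⟨∅, MeasurableSet.empty, Set.empty_subset _⟩⟩

lemma cutDist_le {h k : ℝ → ℝ → ℝ} {c : ℝ}
    (H : ∀ S T : Set ℝ, MeasurableSet S → MeasurableSet T →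
      |∫ p in S ×ˢ T, (h p.1 p.2 - k p.1 p.2) ∂sqMeas| ≤ c) : cutDist h k ≤ c := by
  refine ciSup_le fun S => ciSup_le fun T => ?_
  rw [setIntegral_rect S.2.1 T.2.1 S.2.2 T.2.2 fun p => h p.1 p.2 - k p.1 p.2]
  exact H _ _ S.2.1 T.2.1

lemma le_cutDist {h k : ℝ → ℝ → ℝ} (hh : IsKer h) (hk : IsKer k) {S T : Set ℝ}
    (hS : MeasurableSet S) (hT : MeasurableSet T) :
    |∫ p in S ×ˢ T, (h p.1 p.2 - k p.1 p.2) ∂sqMeas| ≤ cutDist h k := by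
  rw [← setIntegral_rect_inter hS hT fun p => h p.1 p.2 - k p.1 p.2]
  have key : ∀ (S T : {S : Set ℝ // MeasurableSet S ∧ S ⊆ Set.Icc 0 1}),
      |∫ p in S.1 ×ˢ T.1, (h p.1 p.2 - k p.1 p.2)| ≤ L1dist h k := fun S T => by
    rw [setIntegral_rect S.2.1 T.2.1 S.2.2 T.2.2 fun p => h p.1 p.2 - k p.1 p.2]
    exact abs_rectInt_le_L1dist hh hk _
  have b1 : ∀ S : {S : Set ℝ // MeasurableSet S ∧ S ⊆ Set.Icc 0 1}, BddAbove (Set.range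
      fun T : {S : Set ℝ // MeasurableSet S ∧ S ⊆ Set.Icc 0 1} =>
        |∫ p in S.1 ×ˢ T.1, (h p.1 p.2 - k p.1 p.2)|) := fun S => by
    refine ⟨L1dist h k, ?_⟩
    rintro _ ⟨T, rfl⟩
    exact key S T
  have b2 : BddAbove (Set.range fun S : {S : Set ℝ // MeasurableSet S ∧ S ⊆ Set.Icc 0 1} =>
      ⨆ T : {S : Set ℝ // MeasurableSet S ∧ S ⊆ Set.Icc 0 1},
        |∫ p in S.1 ×ˢ T.1, (h p.1 p.2 - k p.1 p.2)|) := by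
    refine ⟨L1dist h k, ?_⟩
    rintro _ ⟨S, rfl⟩
    exact ciSup_le fun T => key S T
  exact (le_ciSup (b1 ⟨S ∩ Set.Icc 0 1, hS.inter measurableSet_Icc, Set.inter_subset_right⟩)
    ⟨T ∩ Set.Icc 0 1, hT.inter measurableSet_Icc, Set.inter_subset_right⟩).trans
    (le_ciSup b2 ⟨S ∩ Set.Icc 0 1, hS.inter measurableSet_Icc, Set.inter_subset_right⟩)

lemma cutDist_nonneg {h k : ℝ → ℝ → ℝ} (hh : IsKer h) (hk : IsKer k) : 0 ≤ cutDist h k :=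
  (abs_nonneg _).trans (le_cutDist hh hk MeasurableSet.empty MeasurableSet.empty)

lemma cutDist_le_L1dist {h k : ℝ → ℝ → ℝ} (hh : IsKer h) (hk : IsKer k) :
    cutDist h k ≤ L1dist h k :=
  cutDist_le fun _ _ _ _ => abs_rectInt_le_L1dist hh hk _

lemma cutDist_comm (h k : ℝ → ℝ → ℝ) : cutDist h k = cutDist k h := by
  unfold cutDist
  congr 1; ext S; congr 1; ext T
  rw [← abs_neg, ← integral_neg]
  simp

lemma cutDist_triangle {h k l : ℝ → ℝ → ℝ} (hh : IsKer h) (hk : IsKer k) (hl : IsKer l) :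
    cutDist h l ≤ cutDist h k + cutDist k l := by
  refine cutDist_le fun S T hS hT => ?_
  have : ∫ p in S ×ˢ T, (h p.1 p.2 - l p.1 p.2) ∂sqMeas
      = ∫ p in S ×ˢ T, (h p.1 p.2 - k p.1 p.2) ∂sqMeas
        + ∫ p in S ×ˢ T, (k p.1 p.2 - l p.1 p.2) ∂sqMeas := by
    rw [← integral_add (hh.sub hk).integrable.integrableOn (hk.sub hl).integrable.integrableOn]
    simp
  rw [this]
  exact (abs_add_le _ _).trans (add_le_add (le_cutDist hh hk hS hT) (le_cutDist hk hl hS hT))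

/-- The inverse of a measure-preserving bijection. -/
def MPBij.inv (σ : MPBij) : MPBij where
  toFun y := open Classical in
    if y ∈ Set.Icc (0:ℝ) 1 then Function.invFunOn σ.toFun (Set.Icc 0 1) y else y
  bijOn := by
    have h := σ.bijOn.invOn_invFunOn
    refine (Set.BijOn.congr (f₁ := Function.invFunOn σ.toFun (Set.Icc 0 1)) ?_ ?_)
    · exact Set.InvOn.bijOn h.symm σ.bijOn.surjOn.mapsTo_invFunOn σ.bijOn.mapsTo
    · intro y hy; simp [hy]
  mp := by
    classical
    set g : ℝ → ℝ := fun y =>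
      if y ∈ Set.Icc (0:ℝ) 1 then Function.invFunOn σ.toFun (Set.Icc 0 1) y else y with hg
    have h := σ.bijOn.invOn_invFunOn
    have hmaps := σ.bijOn.surjOn.mapsTo_invFunOn
    have hm : Measurable g := by
      intro S hS
      have : g ⁻¹' S = σ.toFun '' (S ∩ Set.Icc 0 1) ∪ (S \ Set.Icc 0 1) := by
        ext y
        simp only [Set.mem_preimage, hg, Set.mem_union, Set.mem_image, Set.mem_inter_iff,
          Set.mem_sdiff]
        by_cases hy : y ∈ Set.Icc (0:ℝ) 1
        · simp only [hy, if_true, not_true, and_false, or_false]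
          constructor
          · intro hS
            exact ⟨_, ⟨hS, hmaps hy⟩, h.2 hy⟩
          · rintro ⟨x, ⟨hx, hx1⟩, rfl⟩
            rwa [h.1 hx1]
        · simp only [hy, if_false, not_false_iff, and_true]
          constructor
          · exact Or.inr
          · rintro (⟨x, ⟨hx, hx1⟩, rfl⟩ | hS)
            · exact absurd (σ.bijOn.mapsTo hx1) hy
            · exact hS
      rw [this]
      refine ((hS.inter measurableSet_Icc).image_of_measurable_injOn σ.mp.measurable
        (σ.bijOn.injOn.mono Set.inter_subset_right)).union (hS.diff measurableSet_Icc)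
    refine ⟨hm, ?_⟩
    conv_lhs => rw [← σ.mp.map_eq]
    rw [Measure.map_map hm σ.mp.measurable]
    have : (g ∘ σ.toFun) =ᵐ[volume.restrict (Set.Icc 0 1)] id := by
      filter_upwards [ae_restrict_mem measurableSet_Icc] with x hx
      simp only [hg, Function.comp, σ.bijOn.mapsTo hx, if_true, id, h.1 hx]
    rw [Measure.map_congr this, Measure.map_id]

lemma MPBij.inv_apply (σ : MPBij) {x : ℝ} (hx : x ∈ Set.Icc (0:ℝ) 1) :
    σ.inv.toFun (σ.toFun x) = x := by
  simp only [MPBij.inv, σ.bijOn.mapsTo hx, if_true]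
  exact σ.bijOn.invOn_invFunOn.1 hx

lemma MPBij.apply_inv (σ : MPBij) {x : ℝ} (hx : x ∈ Set.Icc (0:ℝ) 1) :
    σ.toFun (σ.inv.toFun x) = x := by
  simp only [MPBij.inv, hx, if_true]
  exact σ.bijOn.invOn_invFunOn.2 hx

/-- Composition of measure-preserving bijections. -/
def MPBij.comp (σ τ : MPBij) : MPBij where
  toFun := σ.toFun ∘ τ.toFun
  bijOn := σ.bijOn.comp τ.bijOn
  mp := σ.mp.comp τ.mp

lemma relabel_relabel (σ τ : MPBij) (h : ℝ → ℝ → ℝ) :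
    relabel τ (relabel σ h) = relabel (σ.comp τ) h := rfl

lemma MPBij.measurePreserving (σ : MPBij) : MeasurePreserving σ.toFun unitMeas unitMeas := σ.mp

lemma MPBij.measurePreserving_sq (σ : MPBij) :
    MeasurePreserving (Prod.map σ.toFun σ.toFun) sqMeas sqMeas :=
  σ.measurePreserving.prod σ.measurePreserving

lemma MPBij.ae (σ : MPBij) {P : ℝ × ℝ → Prop} (h : ∀ᵐ p ∂sqMeas, P p) :
    ∀ᵐ p ∂sqMeas, P (σ.toFun p.1, σ.toFun p.2) :=
  σ.measurePreserving_sq.quasiMeasurePreserving.ae h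

lemma MPBij.integral_comp (σ : MPBij) {f : ℝ × ℝ → ℝ} (hf : AEStronglyMeasurable f sqMeas) :
    ∫ p, f (σ.toFun p.1, σ.toFun p.2) ∂sqMeas = ∫ p, f p ∂sqMeas := by
  have h := σ.measurePreserving_sq
  conv_rhs => rw [← h.map_eq]
  rw [integral_map h.measurable.aemeasurable (by rwa [h.map_eq])]
  rfl

lemma L1dist_relabel {h k : ℝ → ℝ → ℝ} (hh : IsKer h) (hk : IsKer k) (σ : MPBij) :
    L1dist (relabel σ h) (relabel σ k) = L1dist h k := by
  rw [L1dist_eq, L1dist_eq,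
    ← σ.integral_comp (hh.sub hk).integrable.abs.aestronglyMeasurable]
  rfl

lemma L1dist_congr {h k l m : ℝ → ℝ → ℝ} (h1 : ∀ᵐ p ∂sqMeas, h p.1 p.2 = l p.1 p.2)
    (h2 : ∀ᵐ p ∂sqMeas, k p.1 p.2 = m p.1 p.2) : L1dist h k = L1dist l m := by
  rw [L1dist_eq, L1dist_eq]
  refine integral_congr_ae ?_
  filter_upwards [h1, h2] with p a b
  rw [a, b]

lemma cutDist_congr {h k l m : ℝ → ℝ → ℝ} (h1 : ∀ᵐ p ∂sqMeas, h p.1 p.2 = l p.1 p.2)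
    (h2 : ∀ᵐ p ∂sqMeas, k p.1 p.2 = m p.1 p.2) : cutDist h k = cutDist l m := by
  unfold cutDist
  congr 1; ext S; congr 1; ext T
  rw [setIntegral_rect S.2.1 T.2.1 S.2.2 T.2.2 fun p => h p.1 p.2 - k p.1 p.2,
    setIntegral_rect S.2.1 T.2.1 S.2.2 T.2.2 fun p => l p.1 p.2 - m p.1 p.2]
  congr 1
  refine integral_congr_ae (ae_restrict_of_ae ?_)
  filter_upwards [h1, h2] with p a b
  rw [a, b]

lemma relabel_inv_ae (σ : MPBij) (h : ℝ → ℝ → ℝ) :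
    ∀ᵐ p ∂sqMeas, relabel σ.inv (relabel σ h) p.1 p.2 = h p.1 p.2 := by
  filter_upwards [ae_sq_of_ae ae_mem_Icc] with p hp
  simp only [relabel, σ.apply_inv hp.1, σ.apply_inv hp.2]

lemma cutDist_relabel_le {h k : ℝ → ℝ → ℝ} (hh : IsKer h) (hk : IsKer k) (σ : MPBij) :
    cutDist (relabel σ h) (relabel σ k) ≤ cutDist h k := by
  refine cutDist_le fun S T hS hT => ?_
  have hm := σ.inv.mp.measurable
  have hmeas : MeasurableSet ((σ.inv.toFun ⁻¹' S) ×ˢ (σ.inv.toFun ⁻¹' T)) :=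
    (hm hS).prod (hm hT)
  refine le_trans (le_of_eq ?_) (le_cutDist hh hk (hm hS) (hm hT))
  congr 1
  rw [← integral_indicator (hS.prod hT), ← integral_indicator hmeas,
    ← σ.integral_comp ((hh.sub hk).integrable.indicator hmeas).aestronglyMeasurable]
  refine integral_congr_ae ?_
  filter_upwards [ae_sq_of_ae ae_mem_Icc] with p hp
  have hiff : ((σ.toFun p.1, σ.toFun p.2) ∈ (σ.inv.toFun ⁻¹' S) ×ˢ (σ.inv.toFun ⁻¹' T))
      ↔ p ∈ S ×ˢ T := by
    rw [Set.mem_prod, Set.mem_prod, Set.mem_preimage, Set.mem_preimage, σ.inv_apply hp.1,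
      σ.inv_apply hp.2]
  by_cases hq : p ∈ S ×ˢ T
  · rw [Set.indicator_of_mem hq, Set.indicator_of_mem (hiff.2 hq)]; rfl
  · rw [Set.indicator_of_notMem hq, Set.indicator_of_notMem (mt hiff.1 hq)]

lemma cutDist_relabel {h k : ℝ → ℝ → ℝ} (hh : IsKer h) (hk : IsKer k) (σ : MPBij) :
    cutDist (relabel σ h) (relabel σ k) = cutDist h k := by
  refine (cutDist_relabel_le hh hk σ).antisymm ?_
  refine le_trans (le_of_eq ?_) (cutDist_relabel_le (hh.relabel σ) (hk.relabel σ) σ.inv)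
  refine cutDist_congr ?_ ?_
  · filter_upwards [relabel_inv_ae σ h] with p hp using hp.symm
  · filter_upwards [relabel_inv_ae σ k] with p hp using hp.symm

lemma cutMetric_le {h k : ℝ → ℝ → ℝ} (hh : IsKer h) (hk : IsKer k) (σ τ : MPBij) :
    cutMetric h k ≤ cutDist (relabel σ h) (relabel τ k) := by
  have hb : ∀ σ, BddBelow (Set.range fun τ => cutDist (relabel σ h) (relabel τ k)) := fun σ => by
    refine ⟨0, ?_⟩
    rintro _ ⟨τ, rfl⟩
    exact cutDist_nonneg (hh.relabel σ) (hk.relabel τ)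
  refine (ciInf_le ?_ σ).trans (ciInf_le (hb σ) τ)
  refine ⟨0, ?_⟩
  rintro _ ⟨τ, rfl⟩
  exact le_ciInf fun _ => cutDist_nonneg (hh.relabel _) (hk.relabel _)

lemma cutMetric_nonneg {h k : ℝ → ℝ → ℝ} (hh : IsKer h) (hk : IsKer k) : 0 ≤ cutMetric h k :=
  le_ciInf fun _ => le_ciInf fun _ => cutDist_nonneg (hh.relabel _) (hk.relabel _)

lemma relabel_id (h : ℝ → ℝ → ℝ) :
    relabel ⟨id, Set.bijOn_id _, MeasurePreserving.id _⟩ h = h := rfl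

lemma cutMetric_le_cutDist {h k : ℝ → ℝ → ℝ} (hh : IsKer h) (hk : IsKer k) :
    cutMetric h k ≤ cutDist h k :=
  cutMetric_le hh hk ⟨id, Set.bijOn_id _, MeasurePreserving.id _⟩
    ⟨id, Set.bijOn_id _, MeasurePreserving.id _⟩

lemma exists_of_cutMetric_lt {h k : ℝ → ℝ → ℝ} (hh : IsKer h) (hk : IsKer k) {r : ℝ}
    (hr : cutMetric h k < r) : ∃ σ, cutDist h (relabel σ k) < r := by
  obtain ⟨σ, hσ⟩ := exists_lt_of_ciInf_lt hr
  obtain ⟨τ, hτ⟩ := exists_lt_of_ciInf_lt hσ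
  refine ⟨τ.comp σ.inv, ?_⟩
  rw [← cutDist_relabel (hh.relabel σ) (hk.relabel τ) σ.inv,
    cutDist_congr (relabel_inv_ae σ h) (Eventually.of_forall fun p => rfl)] at hτ
  exact hτ

lemma cutMetric_le_relabel_right {h k : ℝ → ℝ → ℝ} (hh : IsKer h) (hk : IsKer k) (σ : MPBij) :
    cutMetric h k ≤ cutDist h (relabel σ k) :=
  cutMetric_le hh hk ⟨id, Set.bijOn_id _, MeasurePreserving.id _⟩ σ

lemma cutMetric_comm_le {h k : ℝ → ℝ → ℝ} (hh : IsKer h) (hk : IsKer k) :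
    cutMetric h k ≤ cutMetric k h :=
  le_ciInf fun σ => le_ciInf fun τ => by
    rw [cutDist_comm]
    exact cutMetric_le hh hk τ σ

lemma cutMetric_comm {h k : ℝ → ℝ → ℝ} (hh : IsKer h) (hk : IsKer k) :
    cutMetric h k = cutMetric k h :=
  (cutMetric_comm_le hh hk).antisymm (cutMetric_comm_le hk hh)

lemma cutMetric_self {h : ℝ → ℝ → ℝ} (hh : IsKer h) : cutMetric h h = 0 := by
  refine le_antisymm ((cutMetric_le_cutDist hh hh).trans ?_) (cutMetric_nonneg hh hh)
  refine (cutDist_le_L1dist hh hh).trans ?_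
  simp [L1dist]

lemma cutMetric_triangle {h k l : ℝ → ℝ → ℝ} (hh : IsKer h) (hk : IsKer k) (hl : IsKer l) :
    cutMetric h l ≤ cutMetric h k + cutMetric k l := by
  refine le_of_forall_pos_le_add fun ε hε => ?_
  obtain ⟨σ, hσ⟩ := exists_of_cutMetric_lt hh hk (r := cutMetric h k + ε / 2) (by linarith)
  obtain ⟨τ, hτ⟩ := exists_of_cutMetric_lt hk hl (r := cutMetric k l + ε / 2) (by linarith)
  rw [← cutDist_relabel hk (hl.relabel τ) σ, relabel_relabel] at hτ
  have h1 := cutDist_triangle hh (hk.relabel σ) (hl.relabel (τ.comp σ))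
  have h2 := cutMetric_le_relabel_right hh hl (τ.comp σ)
  linarith

/-- Graphons with the cut metric. -/
def Graphon : Type := {h : ℝ → ℝ → ℝ // IsGraphon h}

instance instPseudoMetricSpaceGraphon : PseudoMetricSpace Graphon where
  dist g h := cutMetric g.1 h.1
  dist_self g := cutMetric_self g.2.isKer
  dist_comm g h := cutMetric_comm g.2.isKer h.2.isKer
  dist_triangle g h k := cutMetric_triangle g.2.isKer h.2.isKer k.2.isKer

lemma Graphon.dist_def (g h : Graphon) : dist g h = cutMetric g.1 h.1 := rfl

/-- Testing a cut-norm-small difference against a kernel depending on finitely many labels. -/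
lemma abs_integral_label_mul_le {h k : ℝ → ℝ → ℝ} (hh : IsKer h) (hk : IsKer k) {m : ℕ}
    {f : ℝ → Fin m} (hf : Measurable f) (B : Fin m → Fin m → ℝ) {b : ℝ}
    (hB : ∀ i j, |B i j| ≤ b) :
    |∫ p, B (f p.1) (f p.2) * (h p.1 p.2 - k p.1 p.2) ∂sqMeas| ≤ m * m * b * cutDist h k := by
  have hS : ∀ i, MeasurableSet (f ⁻¹' {i}) := fun i => hf (measurableSet_singleton i)
  have e1 : ∀ p : ℝ × ℝ, B (f p.1) (f p.2) * (h p.1 p.2 - k p.1 p.2)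
      = ∑ i, ∑ j, B i j * ((f ⁻¹' {i}) ×ˢ (f ⁻¹' {j})).indicator
          (fun p => h p.1 p.2 - k p.1 p.2) p := by
    intro p
    rw [Finset.sum_eq_single (f p.1), Finset.sum_eq_single (f p.2)]
    · simp [Set.indicator]
    · intro j _ hj
      simp [Set.indicator, hj.symm]
    · simp
    · intro i _ hi
      refine Finset.sum_eq_zero fun j _ => ?_
      simp [Set.indicator, hi.symm]
    · simp
  have hi : ∀ i j, Integrable (((f ⁻¹' {i}) ×ˢ (f ⁻¹' {j})).indicator
          (fun p : ℝ × ℝ => h p.1 p.2 - k p.1 p.2)) sqMeas := fun i j =>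
    (hh.sub hk).integrable.indicator ((hS i).prod (hS j))
  simp_rw [e1]
  rw [integral_finsetSum _ fun i _ => integrable_finsetSum _ fun j _ => (hi i j).const_mul _]
  have e2 : ∀ i, ∫ p, ∑ j, B i j * ((f ⁻¹' {i}) ×ˢ (f ⁻¹' {j})).indicator
          (fun p => h p.1 p.2 - k p.1 p.2) p ∂sqMeas
      = ∑ j, B i j * ∫ p in (f ⁻¹' {i}) ×ˢ (f ⁻¹' {j}), (h p.1 p.2 - k p.1 p.2) ∂sqMeas := by
    intro i
    rw [integral_finsetSum _ fun j _ => (hi i j).const_mul _]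
    refine Finset.sum_congr rfl fun j _ => ?_
    rw [integral_const_mul, integral_indicator ((hS i).prod (hS j))]
  simp_rw [e2]
  refine (Finset.abs_sum_le_sum_abs _ _).trans ?_
  have : ∀ i, |∑ j, B i j * ∫ p in (f ⁻¹' {i}) ×ˢ (f ⁻¹' {j}), (h p.1 p.2 - k p.1 p.2) ∂sqMeas|
      ≤ ∑ _j : Fin m, b * cutDist h k := fun i => by
    refine (Finset.abs_sum_le_sum_abs _ _).trans (Finset.sum_le_sum fun j _ => ?_)
    rw [abs_mul]
    exact mul_le_mul (hB i j) (le_cutDist hh hk (hS i) (hS j)) (abs_nonneg _)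
      ((abs_nonneg _).trans (hB i j))
  refine (Finset.sum_le_sum fun i _ => this i).trans (le_of_eq ?_)
  simp
  ring

end

/-! ### Grid step kernels -/

noncomputable section

lemma vertexOf_le_iff {n : ℕ} (hn : 0 < n) {x : ℝ} (hx : x ∈ Set.Ioc (0:ℝ) 1) :
    1 ≤ vertexOf n x ∧ vertexOf n x ≤ n ∧ ((vertexOf n x : ℝ) - 1) / n < x ∧
      x ≤ (vertexOf n x : ℝ) / n := by
  have hn' : (0:ℝ) < n := by exact_mod_cast hn
  have h0 : 0 < ⌈(n:ℝ) * x⌉ := Int.ceil_pos.2 (mul_pos hn' hx.1)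
  have h1 : ⌈(n:ℝ) * x⌉ ≤ n := Int.ceil_le.2 (by
    push_cast; exact mul_le_of_le_one_right hn'.le hx.2)
  have h2 : ((vertexOf n x : ℕ) : ℤ) = ⌈(n:ℝ) * x⌉ := Int.toNat_of_nonneg h0.le
  have h3 : (vertexOf n x : ℝ) = (⌈(n:ℝ) * x⌉ : ℝ) := by exact_mod_cast h2
  refine ⟨by omega, by omega, ?_, ?_⟩
  · rw [div_lt_iff₀ hn', h3]
    have := Int.ceil_lt_add_one ((n:ℝ) * x)
    linarith
  · rw [le_div_iff₀ hn', h3]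
    have := Int.le_ceil ((n:ℝ) * x)
    linarith

lemma measurable_vertexOf (n : ℕ) : Measurable (vertexOf n) := by
  unfold vertexOf
  exact (measurable_from_top (f := Int.toNat)).comp
    (Int.measurable_ceil.comp (measurable_const.mul measurable_id))

/-- The index of the grid block containing `x`. -/
def vtx (n : ℕ) [NeZero n] (x : ℝ) : Fin n :=
  ⟨min (vertexOf n x - 1) (n - 1), by have := NeZero.pos n; omega⟩

lemma measurable_vtx (n : ℕ) [NeZero n] : Measurable (vtx n) := by
  have : vtx n = (fun k : ℕ => (⟨min (k - 1) (n - 1), by have := NeZero.pos n; omega⟩ : Fin n)) ∘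
    vertexOf n := rfl
  rw [this]
  exact measurable_from_top.comp (measurable_vertexOf n)

/-- The `i`-th grid block. -/
def block (n : ℕ) (i : Fin n) : Set ℝ := Set.Ioc ((i:ℝ) / n) (((i:ℝ) + 1) / n)

lemma mem_block_iff {n : ℕ} [NeZero n] (i : Fin n) (x : ℝ) :
    x ∈ block n i ↔ x ∈ Set.Ioc (0:ℝ) 1 ∧ vtx n x = i := by
  have hn := NeZero.pos n
  have hn' : (0:ℝ) < n := by exact_mod_cast hn
  constructor
  · intro hx
    have hx1 : x ∈ Set.Ioc (0:ℝ) 1 := by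
      refine ⟨lt_of_le_of_lt (by positivity) hx.1, hx.2.trans ?_⟩
      rw [div_le_one hn']
      exact_mod_cast i.2
    refine ⟨hx1, ?_⟩
    obtain ⟨h1, h2, h3, h4⟩ := vertexOf_le_iff hn hx1
    have a1 := h3.trans_le hx.2
    have a2 := hx.1.trans_le h4
    rw [div_lt_div_iff_of_pos_right hn'] at a1 a2
    have a1' : vertexOf n x < i + 2 := by
      have : (vertexOf n x : ℝ) < i + 2 := by linarith
      exact_mod_cast this
    have a2' : (i : ℕ) < vertexOf n x := by exact_mod_cast a2
    ext
    simp only [vtx]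
    omega
  · rintro ⟨hx1, rfl⟩
    obtain ⟨h1, h2, h3, h4⟩ := vertexOf_le_iff hn hx1
    have e : ((vtx n x : ℕ) : ℝ) = (vertexOf n x : ℝ) - 1 := by
      have : (vtx n x : ℕ) = vertexOf n x - 1 := by simp only [vtx]; omega
      rw [this]; push_cast [h1]; ring
    refine ⟨by rw [e]; exact h3, by rw [e]; simpa using h4⟩

lemma vtx_mem_block {n : ℕ} [NeZero n] {x : ℝ} (hx : x ∈ Set.Ioc (0:ℝ) 1) :
    x ∈ block n (vtx n x) := (mem_block_iff _ _).2 ⟨hx, rfl⟩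

lemma abs_sub_vtx_le {n : ℕ} [NeZero n] {x : ℝ} (hx : x ∈ Set.Ioc (0:ℝ) 1) :
    |x - ((vtx n x : ℝ) + 1) / n| ≤ 1 / n := by
  have h := vtx_mem_block (n := n) hx
  have e : ((vtx n x : ℝ) + 1) / n = (vtx n x : ℝ) / n + 1 / n := by ring
  have h1 := h.1
  have h2 := h.2
  rw [abs_le]
  constructor <;> linarith

lemma unitMeas_eq_Ioc : unitMeas = volume.restrict (Set.Ioc 0 1) := by
  rw [unitMeas, restrict_Ioc_eq_restrict_Icc]

lemma unitMeas_vtx_inter {n : ℕ} [NeZero n] (i : Fin n) {S : Set ℝ} (hS : MeasurableSet S) :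
    unitMeas (vtx n ⁻¹' {i} ∩ S) = volume (block n i ∩ S) := by
  rw [unitMeas_eq_Ioc, Measure.restrict_apply
    ((measurable_vtx n (measurableSet_singleton i)).inter hS)]
  congr 1
  ext x
  simp only [Set.mem_inter_iff, mem_block_iff, Set.mem_preimage, Set.mem_singleton_iff]
  tauto

lemma volume_block {n : ℕ} [NeZero n] (i : Fin n) :
    volume (block n i) = ENNReal.ofReal (1 / n) := by
  rw [block, Real.volume_Ioc]
  congr 1
  ring

lemma unitMeas_vtx {n : ℕ} [NeZero n] (i : Fin n) :
    unitMeas (vtx n ⁻¹' {i}) = ENNReal.ofReal (1 / n) := by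
  have := unitMeas_vtx_inter i (MeasurableSet.univ)
  simpa [volume_block] using this

lemma unitMeas_real_vtx {n : ℕ} [NeZero n] (i : Fin n) :
    unitMeas.real (vtx n ⁻¹' {i}) = 1 / n := by
  rw [measureReal_def, unitMeas_vtx, ENNReal.toReal_ofReal (by positivity)]

lemma map_vtx_real {n : ℕ} [NeZero n] (i : Fin n) :
    (unitMeas.map (vtx n)).real {i} = 1 / n := by
  rw [map_measureReal_apply (measurable_vtx n) (measurableSet_singleton i), unitMeas_real_vtx]

/-- The step kernel of a matrix. -/
def stepK {n : ℕ} [NeZero n] (A : Fin n → Fin n → ℝ) : ℝ → ℝ → ℝ :=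
  fun x y => A (vtx n x) (vtx n y)

lemma measurable_vtx_prod (n : ℕ) [NeZero n] :
    Measurable fun p : ℝ × ℝ => (vtx n p.1, vtx n p.2) :=
  ((measurable_vtx n).comp measurable_fst).prodMk ((measurable_vtx n).comp measurable_snd)

lemma isKer_stepK {n : ℕ} [NeZero n] (A : Fin n → Fin n → ℝ) : IsKer (stepK A) := by
  refine ⟨(measurable_of_finite (Function.uncurry A)).comp (measurable_vtx_prod n),
    ∑ i, ∑ j, |A i j|, fun x y => ?_⟩
  refine le_trans ?_ (Finset.single_le_sum (f := fun i => ∑ j, |A i j|)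
    (fun i _ => Finset.sum_nonneg fun j _ => abs_nonneg _) (Finset.mem_univ (vtx n x)))
  exact Finset.single_le_sum (f := fun j => |A (vtx n x) j|) (fun j _ => abs_nonneg _)
    (Finset.mem_univ (vtx n y))

lemma integral_stepK {n : ℕ} [NeZero n] (A : Fin n → Fin n → ℝ) :
    ∫ p, stepK A p.1 p.2 ∂sqMeas = (∑ i, ∑ j, A i j) / (n:ℝ) ^ 2 := by
  have h1 : sqMeas.map (fun p : ℝ × ℝ => (vtx n p.1, vtx n p.2))
      = (unitMeas.map (vtx n)).prod (unitMeas.map (vtx n)) := by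
    rw [sqMeas, Measure.map_prod_map _ _ (measurable_vtx n) (measurable_vtx n)]; rfl
  have h2 : ∫ p, stepK A p.1 p.2 ∂sqMeas
      = ∫ q, Function.uncurry A q ∂(sqMeas.map (fun p : ℝ × ℝ => (vtx n p.1, vtx n p.2))) := by
    rw [integral_map (measurable_vtx_prod n).aemeasurable
      (measurable_of_finite _).aestronglyMeasurable]
    rfl
  have : IsProbabilityMeasure (unitMeas.map (vtx n)) :=
    Measure.isProbabilityMeasure_map (measurable_vtx n).aemeasurable
  rw [h2, h1, integral_prod _ (Integrable.of_finite), integral_fintype (Integrable.of_finite)]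
  simp_rw [integral_fintype (Integrable.of_finite), map_vtx_real, smul_eq_mul,
    Function.uncurry_apply_pair]
  rw [Finset.sum_div]
  refine Finset.sum_congr rfl fun i _ => ?_
  rw [Finset.sum_div, Finset.mul_sum]
  refine Finset.sum_congr rfl fun j _ => ?_
  have : (n:ℝ) ≠ 0 := by exact_mod_cast NeZero.ne n
  field_simp

lemma L1dist_stepK {n : ℕ} [NeZero n] (A B : Fin n → Fin n → ℝ) :
    L1dist (stepK A) (stepK B) = (∑ i, ∑ j, |A i j - B i j|) / (n:ℝ) ^ 2 := by
  rw [L1dist_eq, ← integral_stepK]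
  rfl

/-! ### Permuting grid blocks -/

/-- The map permuting grid blocks. -/
def blockPermFun (n : ℕ) [NeZero n] (π : Equiv.Perm (Fin n)) (x : ℝ) : ℝ := open Classical in
  if x ∈ Set.Ioc (0:ℝ) 1 then x + ((π (vtx n x) : ℝ) - (vtx n x : ℝ)) / n else x

lemma blockPermFun_mem {n : ℕ} [NeZero n] (π : Equiv.Perm (Fin n)) {x : ℝ}
    (hx : x ∈ Set.Ioc (0:ℝ) 1) : blockPermFun n π x ∈ block n (π (vtx n x)) := by
  have h := vtx_mem_block (n := n) hx
  simp only [blockPermFun, hx, if_true]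
  have h1 := h.1
  have h2 := h.2
  constructor
  · rw [sub_div]; linarith
  · rw [sub_div]; rw [add_div] at h2 ⊢; linarith

lemma vtx_blockPermFun {n : ℕ} [NeZero n] (π : Equiv.Perm (Fin n)) {x : ℝ}
    (hx : x ∈ Set.Ioc (0:ℝ) 1) :
    blockPermFun n π x ∈ Set.Ioc (0:ℝ) 1 ∧ vtx n (blockPermFun n π x) = π (vtx n x) :=
  (mem_block_iff _ _).1 (blockPermFun_mem π hx)

lemma blockPermFun_inv {n : ℕ} [NeZero n] (π : Equiv.Perm (Fin n)) (x : ℝ) :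
    blockPermFun n π⁻¹ (blockPermFun n π x) = x := by
  by_cases hx : x ∈ Set.Ioc (0:ℝ) 1
  · have h := vtx_blockPermFun π hx
    have e : blockPermFun n π⁻¹ (blockPermFun n π x) = blockPermFun n π x
        + ((π⁻¹ (vtx n (blockPermFun n π x)) : ℝ) - (vtx n (blockPermFun n π x) : ℝ)) / n := by
      rw [blockPermFun, if_pos h.1]
    have e' : π⁻¹ (π (vtx n x)) = vtx n x := by simp
    rw [e, h.2, e', blockPermFun, if_pos hx]
    ring
  · have e : blockPermFun n π x = x := by rw [blockPermFun, if_neg hx]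
    rw [e, blockPermFun, if_neg hx]

lemma measurable_blockPermFun {n : ℕ} [NeZero n] (π : Equiv.Perm (Fin n)) :
    Measurable (blockPermFun n π) := by
  classical
  refine Measurable.ite measurableSet_Ioc ?_ measurable_id
  exact measurable_id.add ((measurable_of_finite
    fun i : Fin n => ((π i : ℝ) - (i : ℝ)) / n).comp (measurable_vtx n))

lemma sum_unitMeas_vtx_inter {n : ℕ} [NeZero n] {S : Set ℝ} (hS : MeasurableSet S) :
    unitMeas S = ∑ i, unitMeas (vtx n ⁻¹' {i} ∩ S) := by
  rw [← measure_biUnion_finset]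
  · congr 1
    ext x
    simp
  · intro i _ j _ hij
    refine Set.disjoint_left.2 fun x hx hy => hij ?_
    have h1 := hx.1
    have h2 := hy.1
    simp only [Set.mem_preimage, Set.mem_singleton_iff] at h1 h2
    rw [← h1, ← h2]
  · intro i _
    exact (measurable_vtx n (measurableSet_singleton i)).inter hS

/-- Permutation of the grid blocks as a measure-preserving bijection. -/
def blockPerm {n : ℕ} [NeZero n] (π : Equiv.Perm (Fin n)) : MPBij where
  toFun := blockPermFun n π
  bijOn := by
    have hm : ∀ π : Equiv.Perm (Fin n),
        Set.MapsTo (blockPermFun n π) (Set.Icc 0 1) (Set.Icc 0 1) := fun π x hx => by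
      by_cases h : x ∈ Set.Ioc (0:ℝ) 1
      · exact Set.Ioc_subset_Icc_self (vtx_blockPermFun π h).1
      · rw [blockPermFun, if_neg h]; exact hx
    refine Set.InvOn.bijOn (f' := blockPermFun n π⁻¹)
      ⟨fun x _ => blockPermFun_inv π x, fun x _ => ?_⟩
      (hm π) (hm π⁻¹)
    have := blockPermFun_inv π⁻¹ x
    rwa [inv_inv] at this
  mp := by
    refine ⟨measurable_blockPermFun π, ?_⟩
    change Measure.map (blockPermFun n π) unitMeas = unitMeas
    ext S hS
    rw [Measure.map_apply (measurable_blockPermFun π) hS,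
      sum_unitMeas_vtx_inter (n := n) (measurable_blockPermFun π hS),
      sum_unitMeas_vtx_inter (n := n) hS,
      ← Equiv.sum_comp π fun i => unitMeas (vtx n ⁻¹' {i} ∩ S)]
    refine Finset.sum_congr rfl fun i _ => ?_
    rw [unitMeas_vtx_inter i (measurable_blockPermFun π hS), unitMeas_vtx_inter (π i) hS]
    have : block n i ∩ blockPermFun n π ⁻¹' S
        = (fun x => x + ((π i : ℝ) - (i : ℝ)) / n) ⁻¹' (block n (π i) ∩ S) := by
      ext x
      have hb : x ∈ block n i ↔ x + ((π i : ℝ) - (i : ℝ)) / n ∈ block n (π i) := by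
        simp only [block, Set.mem_Ioc, sub_div, add_div]
        constructor
        · rintro ⟨h1, h2⟩; constructor <;> linarith
        · rintro ⟨h1, h2⟩; constructor <;> linarith
      simp only [Set.mem_inter_iff, Set.mem_preimage, ← hb]
      refine and_congr_right fun hx => ?_
      obtain ⟨h1, h2⟩ := (mem_block_iff i x).1 hx
      rw [blockPermFun, if_pos h1, h2]
    rw [this, measure_preimage_add_right]

lemma relabel_blockPerm_stepK {n : ℕ} [NeZero n] (π : Equiv.Perm (Fin n))
    (A : Fin n → Fin n → ℝ) :
    ∀ᵐ p ∂sqMeas, relabel (blockPerm π) (stepK A) p.1 p.2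
      = stepK (fun i j => A (π i) (π j)) p.1 p.2 := by
  filter_upwards [ae_sq_of_ae ae_mem_Ioc] with p hp
  simp only [relabel, stepK, blockPerm, (vtx_blockPermFun π hp.1).2, (vtx_blockPermFun π hp.2).2]

/-! ### Approximation by step kernels -/

lemma abs_clamp_sub_le (lo hi : ℝ) {a z : ℝ} (ha : a ∈ Set.Icc lo hi) :
    |a - max lo (min hi z)| ≤ |a - z| := by
  have h : a = max lo (min hi a) := by rw [min_eq_right ha.2, max_eq_right ha.1]
  conv_lhs => rw [h]
  calc |max lo (min hi a) - max lo (min hi z)| ≤ max |lo - lo| |min hi a - min hi z| :=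
        abs_max_sub_max_le_max _ _ _ _
    _ = |min hi a - min hi z| := by simp
    _ ≤ max |hi - hi| |a - z| := abs_min_sub_min_le_max _ _ _ _
    _ = |a - z| := by simp

lemma integral_swap_sq {f : ℝ × ℝ → ℝ} :
    ∫ p, f p.swap ∂sqMeas = ∫ p, f p ∂sqMeas :=
  integral_prod_swap (μ := unitMeas) (ν := unitMeas) f

lemma exists_stepK_near {h : ℝ → ℝ → ℝ} (hm : Measurable (Function.uncurry h))
    (hs : ∀ x y, h x y = h y x) {lo hi : ℝ} (hb : ∀ x y, h x y ∈ Set.Icc lo hi) {ε : ℝ}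
    (hε : 0 < ε) :
    ∃ N : ℕ, ∀ n : ℕ, [NeZero n] → N ≤ n → ∃ A : Fin n → Fin n → ℝ, (∀ i j, A i j = A j i) ∧
      (∀ i j, A i j ∈ Set.Icc lo hi) ∧ L1dist h (stepK A) < ε := by
  have hlohi : lo ≤ hi := (hb 0 0).1.trans (hb 0 0).2
  have hker : IsKer h := ⟨hm, max |lo| |hi|, fun x y =>
    abs_le_max_abs_abs (hb x y).1 (hb x y).2⟩
  obtain ⟨f, hfc, hf, hfcont, hfint⟩ :=
    hker.integrable.exists_hasCompactSupport_integral_sub_le (ε := ε / 4) (by linarith)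
  have huc := hfc.uniformContinuous_of_continuous hfcont
  obtain ⟨δ, hδ, hfδ⟩ := Metric.uniformContinuous_iff.1 huc (ε / 4) (by linarith)
  obtain ⟨N, hN⟩ := exists_nat_gt (1 / δ)
  refine ⟨N, fun n _ hn => ?_⟩
  have hn' : (0:ℝ) < n := by exact_mod_cast NeZero.pos n
  have hnδ : 1 / (n:ℝ) < δ := by
    rw [div_lt_comm₀ hn' hδ]
    exact hN.trans_le (by exact_mod_cast hn)
  let pt : Fin n → ℝ := fun i => ((i : ℝ) + 1) / n
  let A : Fin n → Fin n → ℝ := fun i j =>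
    max lo (min hi ((f (pt i, pt j) + f (pt j, pt i)) / 2))
  refine ⟨A, fun i j => by simp only [A]; rw [add_comm],
    fun i j => ⟨le_max_left _ _, max_le hlohi (min_le_left _ _)⟩, ?_⟩
  have hpt : ∀ᵐ p ∂sqMeas, |h p.1 p.2 - stepK A p.1 p.2|
      ≤ (1/2) * |h p.1 p.2 - f p| + (1/2) * |h p.swap.1 p.swap.2 - f p.swap| + ε / 4 := by
    filter_upwards [ae_sq_of_ae ae_mem_Ioc] with p hp
    refine (abs_clamp_sub_le lo hi (hb p.1 p.2)).trans ?_
    have d1 : |p.1 - pt (vtx n p.1)| < δ := (abs_sub_vtx_le hp.1).trans_lt hnδ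
    have d2 : |p.2 - pt (vtx n p.2)| < δ := (abs_sub_vtx_le hp.2).trans_lt hnδ
    have e1 := hfδ (a := p) (b := (pt (vtx n p.1), pt (vtx n p.2))) (by
      rw [Prod.dist_eq, Real.dist_eq, Real.dist_eq]; exact max_lt d1 d2)
    have e2 := hfδ (a := p.swap) (b := (pt (vtx n p.2), pt (vtx n p.1))) (by
      rw [Prod.dist_eq, Real.dist_eq, Real.dist_eq]; exact max_lt d2 d1)
    rw [Real.dist_eq] at e1 e2
    have hsw : h p.swap.1 p.swap.2 = h p.1 p.2 := hs _ _
    rw [hsw]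
    have : h p.1 p.2 - (f (pt (vtx n p.1), pt (vtx n p.2)) + f (pt (vtx n p.2), pt (vtx n p.1))) / 2
        = (1/2) * (h p.1 p.2 - f p) + (1/2) * (h p.1 p.2 - f p.swap)
          + ((1/2) * (f p - f (pt (vtx n p.1), pt (vtx n p.2)))
          + (1/2) * (f p.swap - f (pt (vtx n p.2), pt (vtx n p.1)))) := by ring
    rw [this]
    refine (abs_add_le _ _).trans (add_le_add ((abs_add_le _ _).trans (add_le_add ?_ ?_)) ?_)
    · rw [abs_mul, abs_of_pos (by norm_num : (0:ℝ) < 1/2)]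
    · rw [abs_mul, abs_of_pos (by norm_num : (0:ℝ) < 1/2)]
    · refine (abs_add_le _ _).trans ?_
      rw [abs_mul, abs_mul, abs_of_pos (by norm_num : (0:ℝ) < 1/2)]
      linarith
  have i1 : Integrable (fun p : ℝ × ℝ => |h p.1 p.2 - f p|) sqMeas :=
    (hker.integrable.sub hfint).abs
  have i2 : Integrable (fun p : ℝ × ℝ => |h p.swap.1 p.swap.2 - f p.swap|) sqMeas := by
    have := i1.swap (μ := unitMeas) (ν := unitMeas)
    exact this
  rw [L1dist_eq]
  have hA := isKer_stepK A
  have i3 : Integrable (fun p : ℝ × ℝ => (1/2) * |h p.1 p.2 - f p|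
      + (1/2) * |h p.swap.1 p.swap.2 - f p.swap|) sqMeas := (i1.const_mul _).add (i2.const_mul _)
  calc ∫ p, |h p.1 p.2 - stepK A p.1 p.2| ∂sqMeas
      ≤ ∫ p, ((1/2) * |h p.1 p.2 - f p| + (1/2) * |h p.swap.1 p.swap.2 - f p.swap| + ε / 4)
          ∂sqMeas :=
        integral_mono_ae (hker.sub hA).integrable.abs
          (i3.add (integrable_const _)) hpt
    _ = (1/2) * ∫ p, |h p.1 p.2 - f p| ∂sqMeas
          + (1/2) * ∫ p : ℝ × ℝ, |h p.swap.1 p.swap.2 - f p.swap| ∂sqMeas + ε / 4 := by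
        rw [integral_add i3 (integrable_const _),
          integral_add (i1.const_mul _) (i2.const_mul _), integral_const_mul, integral_const_mul]
        simp
    _ < ε := by
        rw [integral_swap_sq (f := fun p => |h p.1 p.2 - f p|)]
        have : ∫ p, |h p.1 p.2 - f p| ∂sqMeas ≤ ε / 4 := by
          simpa [Real.norm_eq_abs] using hf
        linarith

/-! ### Cut norms of matrices -/

lemma sum_mul_le_of_subset_sums {n : ℕ} {s a : Fin n → ℝ} {m : ℝ}
    (hs : ∀ i, s i ∈ Set.Icc 0 m) :
    ∃ P : Finset (Fin n), ∑ i, s i * a i ≤ m * ∑ i ∈ P, a i := by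
  classical
  refine ⟨Finset.univ.filter fun i => 0 < a i, ?_⟩
  rw [Finset.mul_sum, Finset.sum_filter]
  refine Finset.sum_le_sum fun i _ => ?_
  split_ifs with h
  · exact mul_le_mul_of_nonneg_right (hs i).2 h.le
  · exact mul_nonpos_of_nonneg_of_nonpos (hs i).1 (not_lt.1 h)

lemma bilinear_le_of_subset_sums {n : ℕ} {s t : Fin n → ℝ} {D : Fin n → Fin n → ℝ} {m c : ℝ}
    (hm : 0 ≤ m) (hs : ∀ i, s i ∈ Set.Icc 0 m) (ht : ∀ i, t i ∈ Set.Icc 0 m)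
    (H : ∀ S T : Finset (Fin n), ∑ i ∈ S, ∑ j ∈ T, D i j ≤ c) :
    ∑ i, ∑ j, D i j * (s i * t j) ≤ m ^ 2 * c := by
  have e1 : ∑ i, ∑ j, D i j * (s i * t j) = ∑ i, s i * ∑ j, D i j * t j := by
    refine Finset.sum_congr rfl fun i _ => ?_
    rw [Finset.mul_sum]
    exact Finset.sum_congr rfl fun j _ => by ring
  obtain ⟨P, hP⟩ := sum_mul_le_of_subset_sums (a := fun i => ∑ j, D i j * t j) hs
  have e2 : ∑ i ∈ P, ∑ j, D i j * t j = ∑ j, t j * ∑ i ∈ P, D i j := by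
    rw [Finset.sum_comm]
    refine Finset.sum_congr rfl fun i _ => ?_
    rw [Finset.mul_sum]
    exact Finset.sum_congr rfl fun j _ => by ring
  obtain ⟨Q, hQ⟩ := sum_mul_le_of_subset_sums (a := fun j => ∑ i ∈ P, D i j) ht
  rw [e1]
  refine hP.trans ?_
  rw [e2]
  refine (mul_le_mul_of_nonneg_left hQ hm).trans ?_
  rw [← mul_assoc, ← pow_two, Finset.sum_comm]
  exact mul_le_mul_of_nonneg_left (H _ _) (by positivity)

lemma rectInt_stepK {n : ℕ} [NeZero n] (D : Fin n → Fin n → ℝ) (S T : Set ℝ) :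
    ∫ p in S ×ˢ T, D (vtx n p.1) (vtx n p.2) ∂sqMeas
      = ∑ i, ∑ j, D i j *
        (unitMeas.real (vtx n ⁻¹' {i} ∩ S) * unitMeas.real (vtx n ⁻¹' {j} ∩ T)) := by
  rw [sqMeas, ← Measure.prod_restrict]
  have h1 : ((unitMeas.restrict S).prod (unitMeas.restrict T)).map
        (fun p : ℝ × ℝ => (vtx n p.1, vtx n p.2))
      = ((unitMeas.restrict S).map (vtx n)).prod ((unitMeas.restrict T).map (vtx n)) := by
    rw [Measure.map_prod_map _ _ (measurable_vtx n) (measurable_vtx n)]; rfl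
  have h2 : ∫ p, D (vtx n p.1) (vtx n p.2) ∂((unitMeas.restrict S).prod (unitMeas.restrict T))
      = ∫ q, Function.uncurry D q ∂(((unitMeas.restrict S).prod (unitMeas.restrict T)).map
        (fun p : ℝ × ℝ => (vtx n p.1, vtx n p.2))) := by
    rw [integral_map (measurable_vtx_prod n).aemeasurable
      (measurable_of_finite _).aestronglyMeasurable]
    rfl
  have h3 : ∀ (S : Set ℝ) (i : Fin n), ((unitMeas.restrict S).map (vtx n)).real {i}
      = unitMeas.real (vtx n ⁻¹' {i} ∩ S) := fun S i => by
    rw [map_measureReal_apply (measurable_vtx n) (measurableSet_singleton i), measureReal_def,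
      measureReal_def, Measure.restrict_apply (measurable_vtx n (measurableSet_singleton i))]
  rw [h2, h1, integral_prod _ (Integrable.of_finite), integral_fintype (Integrable.of_finite)]
  simp_rw [integral_fintype (Integrable.of_finite), h3, smul_eq_mul, Function.uncurry_apply_pair]
  refine Finset.sum_congr rfl fun i _ => ?_
  rw [Finset.mul_sum]
  exact Finset.sum_congr rfl fun j _ => by ring

lemma cutDist_stepK_le {n : ℕ} [NeZero n] {A B : Fin n → Fin n → ℝ} {c : ℝ}
    (H : ∀ S T : Finset (Fin n), |∑ i ∈ S, ∑ j ∈ T, (A i j - B i j)| ≤ c * (n:ℝ) ^ 2) :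
    cutDist (stepK A) (stepK B) ≤ c := by
  have hn' : (0:ℝ) < n := by exact_mod_cast NeZero.pos n
  have hm : ∀ (S : Set ℝ) (i : Fin n),
      unitMeas.real (vtx n ⁻¹' {i} ∩ S) ∈ Set.Icc 0 (1 / (n:ℝ)) := fun S i =>
    ⟨measureReal_nonneg, (measureReal_mono Set.inter_subset_left).trans_eq (unitMeas_real_vtx i)⟩
  have hc : (1 / (n:ℝ)) ^ 2 * (c * (n:ℝ) ^ 2) = c := by field_simp
  refine cutDist_le fun S T _ _ => ?_
  have e := rectInt_stepK (fun i j => A i j - B i j) S T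
  change |∫ p in S ×ˢ T, (A (vtx n p.1) (vtx n p.2) - B (vtx n p.1) (vtx n p.2)) ∂sqMeas| ≤ c
  rw [e, abs_le]
  constructor
  · have := bilinear_le_of_subset_sums (D := fun i j => -(A i j - B i j)) (c := c * (n:ℝ) ^ 2)
      (by positivity) (hm S) (hm T)
      fun P Q => by
        have := (abs_le.1 (H P Q)).1
        simp only [Finset.sum_neg_distrib]
        linarith
    rw [hc] at this
    simp only [neg_mul, Finset.sum_neg_distrib] at this
    linarith
  · have := bilinear_le_of_subset_sums (D := fun i j => (A i j - B i j)) (c := c * (n:ℝ) ^ 2)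
      (by positivity) (hm S) (hm T) fun P Q => (abs_le.1 (H P Q)).2
    rwa [hc] at this

end

/-! ### Weak regularity and total boundedness of the space of graphons -/

noncomputable section

lemma exists_simple_approx {n : ℕ} [NeZero n] {A : Fin n → Fin n → ℝ}
    (hA : ∀ i j, |A i j| ≤ 1) {ε : ℝ} (hε : 0 < ε) (k : ℕ) :
    ∃ (f : Fin n → Fin (4 ^ k)) (v : Fin (4 ^ k) → Fin (4 ^ k) → ℝ), (∀ a b, |v a b| ≤ k) ∧
      ((∀ S T : Finset (Fin n), |∑ i ∈ S, ∑ j ∈ T, (A i j - v (f i) (f j))| ≤ ε * (n:ℝ) ^ 2) ∨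
        ∑ i, ∑ j, (A i j - v (f i) (f j)) ^ 2 ≤ (n:ℝ) ^ 2 * (1 - k * ε ^ 2)) := by
  classical
  have hn' : (0:ℝ) < n := by exact_mod_cast NeZero.pos n
  induction k with
  | zero =>
    refine ⟨fun _ => 0, fun _ _ => 0, by simp, Or.inr ?_⟩
    have : ∑ i, ∑ j, (A i j - 0) ^ 2 ≤ ∑ i : Fin n, ∑ j : Fin n, (1:ℝ) :=
      Finset.sum_le_sum fun i _ => Finset.sum_le_sum fun j _ => by
        rw [sub_zero, ← sq_abs]
        exact pow_le_one₀ (abs_nonneg _) (hA i j)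
    refine this.trans ?_
    simp [pow_two]
  | succ k ih =>
    obtain ⟨f, v, hv, h⟩ := ih
    let e : Fin (4 ^ k) × (Bool × Bool) ≃ Fin (4 ^ (k + 1)) :=
      Fintype.equivFinOfCardEq (by simp [pow_succ])
    by_cases hgood : ∀ S T : Finset (Fin n),
        |∑ i ∈ S, ∑ j ∈ T, (A i j - v (f i) (f j))| ≤ ε * (n:ℝ) ^ 2
    · refine ⟨fun i => e (f i, false, false), fun a b => v (e.symm a).1 (e.symm b).1,
        fun a b => (hv _ _).trans (by push_cast; linarith), Or.inl fun S T => ?_⟩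
      simpa using hgood S T
    · have hbd := h.resolve_left hgood
      push Not at hgood
      obtain ⟨S, T, hST⟩ := hgood
      set R : Fin n → Fin n → ℝ := fun i j => A i j - v (f i) (f j) with hR
      set β := ∑ i ∈ S, ∑ j ∈ T, R i j with hβ
      have key : ∑ i, ∑ j, (R i j - if i ∈ S ∧ j ∈ T then β / (n:ℝ) ^ 2 else 0) ^ 2
          ≤ ∑ i, ∑ j, R i j ^ 2 - β ^ 2 / (n:ℝ) ^ 2 := by
        have e1 : ∀ i j, (R i j - if i ∈ S ∧ j ∈ T then β / (n:ℝ) ^ 2 else 0) ^ 2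
            = R i j ^ 2 + (if i ∈ S then (if j ∈ T then
              (β ^ 2 / (n:ℝ) ^ 4 - 2 * (β / (n:ℝ) ^ 2) * R i j) else 0) else 0) := by
          intro i j
          by_cases h1 : i ∈ S <;> by_cases h2 : j ∈ T <;> simp [h1, h2]
          ring
        simp_rw [e1, Finset.sum_add_distrib]
        have e2 : ∑ i, ∑ j, (if i ∈ S then (if j ∈ T then
              (β ^ 2 / (n:ℝ) ^ 4 - 2 * (β / (n:ℝ) ^ 2) * R i j) else 0) else 0)
            = (S.card * T.card) * (β ^ 2 / (n:ℝ) ^ 4) - 2 * (β / (n:ℝ) ^ 2) * β := by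
          have : ∀ i, ∑ j, (if i ∈ S then (if j ∈ T then
              (β ^ 2 / (n:ℝ) ^ 4 - 2 * (β / (n:ℝ) ^ 2) * R i j) else 0) else 0)
              = if i ∈ S then ∑ j ∈ T, (β ^ 2 / (n:ℝ) ^ 4 - 2 * (β / (n:ℝ) ^ 2) * R i j)
                else 0 := by
            intro i
            by_cases h1 : i ∈ S <;> simp [h1]
          simp_rw [this]
          rw [Finset.sum_ite_mem, Finset.univ_inter]
          simp_rw [Finset.sum_sub_distrib, ← Finset.mul_sum]
          rw [← hβ]
          simp
          ring
        rw [e2]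
        have hS : (S.card : ℝ) ≤ n := by
          exact_mod_cast (Finset.card_le_univ S).trans_eq (Fintype.card_fin n)
        have hT : (T.card : ℝ) ≤ n := by
          exact_mod_cast (Finset.card_le_univ T).trans_eq (Fintype.card_fin n)
        have h1 : (S.card * T.card : ℝ) * (β ^ 2 / (n:ℝ) ^ 4) ≤ (n * n) * (β ^ 2 / (n:ℝ) ^ 4) := by
          gcongr
        have h2 : ((n:ℝ) * n) * (β ^ 2 / (n:ℝ) ^ 4) = β ^ 2 / (n:ℝ) ^ 2 := by
          field_simp
        have h3 : 2 * (β / (n:ℝ) ^ 2) * β = 2 * (β ^ 2 / (n:ℝ) ^ 2) := by ring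
        linarith
      have hk0 : (n:ℝ) ^ 2 * (1 - k * ε ^ 2) ≤ (n:ℝ) ^ 2 :=
        mul_le_of_le_one_right (by positivity) (by
          have : 0 ≤ (k:ℝ) * ε ^ 2 := by positivity
          linarith)
      have hβ1 : |β / (n:ℝ) ^ 2| ≤ 1 := by
        have h0 : 0 ≤ ∑ i, ∑ j, (R i j - if i ∈ S ∧ j ∈ T then β / (n:ℝ) ^ 2 else 0) ^ 2 :=
          Finset.sum_nonneg fun i _ => Finset.sum_nonneg fun j _ => sq_nonneg _
        have h1 : β ^ 2 / (n:ℝ) ^ 2 ≤ (n:ℝ) ^ 2 := by linarith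
        rw [← sq_le_one_iff_abs_le_one, div_pow, div_le_one (by positivity)]
        rw [div_le_iff₀ (by positivity)] at h1
        linarith [h1, (by ring : (n:ℝ) ^ 2 * (n:ℝ) ^ 2 = ((n:ℝ) ^ 2) ^ 2)]
      have hβ2 : ε ^ 2 * (n:ℝ) ^ 2 ≤ β ^ 2 / (n:ℝ) ^ 2 := by
        rw [le_div_iff₀ (by positivity)]
        have : (ε * (n:ℝ) ^ 2) ^ 2 ≤ |β| ^ 2 := by gcongr
        rw [sq_abs] at this
        linarith [(by ring : ε ^ 2 * (n:ℝ) ^ 2 * (n:ℝ) ^ 2 = (ε * (n:ℝ) ^ 2) ^ 2)]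
      refine ⟨fun i => e (f i, decide (i ∈ S), decide (i ∈ T)),
        fun a b => v (e.symm a).1 (e.symm b).1 +
          if (e.symm a).2.1 = true ∧ (e.symm b).2.2 = true then β / (n:ℝ) ^ 2 else 0,
        fun a b => ?_, Or.inr ?_⟩
      · refine (abs_add_le _ _).trans ?_
        push_cast
        refine add_le_add (hv _ _) ?_
        split_ifs
        · exact hβ1
        · simp
      · simp only [Equiv.symm_apply_apply, decide_eq_true_eq]
        have e3 : ∀ i j, A i j - (v (f i) (f j) + if i ∈ S ∧ j ∈ T then β / (n:ℝ) ^ 2 else 0)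
            = R i j - if i ∈ S ∧ j ∈ T then β / (n:ℝ) ^ 2 else 0 := fun i j => by
          rw [hR]; ring
        simp_rw [e3]
        push_cast
        linarith [(by ring : (n:ℝ) ^ 2 * (1 - (k + 1) * ε ^ 2)
          = (n:ℝ) ^ 2 * (1 - k * ε ^ 2) - ε ^ 2 * (n:ℝ) ^ 2)]

/-- Frieze–Kannan weak regularity. -/
lemma exists_regular_approx {ε : ℝ} (hε : 0 < ε) :
    ∃ k : ℕ, ∀ n : ℕ, [NeZero n] → ∀ A : Fin n → Fin n → ℝ, (∀ i j, |A i j| ≤ 1) →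
      ∃ (f : Fin n → Fin (4 ^ k)) (v : Fin (4 ^ k) → Fin (4 ^ k) → ℝ), (∀ a b, |v a b| ≤ k) ∧
        ∀ S T : Finset (Fin n), |∑ i ∈ S, ∑ j ∈ T, (A i j - v (f i) (f j))| ≤ ε * (n:ℝ) ^ 2 := by
  obtain ⟨k, hk⟩ := exists_nat_gt (1 / ε ^ 2)
  refine ⟨k, fun n _ A hA => ?_⟩
  have hn' : (0:ℝ) < n := by exact_mod_cast NeZero.pos n
  obtain ⟨f, v, hv, h⟩ := exists_simple_approx hA hε k
  refine ⟨f, v, hv, h.resolve_right fun h => ?_⟩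
  have h0 : 0 ≤ ∑ i, ∑ j, (A i j - v (f i) (f j)) ^ 2 :=
    Finset.sum_nonneg fun i _ => Finset.sum_nonneg fun j _ => sq_nonneg _
  rw [div_lt_iff₀ (by positivity)] at hk
  have : (n:ℝ) ^ 2 * (1 - k * ε ^ 2) < 0 := mul_neg_of_pos_of_neg (by positivity) (by linarith)
  linarith

lemma measure_ne_sample_le {g : ℝ → ℕ} (hg : MonotoneOn g (Set.Ioc 0 1)) {T : ℕ}
    (hT : ∀ x, g x ≤ T) (M : ℕ) [NeZero M] :
    unitMeas.real {x | g x ≠ g (((vtx M x : ℝ) + 1) / M)} ≤ T / M := by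
  classical
  have hM := NeZero.pos M
  have hM' : (0:ℝ) < M := by exact_mod_cast hM
  let u : ℕ → ℕ := fun b => if b = 0 then 0 else g ((b:ℝ) / M)
  have hmem : ∀ b : ℕ, b < M → ((b + 1 : ℕ) : ℝ) / M ∈ Set.Ioc (0:ℝ) 1 := fun b hb =>
    ⟨by positivity, by rw [div_le_one hM']; exact_mod_cast hb⟩
  have humono : ∀ b, b < M → u b ≤ u (b + 1) := by
    intro b hb
    simp only [u]
    rcases Nat.eq_zero_or_pos b with rfl | hb0
    · simp
    · rw [if_neg hb0.ne', if_neg b.succ_ne_zero]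
      refine hg ?_ (hmem b hb) ?_
      · have := hmem (b - 1) (by omega)
        rwa [Nat.sub_add_cancel hb0] at this
      · gcongr; simp
  let J : Finset (Fin M) := Finset.univ.filter fun b => u b ≠ u (b + 1)
  have hJ : J.card ≤ T := by
    have h1 : J.card ≤ ∑ b ∈ Finset.range M, (u (b + 1) - u b) := by
      rw [← Fin.sum_univ_eq_sum_range (fun b => u (b + 1) - u b), Finset.card_eq_sum_ones,
        Finset.sum_filter]
      refine Finset.sum_le_sum fun b _ => ?_
      have := humono b b.2
      split_ifs <;> omega
    have h2 : ∀ m ≤ M, ∑ b ∈ Finset.range m, (u (b + 1) - u b) = u m := by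
      intro m
      induction m with
      | zero => simp [u]
      | succ m ih =>
        intro hm
        rw [Finset.sum_range_succ, ih (by omega)]
        have := humono m (by omega)
        omega
    rw [h2 M le_rfl] at h1
    refine h1.trans ?_
    simp only [u]
    split_ifs
    · exact Nat.zero_le _
    · exact hT _
  have hsub : ∀ᵐ x ∂unitMeas, x ∈ {x | g x ≠ g (((vtx M x : ℝ) + 1) / M)} →
      x ∈ ⋃ b ∈ J, vtx M ⁻¹' {b} := by
    filter_upwards [ae_mem_Ioc] with x hx hbad
    simp only [Set.mem_iUnion, Set.mem_preimage, Set.mem_singleton_iff]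
    refine ⟨vtx M x, ?_, rfl⟩
    simp only [J, Finset.mem_filter, Finset.mem_univ, true_and]
    intro heq
    apply hbad
    have hb := vtx_mem_block (n := M) hx
    have e1 : u (vtx M x + 1) = g (((vtx M x : ℝ) + 1) / M) := by
      simp only [u]; rw [if_neg (Nat.succ_ne_zero _)]; push_cast; rfl
    have hr : ((vtx M x : ℝ) + 1) / M ∈ Set.Ioc (0:ℝ) 1 := by
      have := hmem (vtx M x) (vtx M x).2
      push_cast at this
      exact this
    have up := hg hx hr hb.2
    have lo : u (vtx M x) ≤ g x := by
      simp only [u]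
      split_ifs with h0
      · exact Nat.zero_le _
      · refine hg ?_ hx hb.1.le
        have := hmem (vtx M x - 1) (by have := (vtx M x).2; omega)
        rwa [Nat.sub_add_cancel (Nat.pos_of_ne_zero h0)] at this
    omega
  have hle : unitMeas {x | g x ≠ g (((vtx M x : ℝ) + 1) / M)} ≤ unitMeas (⋃ b ∈ J, vtx M ⁻¹' {b}) :=
    measure_mono_ae hsub
  calc unitMeas.real {x | g x ≠ g (((vtx M x : ℝ) + 1) / M)}
      ≤ unitMeas.real (⋃ b ∈ J, vtx M ⁻¹' {b}) :=
        ENNReal.toReal_mono (measure_ne_top _ _) hle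
    _ ≤ ∑ b ∈ J, unitMeas.real (vtx M ⁻¹' {b}) := measureReal_biUnion_finset_le _ _
    _ = J.card * (1 / M) := by simp [unitMeas_real_vtx]
    _ ≤ T / M := by
        rw [mul_one_div]
        gcongr

lemma L1dist_comp_label_le {L : Type*} [Finite L] [MeasurableSpace L] [DiscreteMeasurableSpace L]
    {v : L → L → ℝ} {b m : ℝ} (hv : ∀ a b', |v a b'| ≤ b) {φ ψ : ℝ → L}
    (hφ : Measurable φ) (hψ : Measurable ψ) (hm : unitMeas.real {x | φ x ≠ ψ x} ≤ m) :
    L1dist (fun x y => v (φ x) (φ y)) (fun x y => v (ψ x) (ψ y)) ≤ 4 * b * m := by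
  classical
  have hb : 0 ≤ b := (abs_nonneg _).trans (hv (φ 0) (φ 0))
  have hk : ∀ {φ : ℝ → L}, Measurable φ → IsKer fun x y => v (φ x) (φ y) := fun {φ} hφ =>
    ⟨(measurable_of_finite (Function.uncurry v)).comp
      ((hφ.comp measurable_fst).prodMk (hφ.comp measurable_snd)), b, fun x y => hv _ _⟩
  set D := {x | φ x ≠ ψ x} with hD
  have hDm : MeasurableSet D := by
    have : D = (fun x => (φ x, ψ x)) ⁻¹' {q | q.1 ≠ q.2} := rfl
    rw [this]
    exact (hφ.prodMk hψ) (Set.toFinite _).measurableSet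
  have hi : ∀ {s : Set (ℝ × ℝ)}, MeasurableSet s →
      Integrable (s.indicator fun _ => (2 * b : ℝ)) sqMeas := fun hs =>
    (integrable_const _).indicator hs
  have m1 : MeasurableSet (D ×ˢ (Set.univ : Set ℝ)) := hDm.prod MeasurableSet.univ
  have m2 : MeasurableSet ((Set.univ : Set ℝ) ×ˢ D) := MeasurableSet.univ.prod hDm
  rw [L1dist_eq]
  calc ∫ p, |v (φ p.1) (φ p.2) - v (ψ p.1) (ψ p.2)| ∂sqMeas
      ≤ ∫ p, ((D ×ˢ (Set.univ : Set ℝ)).indicator (fun _ => (2 * b : ℝ)) p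
          + ((Set.univ : Set ℝ) ×ˢ D).indicator (fun _ => (2 * b : ℝ)) p) ∂sqMeas := by
        refine integral_mono ((hk hφ).sub (hk hψ)).integrable.abs ((hi m1).add (hi m2)) fun p => ?_
        by_cases h1 : p.1 ∈ D <;> by_cases h2 : p.2 ∈ D
        · have := (abs_sub _ _).trans (add_le_add (hv (φ p.1) (φ p.2)) (hv (ψ p.1) (ψ p.2)))
          simp [Set.indicator, h1, h2]; linarith
        · have := (abs_sub _ _).trans (add_le_add (hv (φ p.1) (φ p.2)) (hv (ψ p.1) (ψ p.2)))
          simp [Set.indicator, h1, h2]; linarith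
        · have := (abs_sub _ _).trans (add_le_add (hv (φ p.1) (φ p.2)) (hv (ψ p.1) (ψ p.2)))
          simp [Set.indicator, h1, h2]; linarith
        · simp only [hD, Set.mem_ofPred_eq, not_not] at h1 h2
          simp [Set.indicator, hD, h1, h2]
    _ = 4 * b * unitMeas.real D := by
        rw [integral_add (hi m1) (hi m2), integral_indicator_const _ m1,
          integral_indicator_const _ m2, sqMeas, measureReal_prod_prod, measureReal_prod_prod]
        simp
        ring
    _ ≤ 4 * b * m := by gcongr

lemma exists_bounded_matrix_approx {ε : ℝ} (hε : 0 < ε) :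
    ∃ (M : ℕ) (_ : NeZero M) (k : ℝ), ∀ W, IsGraphon W →
      ∃ B : Fin M → Fin M → ℝ, (∀ i j, |B i j| ≤ k) ∧ cutMetric W (stepK B) < ε := by
  obtain ⟨k, hk⟩ := exists_regular_approx (ε := ε / 4) (by linarith)
  obtain ⟨M, hM⟩ := exists_nat_gt (4 * k * 4 ^ k / (ε / 4))
  have hM' : (0:ℝ) < M := lt_of_le_of_lt (by positivity) hM
  have hM0 : NeZero M := ⟨by rintro rfl; simp at hM'⟩
  refine ⟨M, hM0, k, fun W hW => ?_⟩
  obtain ⟨N, hN⟩ := exists_stepK_near hW.1 hW.2.1 hW.2.2 (ε := ε / 4) (by linarith)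
  obtain ⟨n, _, hNn⟩ : ∃ (n : ℕ) (_ : NeZero n), N ≤ n := ⟨N + 1, inferInstance, by omega⟩
  obtain ⟨A, -, hA, hWA⟩ := hN n hNn
  obtain ⟨f, v, hv, hcut⟩ := hk n A fun i j => by
    rw [abs_le]; constructor <;> linarith [(hA i j).1, (hA i j).2]
  set π := Tuple.sort f
  have hmono : Monotone (f ∘ π) := Tuple.monotone_sort f
  let φ : ℝ → Fin (4 ^ k) := fun x => f (π (vtx n x))
  let lab : Fin M → Fin (4 ^ k) := fun b => φ (((b:ℝ) + 1) / M)
  let B : Fin M → Fin M → ℝ := fun a b => v (lab a) (lab b)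
  refine ⟨B, fun i j => hv _ _, ?_⟩
  have kW := hW.isKer
  have kA := isKer_stepK A
  have kV := isKer_stepK fun i j => v (f i) (f j)
  have kB := isKer_stepK B
  have d1 : cutDist W (stepK A) < ε / 4 := (cutDist_le_L1dist kW kA).trans_lt hWA
  have d2 : cutDist (stepK A) (stepK fun i j => v (f i) (f j)) ≤ ε / 4 := cutDist_stepK_le hcut
  have hφ : Measurable φ := (measurable_of_finite (f ∘ π)).comp (measurable_vtx n)
  have hψ : Measurable fun x => lab (vtx M x) := (measurable_of_finite lab).comp (measurable_vtx M)
  have d3 : cutDist (relabel (blockPerm π) (stepK fun i j => v (f i) (f j))) (stepK B) ≤ ε / 4 := by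
    refine (cutDist_le_L1dist (kV.relabel _) kB).trans ?_
    rw [L1dist_congr (relabel_blockPerm_stepK π _) (ae_of_all _ fun p => rfl)]
    have hs := measure_ne_sample_le (g := fun x => (φ x : ℕ)) (T := 4 ^ k) (fun x hx y hy hxy => ?_)
      (fun x => (φ x).2.le) M
    · have := L1dist_comp_label_le (m := ((4 ^ k : ℕ) : ℝ) / M) hv hφ hψ (by
        simpa only [ne_eq, Fin.val_inj] using hs)
      refine le_trans this ?_
      rw [div_lt_iff₀ (by linarith)] at hM
      rw [← mul_div_assoc, div_le_iff₀ hM']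
      push_cast
      linarith
    · refine hmono ?_
      rw [Fin.le_def]
      have hx' := vertexOf_le_iff (NeZero.pos n) hx
      have hy' := vertexOf_le_iff (NeZero.pos n) hy
      have : vertexOf n x ≤ vertexOf n y := Int.toNat_le_toNat (Int.ceil_le_ceil (by gcongr))
      simp only [vtx]
      omega
  have m1 := cutMetric_triangle kW kA kB
  have m2 := cutMetric_triangle kA kV kB
  have m3 := cutMetric_le_cutDist kW kA
  have m4 := cutMetric_le_cutDist kA kV
  have m5 := cutMetric_le kV kB (blockPerm π)
    (MPBij.mk id (Set.bijOn_id _) (MeasurePreserving.id _))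
  rw [relabel_id] at m5
  linarith

lemma totallyBounded_graphon : TotallyBounded (Set.univ : Set Graphon) := by
  refine Metric.totallyBounded_of_finite_discretization fun ε hε => ?_
  obtain ⟨M, _, k, hB⟩ := exists_bounded_matrix_approx (ε := ε / 4) (by linarith)
  choose! B hBk hBW using hB
  have hcomp : TotallyBounded (Metric.closedBall (0 : Fin M → Fin M → ℝ) k) :=
    (isCompact_closedBall _ _).totallyBounded
  obtain ⟨t, ht, hcov⟩ := Metric.totallyBounded_iff.1 hcomp (ε / 4) (by linarith)
  have hmem : ∀ W : Graphon, ∃ c : t, dist (B W.1) c.1 < ε / 4 := fun W => by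
    have : B W.1 ∈ Metric.closedBall (0 : Fin M → Fin M → ℝ) k := by
      have h0 : 0 ≤ k := (abs_nonneg _).trans (hBk W.1 W.2 0 0)
      rw [mem_closedBall_zero_iff, pi_norm_le_iff_of_nonneg h0]
      intro i
      rw [pi_norm_le_iff_of_nonneg h0]
      exact hBk W.1 W.2 i
    have := hcov this
    simp only [Set.mem_iUnion, Metric.mem_ball] at this
    obtain ⟨c, hc, hd⟩ := this
    exact ⟨⟨c, hc⟩, hd⟩
  choose F hF using hmem
  have := ht.to_subtype
  have hfin : Fintype t := Fintype.ofFinite t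
  refine ⟨t, hfin, fun W => F W.1, fun x y hxy => ?_⟩
  have hstep : ∀ W : Graphon, cutMetric W.1 (stepK (F W).1) < ε / 2 := fun W => by
    have h1 := cutMetric_triangle W.2.isKer (isKer_stepK (B W.1)) (isKer_stepK (F W).1)
    have h2 := cutMetric_le_cutDist (isKer_stepK (B W.1)) (isKer_stepK (F W).1)
    have h3 : cutDist (stepK (B W.1)) (stepK (F W).1) ≤ ε / 4 := by
      refine (cutDist_le_L1dist (isKer_stepK _) (isKer_stepK _)).trans ?_
      rw [L1dist_stepK, div_le_iff₀ (by have := NeZero.pos M; positivity)]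
      calc ∑ i, ∑ j, |B W.1 i j - (F W).1 i j| ≤ ∑ i : Fin M, ∑ j : Fin M, ε / 4 :=
            Finset.sum_le_sum fun i _ => Finset.sum_le_sum fun j _ => by
              have a := dist_le_pi_dist (B W.1) (F W).1 i
              have b := dist_le_pi_dist (B W.1 i) ((F W).1 i) j
              rw [Real.dist_eq] at b
              linarith [hF W]
        _ = ε / 4 * (M:ℝ) ^ 2 := by simp; ring
    linarith [hBW W.1 W.2]
  have h1 := hstep x.1
  have h2 := hstep y.1
  have hxy' : F y.1 = F x.1 := hxy.symm
  rw [hxy'] at h2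
  rw [Graphon.dist_def]
  have h3 := cutMetric_triangle x.1.2.isKer (isKer_stepK (F x.1).1) y.1.2.isKer
  rw [cutMetric_comm (isKer_stepK _) y.1.2.isKer] at h3
  linarith

end

/-! ### Completeness and compactness of the space of graphons -/

noncomputable section

/-- Weak limits of sequences of functions with values in `[0,1]`. -/
lemma exists_weak_limit {f : ℕ → ℝ × ℝ → ℝ} (hf : ∀ n, Measurable (f n))
    (h01 : ∀ n p, f n p ∈ Set.Icc (0:ℝ) 1) :
    ∃ u : ℝ × ℝ → ℝ, Measurable u ∧ (∀ p, u p ∈ Set.Icc (0:ℝ) 1) ∧ ∀ s, MeasurableSet s →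
      Tendsto (fun n => ∫ p in s, f n p ∂sqMeas) (hyperfilter ℕ)
        (nhds (∫ p in s, u p ∂sqMeas)) := by
  have hL : ∀ n, MemLp (f n) 2 sqMeas := fun n =>
    MemLp.of_bound (hf n).aestronglyMeasurable 1 (ae_of_all _ fun p => by
      rw [Real.norm_eq_abs, abs_le]; constructor <;> linarith [(h01 n p).1, (h01 n p).2])
  let φ : ℕ → WeakDual ℝ (Lp ℝ 2 sqMeas) := fun n =>
    StrongDual.toWeakDual (InnerProductSpace.toDual ℝ _ ((hL n).toLp (f n)))
  have hφ : ∀ n, φ n ∈ WeakDual.toStrongDual ⁻¹'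
      Metric.closedBall (0 : StrongDual ℝ (Lp ℝ 2 sqMeas)) 1 := fun n => by
    rw [Set.mem_preimage, mem_closedBall_zero_iff]
    change ‖InnerProductSpace.toDual ℝ _ ((hL n).toLp (f n))‖ ≤ 1
    rw [LinearIsometryEquiv.norm_map]
    refine (Lp.norm_le_of_ae_bound (C := 1) zero_le_one ?_).trans (by
      simp [measureUnivNNReal])
    filter_upwards [(hL n).coeFn_toLp] with p hp
    rw [hp, Real.norm_eq_abs, abs_le]
    constructor <;> linarith [(h01 n p).1, (h01 n p).2]
  obtain ⟨ψ, -, hψ⟩ := (WeakDual.isCompact_closedBall (𝕜 := ℝ)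
    (0 : StrongDual ℝ (Lp ℝ 2 sqMeas)) 1).ultrafilter_le_nhds ((hyperfilter ℕ).map φ)
    (by
      rw [le_principal_iff, Ultrafilter.mem_coe, Ultrafilter.mem_map]
      exact Filter.univ_mem' hφ)
  let w : Lp ℝ 2 sqMeas := (InnerProductSpace.toDual ℝ _).symm (WeakDual.toStrongDual ψ)
  have hw : ∀ s, MeasurableSet s → Tendsto (fun n => ∫ p in s, f n p ∂sqMeas) (hyperfilter ℕ)
      (nhds (∫ p in s, w p ∂sqMeas)) := fun s hs => by
    let e : Lp ℝ 2 sqMeas := indicatorConstLp 2 hs (measure_ne_top _ _) (1:ℝ)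
    have h1 : Tendsto (fun n => φ n e) (hyperfilter ℕ) (nhds (ψ e)) :=
      ((WeakDual.eval_continuous e).tendsto ψ).comp hψ
    have h2 : ∀ n, φ n e = ∫ p in s, f n p ∂sqMeas := fun n => by
      change inner ℝ ((hL n).toLp (f n)) e = _
      rw [real_inner_comm, L2.inner_indicatorConstLp_one]
      refine setIntegral_congr_ae hs ?_
      filter_upwards [(hL n).coeFn_toLp] with p hp _ using hp
    have h3 : ψ e = ∫ p in s, w p ∂sqMeas := by
      rw [← L2.inner_indicatorConstLp_one (𝕜 := ℝ) hs (measure_ne_top _ _) w, real_inner_comm,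
        InnerProductSpace.toDual_symm_apply]
      rfl
    rw [← h3]
    exact h1.congr h2
  have hwi : Integrable w sqMeas := (Lp.memLp w).integrable (by norm_num)
  have hfi : ∀ n, Integrable (f n) sqMeas := fun n => (hL n).integrable (by norm_num)
  have h0 : 0 ≤ᵐ[sqMeas] w := ae_nonneg_of_forall_setIntegral_nonneg hwi fun s hs _ =>
    ge_of_tendsto' (hw s hs) fun n => integral_nonneg fun p => (h01 n p).1
  have h1 : w ≤ᵐ[sqMeas] fun _ => (1:ℝ) :=
    ae_le_of_forall_setIntegral_le hwi (integrable_const _) fun s hs _ =>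
      le_of_tendsto' (hw s hs) fun n =>
        integral_mono (hfi n).integrableOn (integrable_const _) fun p => (h01 n p).2
  have hwm : AEMeasurable w sqMeas := (Lp.aestronglyMeasurable w).aemeasurable
  refine ⟨fun p => max 0 (min 1 (hwm.mk w p)), measurable_const.max
    (measurable_const.min hwm.measurable_mk), fun p => ⟨le_max_left _ _, max_le zero_le_one
      (min_le_left _ _)⟩, fun s hs => ?_⟩
  have : ∫ p in s, max 0 (min 1 (hwm.mk w p)) ∂sqMeas = ∫ p in s, w p ∂sqMeas := by
    refine setIntegral_congr_ae hs ?_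
    filter_upwards [h0, h1, hwm.ae_eq_mk] with p a b c _
    rw [← c, min_eq_right b]
    exact max_eq_right a
  rw [this]
  exact hw s hs

lemma setIntegral_rect_swap {S T : Set ℝ} (hS : MeasurableSet S) (hT : MeasurableSet T)
    (f : ℝ × ℝ → ℝ) :
    ∫ p in S ×ˢ T, f p.swap ∂sqMeas = ∫ p in T ×ˢ S, f p ∂sqMeas := by
  rw [← integral_indicator (hS.prod hT), ← integral_indicator (hT.prod hS),
    ← integral_swap_sq]
  congr 1
  ext p
  by_cases h1 : p.2 ∈ S <;> by_cases h2 : p.1 ∈ T <;>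
    simp [Set.indicator, Set.mem_prod, h1, h2]

lemma exists_graphon_weak_limit {U : ℕ → ℝ → ℝ → ℝ} (hU : ∀ n, IsGraphon (U n)) :
    ∃ V, IsGraphon V ∧ ∀ S T : Set ℝ, MeasurableSet S → MeasurableSet T →
      Tendsto (fun n => ∫ p in S ×ˢ T, U n p.1 p.2 ∂sqMeas) (hyperfilter ℕ)
        (nhds (∫ p in S ×ˢ T, V p.1 p.2 ∂sqMeas)) := by
  obtain ⟨u, hu, h01, hlim⟩ := exists_weak_limit (f := fun n p => U n p.1 p.2)
    (fun n => (hU n).isKer.measurable) fun n p => (hU n).2.2 _ _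
  have hsw : Measurable fun p : ℝ × ℝ => u p.swap := hu.comp measurable_swap
  refine ⟨fun x y => (u (x, y) + u (y, x)) / 2, ⟨(hu.add hsw).div_const 2,
    fun x y => by simp only [add_comm], fun x y => ?_⟩, fun S T hS hT => ?_⟩
  · have h1 := h01 (x, y)
    have h2 := h01 (y, x)
    constructor <;> linarith [h1.1, h1.2, h2.1, h2.2]
  · have i1 : Integrable u sqMeas := integrable_of_bound hu (B := 1) fun p => by
      rw [abs_le]; constructor <;> linarith [(h01 p).1, (h01 p).2]
    have i2 : Integrable (fun p : ℝ × ℝ => u p.swap) sqMeas :=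
      integrable_of_bound hsw (B := 1) fun p => by
        rw [abs_le]; constructor <;> linarith [(h01 p.swap).1, (h01 p.swap).2]
    have e1 : ∫ p in S ×ˢ T, (u (p.1, p.2) + u (p.2, p.1)) / 2 ∂sqMeas
        = (∫ p in S ×ˢ T, u p ∂sqMeas + ∫ p in T ×ˢ S, u p ∂sqMeas) / 2 := by
      rw [integral_div, ← setIntegral_rect_swap hS hT, ← integral_add i1.integrableOn
        i2.integrableOn]
      rfl
    have e2 : ∀ n, ∫ p in S ×ˢ T, U n p.1 p.2 ∂sqMeas
        = (∫ p in S ×ˢ T, U n p.1 p.2 ∂sqMeas + ∫ p in T ×ˢ S, U n p.1 p.2 ∂sqMeas) / 2 := by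
      intro n
      have : ∫ p in T ×ˢ S, U n p.1 p.2 ∂sqMeas = ∫ p in S ×ˢ T, U n p.1 p.2 ∂sqMeas := by
        rw [← setIntegral_rect_swap hS hT fun p => U n p.1 p.2]
        simp_rw [Prod.fst_swap, Prod.snd_swap, (hU n).2.1 (Prod.snd _) (Prod.fst _)]
      rw [this]; ring
    rw [e1]
    exact (((hlim _ (hS.prod hT)).add (hlim _ (hT.prod hS))).div_const 2).congr fun n =>
      (e2 n).symm

instance completeSpace_graphon : CompleteSpace Graphon := by
  refine Metric.complete_of_convergent_controlled_sequences (fun n => (1 / 2) ^ n) (by simp) ?_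
  intro u hu
  have hstep : ∀ n, ∃ σ, cutDist (u n).1 (relabel σ (u (n + 1)).1) < (1 / 2 : ℝ) ^ n := fun n =>
    exists_of_cutMetric_lt (u n).2.isKer (u (n + 1)).2.isKer (hu n n (n + 1) le_rfl (by omega))
  choose σ hσ using hstep
  let τ : ℕ → MPBij := fun n => Nat.rec ⟨id, Set.bijOn_id _, MeasurePreserving.id _⟩
    (fun n t => (σ n).comp t) n
  let U : ℕ → ℝ → ℝ → ℝ := fun n => relabel (τ n) (u n).1
  have hU : ∀ n, IsGraphon (U n) := fun n => (u n).2.relabel _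
  have hU1 : ∀ n, cutDist (U n) (U (n + 1)) < (1 / 2 : ℝ) ^ n := fun n => by
    have : U (n + 1) = relabel (τ n) (relabel (σ n) (u (n + 1)).1) := rfl
    rw [this, cutDist_relabel (u n).2.isKer ((u (n + 1)).2.relabel _).isKer]
    exact hσ n
  have hU2 : ∀ n k, cutDist (U n) (U (n + k))
      ≤ 2 * (1 / 2 : ℝ) ^ n - 2 * (1 / 2 : ℝ) ^ (n + k) := by
    intro n k
    induction k with
    | zero =>
      have : cutDist (U n) (U n) ≤ 0 := cutDist_le fun S T _ _ => by simp
      simpa using this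
    | succ k ih =>
      have h1 := cutDist_triangle (hU n).isKer (hU (n + k)).isKer (hU (n + k + 1)).isKer
      have h2 := hU1 (n + k)
      have h3 : (1 / 2 : ℝ) ^ (n + (k + 1)) = (1 / 2 : ℝ) ^ (n + k) * (1 / 2) := by
        rw [← add_assoc, pow_succ]
      rw [h3]
      change cutDist (U n) (U (n + k + 1)) ≤ _
      linarith
  obtain ⟨V, hV, hlim⟩ := exists_graphon_weak_limit hU
  have hcut : ∀ n, cutDist (U n) V ≤ 2 * (1 / 2 : ℝ) ^ n := by
    intro n
    refine cutDist_le fun S T hS hT => ?_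
    rw [integral_sub (hU n).isKer.integrable.integrableOn hV.isKer.integrable.integrableOn]
    refine le_of_tendsto ((tendsto_const_nhds.sub (hlim S T hS hT)).abs) ?_
    have hev : ∀ᶠ m in (hyperfilter ℕ : Filter ℕ), n ≤ m :=
      Nat.hyperfilter_le_atTop (eventually_ge_atTop n)
    filter_upwards [hev] with m hm
    obtain ⟨k, rfl⟩ := Nat.exists_eq_add_of_le hm
    rw [← integral_sub (hU n).isKer.integrable.integrableOn
      (hU (n + k)).isKer.integrable.integrableOn]
    refine (le_cutDist (hU n).isKer (hU (n + k)).isKer hS hT).trans ((hU2 n k).trans ?_)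
    have : 0 ≤ 2 * (1 / 2 : ℝ) ^ (n + k) := by positivity
    linarith
  let V' : Graphon := ⟨V, hV⟩
  refine ⟨V', ?_⟩
  rw [tendsto_iff_dist_tendsto_zero]
  refine squeeze_zero (fun n => dist_nonneg) (g := fun n => 2 * (1 / 2 : ℝ) ^ n) (fun n => ?_) ?_
  · rw [dist_comm, Graphon.dist_def]
    refine (cutMetric_le_relabel_right hV.isKer (u n).2.isKer (τ n)).trans ?_
    rw [cutDist_comm]
    exact hcut n
  · simpa using (tendsto_pow_atTop_nhds_zero_of_lt_one (by norm_num : (0:ℝ) ≤ 1 / 2)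
      (by norm_num)).const_mul 2

instance compactSpace_graphon : CompactSpace Graphon :=
  ⟨isCompact_iff_totallyBounded_isComplete.2 ⟨totallyBounded_graphon, isComplete_univ⟩⟩

end

/-! ### Log-likelihoods and relative entropy -/

noncomputable section

/-- Log-likelihood of a Bernoulli(`b`) variable, averaged against a Bernoulli(`a`) one. -/
def ll (a b : ℝ) : ℝ := a * Real.log b + (1 - a) * Real.log (1 - b)

lemma ll_sub (a a' b : ℝ) : ll a b - ll a' b = (a - a') * (Real.log b - Real.log (1 - b)) := by
  unfold ll; ring

lemma abs_log_sub_log_le {η x y : ℝ} (hη : 0 < η) (hx : η ≤ x) (hy : η ≤ y) :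
    |Real.log x - Real.log y| ≤ |x - y| / η := by
  have hx0 := hη.trans_le hx
  have hy0 := hη.trans_le hy
  have key : ∀ {x y : ℝ}, η ≤ x → η ≤ y → Real.log x - Real.log y ≤ |x - y| / η := by
    intro x y hx hy
    have hx0 := hη.trans_le hx
    have hy0 := hη.trans_le hy
    rw [← Real.log_div hx0.ne' hy0.ne']
    refine (Real.log_le_sub_one_of_pos (div_pos hx0 hy0)).trans ?_
    have : x / y - 1 = (x - y) / y := by field_simp
    rw [this]
    calc (x - y) / y ≤ |x - y| / y := by gcongr; exact le_abs_self _
      _ ≤ |x - y| / η := by gcongr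
  rw [abs_le]
  have h1 := key hx hy
  have h2 := key hy hx
  rw [abs_sub_comm] at h2
  constructor <;> linarith

lemma abs_log_le {η x : ℝ} (hη : 0 < η) (hx : η ≤ x) (hx1 : x ≤ 1) : |Real.log x| ≤ 1 / η := by
  have := abs_log_sub_log_le hη hx (hx.trans hx1)
  rw [Real.log_one, sub_zero] at this
  refine this.trans ?_
  gcongr
  rw [abs_le]
  constructor <;> linarith [hη.trans_le hx]

lemma abs_ll_sub_le {η a b b' : ℝ} (hη : 0 < η) (ha : a ∈ Set.Icc (0:ℝ) 1)
    (hb : b ∈ Set.Icc η (1 - η)) (hb' : b' ∈ Set.Icc η (1 - η)) :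
    |ll a b - ll a b'| ≤ |b - b'| / η := by
  have h1 := abs_log_sub_log_le hη hb.1 hb'.1
  have h2 := abs_log_sub_log_le hη (x := 1 - b) (y := 1 - b') (by linarith [hb.2])
    (by linarith [hb'.2])
  have e : |1 - b - (1 - b')| = |b - b'| := by rw [abs_sub_comm]; congr 1; ring
  rw [e] at h2
  have e2 : ll a b - ll a b' = a * (Real.log b - Real.log b')
      + (1 - a) * (Real.log (1 - b) - Real.log (1 - b')) := by unfold ll; ring
  rw [e2]
  refine (abs_add_le _ _).trans ?_
  rw [abs_mul, abs_mul, abs_of_nonneg ha.1, abs_of_nonneg (by linarith [ha.2] : 0 ≤ 1 - a)]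
  have := add_le_add (mul_le_mul_of_nonneg_left h1 ha.1)
    (mul_le_mul_of_nonneg_left h2 (by linarith [ha.2] : 0 ≤ 1 - a))
  linarith [this]

lemma abs_ll_le {η a b : ℝ} (hη : 0 < η) (ha : a ∈ Set.Icc (0:ℝ) 1)
    (hb : b ∈ Set.Icc η (1 - η)) : |ll a b| ≤ 1 / η := by
  have h1 := abs_log_le hη hb.1 (by linarith [hb.2])
  have h2 := abs_log_le hη (x := 1 - b) (by linarith [hb.2]) (by linarith [hb.1])
  unfold ll
  refine (abs_add_le _ _).trans ?_
  rw [abs_mul, abs_mul, abs_of_nonneg ha.1, abs_of_nonneg (by linarith [ha.2] : 0 ≤ 1 - a)]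
  have := add_le_add (mul_le_mul_of_nonneg_left h1 ha.1)
    (mul_le_mul_of_nonneg_left h2 (by linarith [ha.2] : 0 ≤ 1 - a))
  linarith [this]

lemma ll_self (a : ℝ) : ll a a = -Real.binEntropy a := by
  rw [Real.binEntropy_eq_negMulLog_add_negMulLog_one_sub]
  simp only [ll, Real.negMulLog]
  ring

/-- Smoothing towards `1/2` costs little likelihood. -/
lemma ll_smooth {a δ : ℝ} (ha : a ∈ Set.Icc (0:ℝ) 1) (hδ : δ ∈ Set.Ioo (0:ℝ) 1) :
    ll a a + Real.log (1 - δ) ≤ ll a ((1 - δ) * a + δ / 2) := by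
  have key : ∀ x : ℝ, 0 ≤ x → x * Real.log x + x * Real.log (1 - δ)
      ≤ x * Real.log ((1 - δ) * x + δ / 2) := by
    intro x hx
    rcases hx.eq_or_lt with rfl | hx
    · simp
    · rw [← mul_add, ← Real.log_mul hx.ne' (by linarith [hδ.2])]
      have h0 : 0 < x * (1 - δ) := mul_pos hx (by linarith [hδ.2])
      refine mul_le_mul_of_nonneg_left (Real.log_le_log h0 ?_) hx.le
      linarith [hδ.1]
  have h1 := key a ha.1
  have h2 := key (1 - a) (by linarith [ha.2])
  have e : 1 - ((1 - δ) * a + δ / 2) = (1 - δ) * (1 - a) + δ / 2 := by ring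
  unfold ll
  rw [e]
  linarith

lemma ll_le_ll_self {a b : ℝ} (ha : a ∈ Set.Icc (0:ℝ) 1) (hb : b ∈ Set.Ioo (0:ℝ) 1) :
    ll a b ≤ ll a a := by
  have key : ∀ x y : ℝ, 0 ≤ x → 0 < y → x * Real.log y ≤ x * Real.log x + (y - x) := by
    intro x y hx hy
    rcases hx.eq_or_lt with rfl | hx
    · simpa using hy.le
    · have := Real.log_le_sub_one_of_pos (div_pos hy hx)
      rw [Real.log_div hy.ne' hx.ne'] at this
      have := mul_le_mul_of_nonneg_left this hx.le
      have e : x * (y / x - 1) = y - x := by field_simp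
      rw [e] at this
      linarith
  have h1 := key a b ha.1 hb.1
  have h2 := key (1 - a) (1 - b) (by linarith [ha.2]) (by linarith [hb.2])
  unfold ll
  linarith

lemma relEnt_eq {a b : ℝ} (ha : a ∈ Set.Icc (0:ℝ) 1) (hb : b ∈ Set.Ioo (0:ℝ) 1) :
    relEnt a b = ENNReal.ofReal (ll a a - ll a b) := by
  rw [relEnt, if_neg (not_le.2 hb.1), if_neg (not_le.2 hb.2)]
  congr 1
  have key : ∀ x y : ℝ, 0 ≤ x → 0 < y → x * Real.log (x / y) = x * Real.log x - x * Real.log y := by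
    intro x y hx hy
    rcases hx.eq_or_lt with rfl | hx
    · simp
    · rw [Real.log_div hx.ne' hy.ne']; ring
  rw [key a b ha.1 hb.1, key (1 - a) (1 - b) (by linarith [ha.2]) (by linarith [hb.2])]
  unfold ll
  ring

lemma exists_abs_ll_self_sub_le {ε : ℝ} (hε : 0 < ε) :
    ∃ C > 0, ∀ a ∈ Set.Icc (0:ℝ) 1, ∀ b ∈ Set.Icc (0:ℝ) 1,
      |ll a a - ll b b| ≤ ε + C * |a - b| := by
  have hc : UniformContinuousOn Real.binEntropy (Set.Icc (0:ℝ) 1) :=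
    isCompact_Icc.uniformContinuousOn_of_continuous Real.binEntropy_continuous.continuousOn
  obtain ⟨δ, hδ, h⟩ := Metric.uniformContinuousOn_iff.1 hc ε hε
  have hbd : ∀ a ∈ Set.Icc (0:ℝ) 1, |Real.binEntropy a| ≤ Real.log 2 := fun a ha => by
    rw [abs_of_nonneg (Real.binEntropy_nonneg ha.1 ha.2)]
    exact Real.binEntropy_le_log_two
  have hl := Real.log_pos (by norm_num : (1:ℝ) < 2)
  refine ⟨2 * Real.log 2 / δ, by positivity, fun a ha b hb => ?_⟩
  have e : |ll a a - ll b b| = |Real.binEntropy a - Real.binEntropy b| := by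
    rw [ll_self, ll_self, abs_sub_comm]; congr 1; ring
  rw [e]
  by_cases hab : dist a b < δ
  · have := (h a ha b hb hab).le
    rw [Real.dist_eq] at this
    have h0 : 0 ≤ 2 * Real.log 2 / δ * |a - b| := by positivity
    linarith
  · rw [not_lt, Real.dist_eq] at hab
    have h1 : |Real.binEntropy a - Real.binEntropy b| ≤ 2 * Real.log 2 :=
      (abs_sub _ _).trans (by linarith [hbd a ha, hbd b hb])
    have h2 : 2 * Real.log 2 ≤ 2 * Real.log 2 / δ * |a - b| := by
      rw [div_mul_eq_mul_div, le_div_iff₀ hδ]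
      gcongr
    linarith

lemma measurable_ll : Measurable fun q : ℝ × ℝ => ll q.1 q.2 := by
  unfold ll
  fun_prop

/-- Integrated log-likelihood. -/
def llI (h r : ℝ → ℝ → ℝ) : ℝ := ∫ p, ll (h p.1 p.2) (r p.1 p.2) ∂sqMeas

lemma isKer_ll {η : ℝ} (hη : 0 < η) {h r : ℝ → ℝ → ℝ} (hh : IsGraphon h) (hr : IsKer r)
    (hrη : ∀ x y, r x y ∈ Set.Icc η (1 - η)) : IsKer fun x y => ll (h x y) (r x y) :=
  ⟨measurable_ll.comp (hh.isKer.measurable.prodMk hr.measurable), 1 / η, fun x y =>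
    abs_ll_le hη (hh.2.2 x y) (hrη x y)⟩

lemma isKer_ll_self {h : ℝ → ℝ → ℝ} (hh : IsGraphon h) : IsKer fun x y => ll (h x y) (h x y) :=
  ⟨measurable_ll.comp (hh.isKer.measurable.prodMk hh.isKer.measurable), Real.log 2, fun x y => by
    change |ll (h x y) (h x y)| ≤ Real.log 2
    rw [ll_self, abs_neg, abs_of_nonneg (Real.binEntropy_nonneg (hh.2.2 x y).1 (hh.2.2 x y).2)]
    exact Real.binEntropy_le_log_two⟩

lemma llI_relabel {h r : ℝ → ℝ → ℝ} (hh : IsKer h) (hr : IsKer r) (σ : MPBij) :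
    llI (relabel σ h) (relabel σ r) = llI h r :=
  σ.integral_comp (f := fun p => ll (h p.1 p.2) (r p.1 p.2))
    (measurable_ll.comp (hh.measurable.prodMk hr.measurable)).aestronglyMeasurable

lemma llI_congr {h h' r r' : ℝ → ℝ → ℝ} (h1 : ∀ᵐ p ∂sqMeas, h p.1 p.2 = h' p.1 p.2)
    (h2 : ∀ᵐ p ∂sqMeas, r p.1 p.2 = r' p.1 p.2) : llI h r = llI h' r' := by
  refine integral_congr_ae ?_
  filter_upwards [h1, h2] with p a b
  rw [a, b]

lemma Irate_congr {h r r' : ℝ → ℝ → ℝ} (h2 : ∀ᵐ p ∂sqMeas, r p.1 p.2 = r' p.1 p.2) :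
    Irate r h = Irate r' h := by
  rw [Irate, Irate, restrict_unitSq]
  refine lintegral_congr_ae ?_
  filter_upwards [h2] with p b
  rw [b]

lemma Irate_eq {η : ℝ} (hη : 0 < η) {h r : ℝ → ℝ → ℝ} (hh : IsGraphon h) (hr : IsKer r)
    (hrη : ∀ x y, r x y ∈ Set.Icc η (1 - η)) :
    Irate r h = ENNReal.ofReal (llI h h - llI h r) ∧ 0 ≤ llI h h - llI h r := by
  have hr01 : ∀ x y, r x y ∈ Set.Ioo (0:ℝ) 1 := fun x y =>
    ⟨hη.trans_le (hrη x y).1, by linarith [(hrη x y).2]⟩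
  have k1 := isKer_ll_self hh
  have k2 := isKer_ll hη hh hr hrη
  rw [llI, llI, ← integral_sub k1.integrable k2.integrable]
  have h0 : ∀ p : ℝ × ℝ, 0 ≤ ll (h p.1 p.2) (h p.1 p.2) - ll (h p.1 p.2) (r p.1 p.2) := fun p =>
    sub_nonneg.2 (ll_le_ll_self (hh.2.2 _ _) (hr01 _ _))
  refine ⟨?_, integral_nonneg h0⟩
  rw [Irate, restrict_unitSq, ofReal_integral_eq_lintegral_ofReal (k1.sub k2).integrable
    (ae_of_all _ h0)]
  exact lintegral_congr fun p => relEnt_eq (hh.2.2 _ _) (hr01 _ _)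

lemma abs_llI_sub_le {η : ℝ} (hη : 0 < η) {h r r' : ℝ → ℝ → ℝ} (hh : IsGraphon h) (hr : IsKer r)
    (hrη : ∀ x y, r x y ∈ Set.Icc η (1 - η)) (hr' : IsKer r')
    (hrη' : ∀ x y, r' x y ∈ Set.Icc η (1 - η)) :
    |llI h r - llI h r'| ≤ L1dist r r' / η := by
  have k1 := isKer_ll hη hh hr hrη
  have k2 := isKer_ll hη hh hr' hrη'
  rw [llI, llI, ← integral_sub k1.integrable k2.integrable, L1dist_eq, ← integral_div]
  refine (abs_integral_le_integral_abs).trans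
    (integral_mono (k1.sub k2).integrable.abs ((hr.sub hr').integrable.abs.div_const η) fun p => ?_)
  exact abs_ll_sub_le hη (hh.2.2 _ _) (hrη _ _) (hrη' _ _)

lemma exists_abs_llI_self_sub_le {ε : ℝ} (hε : 0 < ε) :
    ∃ C > 0, ∀ h k, IsGraphon h → IsGraphon k → |llI h h - llI k k| ≤ ε + C * L1dist h k := by
  obtain ⟨C, hC, H⟩ := exists_abs_ll_self_sub_le hε
  refine ⟨C, hC, fun h k hh hk => ?_⟩
  have k1 := isKer_ll_self hh
  have k2 := isKer_ll_self hk
  have i := (hh.isKer.sub hk.isKer).integrable.abs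
  rw [llI, llI, ← integral_sub k1.integrable k2.integrable, L1dist_eq, ← integral_const_mul]
  have e : ε + ∫ p, C * |h p.1 p.2 - k p.1 p.2| ∂sqMeas
      = ∫ p, (ε + C * |h p.1 p.2 - k p.1 p.2|) ∂sqMeas := by
    rw [integral_add (integrable_const _) (i.const_mul C)]; simp
  rw [e]
  refine (abs_integral_le_integral_abs).trans
    (integral_mono (k1.sub k2).integrable.abs ((integrable_const _).add (i.const_mul C))
      fun p => ?_)
  exact H _ (hh.2.2 _ _) _ (hk.2.2 _ _)

/-- The smoothing of a graphon towards `1/2`. -/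
def smooth (δ : ℝ) (h : ℝ → ℝ → ℝ) : ℝ → ℝ → ℝ := fun x y => (1 - δ) * h x y + δ / 2

lemma smooth_mem {δ a : ℝ} (hδ : δ ∈ Set.Ioo (0:ℝ) 1) (ha : a ∈ Set.Icc (0:ℝ) 1) :
    (1 - δ) * a + δ / 2 ∈ Set.Icc (δ / 2) (1 - δ / 2) := by
  have h1 : 0 ≤ (1 - δ) * a := mul_nonneg (by linarith [hδ.2]) ha.1
  have h2 : (1 - δ) * a ≤ 1 - δ := mul_le_of_le_one_right (by linarith [hδ.2]) ha.2
  constructor <;> linarith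

lemma IsGraphon.smooth {δ : ℝ} (hδ : δ ∈ Set.Ioo (0:ℝ) 1) {h : ℝ → ℝ → ℝ} (hh : IsGraphon h) :
    IsGraphon (smooth δ h) ∧ ∀ x y, _root_.smooth δ h x y ∈ Set.Icc (δ / 2) (1 - δ / 2) := by
  have hm : ∀ x y, _root_.smooth δ h x y ∈ Set.Icc (δ / 2) (1 - δ / 2) := fun x y =>
    smooth_mem hδ (hh.2.2 x y)
  refine ⟨⟨(hh.1.const_mul _).add_const _, fun x y => ?_, fun x y => ?_⟩, hm⟩
  · simp only [_root_.smooth]; rw [hh.2.1 x y]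
  · have := hm x y
    constructor <;> linarith [this.1, this.2, hδ.1]

lemma L1dist_smooth_le {δ : ℝ} (hδ : δ ∈ Set.Ioo (0:ℝ) 1) {h : ℝ → ℝ → ℝ} (hh : IsGraphon h) :
    L1dist h (smooth δ h) ≤ δ := by
  rw [L1dist_eq]
  have := integral_mono (μ := sqMeas) (hh.isKer.sub (hh.smooth hδ).1.isKer).integrable.abs
    (integrable_const δ) fun p => by
      change |h p.1 p.2 - ((1 - δ) * h p.1 p.2 + δ / 2)| ≤ δ
      have h01 := hh.2.2 p.1 p.2
      have e : h p.1 p.2 - ((1 - δ) * h p.1 p.2 + δ / 2) = δ * (h p.1 p.2 - 1 / 2) := by ring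
      rw [e, abs_mul, abs_of_pos hδ.1]
      refine mul_le_of_le_one_right hδ.1.le ?_
      rw [abs_le]
      constructor <;> linarith [h01.1, h01.2]
  simpa using this

lemma exists_stepK_llI_ge {h : ℝ → ℝ → ℝ} (hh : IsGraphon h) {ε : ℝ} (hε : 0 < ε) :
    ∃ (k : ℕ) (_ : NeZero k) (η : ℝ) (A : Fin k → Fin k → ℝ), 0 < η ∧ (∀ i j, A i j = A j i) ∧
      (∀ i j, A i j ∈ Set.Icc η (1 - η)) ∧ llI h h - ε ≤ llI h (stepK A) := by
  have hc : Tendsto (fun δ : ℝ => Real.log (1 - δ)) (nhds 0) (nhds (Real.log (1 - 0))) :=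
    (Real.continuousAt_log (by norm_num)).tendsto.comp
      ((continuous_const.sub continuous_id).tendsto 0)
  rw [sub_zero, Real.log_one] at hc
  have hc' : ∀ᶠ δ in nhdsWithin (0:ℝ) (Set.Ioi 0), -(ε / 2) < Real.log (1 - δ) ∧ δ < 1 :=
    ((hc.eventually (lt_mem_nhds (by linarith : -(ε / 2) < 0))).and
      (gt_mem_nhds one_pos)).filter_mono nhdsWithin_le_nhds
  obtain ⟨δ, ⟨hδ2, hδ1⟩, hδ0⟩ := (hc'.and self_mem_nhdsWithin).exists
  have hδ : δ ∈ Set.Ioo (0:ℝ) 1 := ⟨hδ0, hδ1⟩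
  have hδ0' : 0 < δ := hδ0
  obtain ⟨hs, hsm⟩ := hh.smooth hδ
  obtain ⟨N, hN⟩ := exists_stepK_near hs.1 hs.2.1 hsm (ε := δ / 2 * (ε / 2)) (by positivity)
  obtain ⟨k, _, hNk⟩ : ∃ (n : ℕ) (_ : NeZero n), N ≤ n := ⟨N + 1, inferInstance, by omega⟩
  obtain ⟨A, hAs, hA, hd⟩ := hN k hNk
  refine ⟨k, inferInstance, δ / 2, A, by positivity, hAs, hA, ?_⟩
  have hη : 0 < δ / 2 := by positivity
  have h1 := abs_llI_sub_le hη hh hs.isKer hsm (isKer_stepK A) fun x y => hA _ _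
  have h2 : L1dist (smooth δ h) (stepK A) / (δ / 2) ≤ ε / 2 := by
    rw [div_le_iff₀ hη]; linarith
  have h3 : llI h h + Real.log (1 - δ) ≤ llI h (smooth δ h) := by
    have e : llI h h + Real.log (1 - δ)
        = ∫ p, (ll (h p.1 p.2) (h p.1 p.2) + Real.log (1 - δ)) ∂sqMeas := by
      rw [integral_add (isKer_ll_self hh).integrable (integrable_const _)]; simp [llI]
    rw [e]
    exact integral_mono ((isKer_ll_self hh).integrable.add (integrable_const _))
      (isKer_ll hη hh hs.isKer hsm).integrable fun p => ll_smooth (hh.2.2 _ _) hδ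
  have := (abs_le.1 (h1.trans h2)).2
  linarith

/-- The log-likelihood pairing is continuous for the cut distance, uniformly over reference
kernels close to relabellings of a given graphon. -/
lemma exists_llI_pairing {g : ℝ → ℝ → ℝ} (hg : IsGraphon g) {η : ℝ} (hη : 0 < η)
    (hgη : ∀ x y, g x y ∈ Set.Icc η (1 - η)) {ε : ℝ} (hε : 0 < ε) :
    ∃ ρ > 0, ∃ r > 0, ∀ (τ : MPBij) (q : ℝ → ℝ → ℝ), IsKer q →
      (∀ x y, q x y ∈ Set.Icc η (1 - η)) → L1dist q (relabel τ g) < ρ →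
      ∀ W V, IsGraphon W → IsGraphon V → cutDist W V ≤ r → |llI W q - llI V q| ≤ ε := by
  obtain ⟨N, hN⟩ := exists_stepK_near hg.1 hg.2.1 hgη (ε := η * (ε / 8)) (by positivity)
  obtain ⟨k, _, hNk⟩ : ∃ (n : ℕ) (_ : NeZero n), N ≤ n := ⟨N + 1, inferInstance, by omega⟩
  obtain ⟨A, -, hA, hd⟩ := hN k hNk
  have hk : (0:ℝ) < k := by exact_mod_cast NeZero.pos k
  refine ⟨η * (ε / 8), by positivity, ε / 2 / (k * k * (2 / η)), by positivity,
    fun τ q hq hqη hqg W V hW hV hWV => ?_⟩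
  have kA : IsKer (relabel τ (stepK A)) := (isKer_stepK A).relabel τ
  have hAη : ∀ x y, relabel τ (stepK A) x y ∈ Set.Icc η (1 - η) := fun x y => hA _ _
  have hL : L1dist q (relabel τ (stepK A)) / η ≤ ε / 4 := by
    have h1 := L1dist_triangle hq (hg.isKer.relabel τ) kA
    rw [L1dist_relabel hg.isKer (isKer_stepK A)] at h1
    rw [div_le_iff₀ hη]
    linarith
  have a1 := (abs_llI_sub_le hη hW hq hqη kA hAη).trans hL
  have a2 := (abs_llI_sub_le hη hV hq hqη kA hAη).trans hL
  have a3 : |llI W (relabel τ (stepK A)) - llI V (relabel τ (stepK A))| ≤ ε / 2 := by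
    have e : llI W (relabel τ (stepK A)) - llI V (relabel τ (stepK A))
        = ∫ p, (fun i j => Real.log (A i j) - Real.log (1 - A i j)) (vtx k (τ.toFun p.1))
            (vtx k (τ.toFun p.2)) * (W p.1 p.2 - V p.1 p.2) ∂sqMeas := by
      rw [llI, llI, ← integral_sub (isKer_ll hη hW kA hAη).integrable
        (isKer_ll hη hV kA hAη).integrable]
      refine integral_congr_ae (ae_of_all _ fun p => ?_)
      simp only [ll_sub]
      rw [mul_comm]
      rfl
    rw [e]
    refine (abs_integral_label_mul_le hW.isKer hV.isKer
      (f := fun x => vtx k (τ.toFun x)) ((measurable_vtx k).comp τ.mp.measurable)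
      (fun i j => Real.log (A i j) - Real.log (1 - A i j)) (b := 2 / η) fun i j => ?_).trans ?_
    · have h1 := abs_log_le hη (hA i j).1 (by linarith [(hA i j).2])
      have h2 := abs_log_le hη (x := 1 - A i j) (by linarith [(hA i j).2])
        (by linarith [(hA i j).1])
      refine (abs_sub _ _).trans ?_
      have : 2 / η = 1 / η + 1 / η := by ring
      linarith
    · rw [le_div_iff₀ (by positivity)] at hWV
      linarith
  rw [abs_le] at a1 a2 a3 ⊢
  constructor <;> linarith [a1.1, a1.2, a2.1, a2.2, a3.1, a3.2]

end
noncomputable section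

/-! ### Finite weighted graphs -/

/-- The potential edges of a graph on `n` vertices. -/
abbrev Edge (n : ℕ) := {e : Fin n × Fin n // e.1 < e.2}

lemma sum_sum_eq_edge {n : ℕ} (C : Fin n → Fin n → ℝ) :
    ∑ i, ∑ j, C i j = ∑ e : Edge n, (C e.1.1 e.1.2 + C e.1.2 e.1.1) + ∑ i, C i i := by
  have h1 : ∑ i, ∑ j, C i j
      = ∑ i, ∑ j, ((if i < j then C i j else 0) + (if j < i then C i j else 0)
        + (if i = j then C i j else 0)) := by
    refine Finset.sum_congr rfl fun i _ => Finset.sum_congr rfl fun j _ => ?_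
    rcases lt_trichotomy i j with h | h | h
    · simp [h, h.not_gt, h.ne]
    · simp [h]
    · simp [h, h.not_gt, h.ne']
  have h2 : ∀ D : Fin n → Fin n → ℝ, ∑ i, ∑ j, (if i < j then D i j else 0)
      = ∑ e : Edge n, D e.1.1 e.1.2 := fun D => by
    rw [← Fintype.sum_prod_type' (f := fun i j => if i < j then D i j else 0),
      ← Finset.sum_filter]
    exact Finset.sum_subtype (Finset.univ.filter fun e : Fin n × Fin n => e.1 < e.2)
      (fun e => by simp) fun e => D e.1 e.2
  rw [h1]
  simp_rw [Finset.sum_add_distrib]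
  rw [h2 C, Finset.sum_comm (f := fun i j => if j < i then C i j else 0), h2 fun i j => C j i]
  simp

/-- The `0`-`1` value of a Boolean. -/
def bit (b : Bool) : ℝ := if b then 1 else 0

lemma bit_mem (b : Bool) : bit b ∈ Set.Icc (0:ℝ) 1 := by
  cases b <;> simp [bit]

/-- The adjacency matrix of a graph given by its edge indicators. -/
def adjM {n : ℕ} (ξ : Edge n → Bool) (i j : Fin n) : ℝ :=
  if h : i < j then bit (ξ ⟨(i, j), h⟩) else if h : j < i then bit (ξ ⟨(j, i), h⟩) else 0

lemma adjM_symm {n : ℕ} (ξ : Edge n → Bool) (i j : Fin n) : adjM ξ i j = adjM ξ j i := by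
  rcases lt_trichotomy i j with h | h | h
  · simp [adjM, h, h.not_gt]
  · simp [h]
  · simp [adjM, h, h.not_gt]

lemma adjM_edge {n : ℕ} (ξ : Edge n → Bool) (e : Edge n) : adjM ξ e.1.1 e.1.2 = bit (ξ e) := by
  simp [adjM, e.2]

lemma adjM_edge' {n : ℕ} (ξ : Edge n → Bool) (e : Edge n) : adjM ξ e.1.2 e.1.1 = bit (ξ e) := by
  rw [adjM_symm, adjM_edge]

lemma adjM_self {n : ℕ} (ξ : Edge n → Bool) (i : Fin n) : adjM ξ i i = 0 := by
  simp [adjM]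

lemma adjM_mem {n : ℕ} (ξ : Edge n → Bool) (i j : Fin n) : adjM ξ i j ∈ Set.Icc (0:ℝ) 1 := by
  unfold adjM
  split_ifs
  · exact bit_mem _
  · exact bit_mem _
  · simp

lemma isGraphon_stepK {n : ℕ} [NeZero n] {A : Fin n → Fin n → ℝ} (hs : ∀ i j, A i j = A j i)
    (hA : ∀ i j, A i j ∈ Set.Icc (0:ℝ) 1) : IsGraphon (stepK A) :=
  ⟨(isKer_stepK A).measurable, fun _ _ => hs _ _, fun _ _ => hA _ _⟩

lemma isGraphon_adjM {n : ℕ} [NeZero n] (ξ : Edge n → Bool) : IsGraphon (stepK (adjM ξ)) :=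
  isGraphon_stepK (adjM_symm ξ) (adjM_mem ξ)

/-- The probability of a graph when edges are independent with probabilities `p`. -/
def wt {n : ℕ} (p : Fin n → Fin n → ℝ) (ξ : Edge n → Bool) : ℝ :=
  ∏ e, if ξ e then p e.1.1 e.1.2 else 1 - p e.1.1 e.1.2

lemma wt_nonneg {n : ℕ} {p : Fin n → Fin n → ℝ} (hp : ∀ i j, p i j ∈ Set.Icc (0:ℝ) 1)
    (ξ : Edge n → Bool) : 0 ≤ wt p ξ :=
  Finset.prod_nonneg fun e _ => by
    have := hp e.1.1 e.1.2
    split_ifs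
    · exact this.1
    · linarith [this.2]

lemma sum_prod_bool {n : ℕ} (F : Edge n → Bool → ℝ) :
    ∑ ξ : Edge n → Bool, ∏ e, F e (ξ e) = ∏ e, (F e true + F e false) := by
  rw [← Fintype.piFinset_univ, ← Finset.prod_univ_sum]
  simp

lemma sum_wt {n : ℕ} (p : Fin n → Fin n → ℝ) : ∑ ξ, wt p ξ = 1 := by
  have := sum_prod_bool fun (e : Edge n) b => if b then p e.1.1 e.1.2 else 1 - p e.1.1 e.1.2
  simp only [wt, this]
  simp

lemma wt_eq_exp {n : ℕ} {p : Fin n → Fin n → ℝ} (hp : ∀ i j, p i j ∈ Set.Ioo (0:ℝ) 1)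
    (ξ : Edge n → Bool) :
    wt p ξ = Real.exp (∑ e : Edge n, ll (adjM ξ e.1.1 e.1.2) (p e.1.1 e.1.2)) := by
  rw [Real.exp_sum]
  refine Finset.prod_congr rfl fun e _ => ?_
  have := hp e.1.1 e.1.2
  rw [adjM_edge]
  cases ξ e
  · simp [bit, ll, Real.exp_log (sub_pos.2 this.2)]
  · simp [bit, ll, Real.exp_log this.1]

lemma llI_stepK {n : ℕ} [NeZero n] (W p : Fin n → Fin n → ℝ) :
    (n:ℝ) ^ 2 * llI (stepK W) (stepK p) = ∑ i, ∑ j, ll (W i j) (p i j) := by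
  have hn : (n:ℝ) ≠ 0 := by exact_mod_cast NeZero.ne n
  have := integral_stepK fun i j => ll (W i j) (p i j)
  change llI (stepK W) (stepK p) = _ at this
  rw [this]
  field_simp

lemma sum_edge_ll {n : ℕ} {p : Fin n → Fin n → ℝ} (hs : ∀ i j, p i j = p j i) {η : ℝ} (hη : 0 < η)
    (hp : ∀ i j, p i j ∈ Set.Icc η (1 - η)) (ξ : Edge n → Bool) :
    |∑ e : Edge n, ll (adjM ξ e.1.1 e.1.2) (p e.1.1 e.1.2)
      - (∑ i, ∑ j, ll (adjM ξ i j) (p i j)) / 2| ≤ n / η := by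
  rw [sum_sum_eq_edge]
  have e1 : ∑ e : Edge n, (ll (adjM ξ e.1.1 e.1.2) (p e.1.1 e.1.2)
      + ll (adjM ξ e.1.2 e.1.1) (p e.1.2 e.1.1))
      = 2 * ∑ e : Edge n, ll (adjM ξ e.1.1 e.1.2) (p e.1.1 e.1.2) := by
    rw [Finset.mul_sum]
    refine Finset.sum_congr rfl fun e _ => ?_
    rw [adjM_symm ξ e.1.2, hs e.1.2]; ring
  rw [e1]
  have e2 : |∑ i, ll (adjM ξ i i) (p i i)| ≤ n * (1 / η) := by
    refine (Finset.abs_sum_le_sum_abs _ _).trans ?_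
    refine (Finset.sum_le_card_nsmul _ _ (1 / η) fun i _ =>
      abs_ll_le hη (adjM_mem ξ i i) (hp i i)).trans ?_
    simp
  have e3 : (0:ℝ) ≤ n * (1 / η) := by positivity
  rw [div_eq_mul_one_div (n:ℝ) η]
  rw [abs_le] at e2 ⊢
  constructor <;> linarith [e2.1, e2.2]

lemma wt_bounds {n : ℕ} [NeZero n] {p : Fin n → Fin n → ℝ} (hs : ∀ i j, p i j = p j i) {η : ℝ}
    (hη : 0 < η) (hp : ∀ i j, p i j ∈ Set.Icc η (1 - η)) (ξ : Edge n → Bool) :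
    Real.exp ((n:ℝ) ^ 2 / 2 * llI (stepK (adjM ξ)) (stepK p) - n / η) ≤ wt p ξ ∧
      wt p ξ ≤ Real.exp ((n:ℝ) ^ 2 / 2 * llI (stepK (adjM ξ)) (stepK p) + n / η) := by
  have h01 : ∀ i j, p i j ∈ Set.Ioo (0:ℝ) 1 := fun i j =>
    ⟨hη.trans_le (hp i j).1, by linarith [(hp i j).2]⟩
  rw [wt_eq_exp h01, Real.exp_le_exp, Real.exp_le_exp]
  have := abs_le.1 (sum_edge_ll hs hη hp ξ)
  rw [← llI_stepK] at this
  constructor <;> linarith [this.1, this.2]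

/-! ### Random rounding of fractional labellings -/

lemma exists_labelling_ge {n k : ℕ} (θ : Fin n → Fin k → ℝ) (h0 : ∀ i a, 0 ≤ θ i a)
    (h1 : ∀ i, ∑ a, θ i a = 1) (c : Edge n → Fin k → Fin k → ℝ) :
    ∃ f : Fin n → Fin k, ∑ e : Edge n, ∑ a, ∑ b, θ e.1.1 a * θ e.1.2 b * c e a b
      ≤ ∑ e : Edge n, c e (f e.1.1) (f e.1.2) := by
  set w : (Fin n → Fin k) → ℝ := fun f => ∏ i, θ i (f i) with hw
  have hw1 : ∑ f, w f = 1 := by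
    rw [← Fintype.piFinset_univ, hw, ← Finset.prod_univ_sum]
    simp [h1]
  have hpair : ∀ (e : Edge n) (a b : Fin k),
      ∑ f, w f * (if f e.1.1 = a ∧ f e.1.2 = b then 1 else 0) = θ e.1.1 a * θ e.1.2 b := by
    intro e a b
    set G : Fin n → Fin k → ℝ := fun l x =>
      θ l x * (if l = e.1.1 then (if x = a then 1 else 0)
        else if l = e.1.2 then (if x = b then 1 else 0) else 1) with hG
    have hne : e.1.1 ≠ e.1.2 := e.2.ne
    have e1 : ∀ f : Fin n → Fin k, w f * (if f e.1.1 = a ∧ f e.1.2 = b then 1 else 0)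
        = ∏ l, G l (f l) := by
      intro f
      simp only [hG, Finset.prod_mul_distrib, hw]
      congr 1
      rw [Finset.prod_eq_mul (s := Finset.univ) e.1.1 e.1.2 hne (fun c _ hc => by simp [hc.1, hc.2])
        (by simp) (by simp)]
      simp only [hne.symm, if_true, if_false, ite_and]
      split_ifs <;> simp
    simp_rw [e1]
    rw [← Fintype.piFinset_univ, ← Finset.prod_univ_sum,
      Finset.prod_eq_mul (s := Finset.univ) e.1.1 e.1.2 hne
        (fun c _ hc => by simp [hG, hc.1, hc.2, h1]) (by simp) (by simp)]
    simp [hG, hne.symm]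
  have hE : ∑ f, w f * ∑ e : Edge n, c e (f e.1.1) (f e.1.2)
      = ∑ e : Edge n, ∑ a, ∑ b, θ e.1.1 a * θ e.1.2 b * c e a b := by
    simp_rw [Finset.mul_sum]
    rw [Finset.sum_comm]
    refine Finset.sum_congr rfl fun e _ => ?_
    simp_rw [← hpair, Finset.sum_mul]
    rw [Finset.sum_congr rfl fun a _ => Finset.sum_comm, Finset.sum_comm]
    refine Finset.sum_congr rfl fun f _ => ?_
    simp_rw [mul_assoc, ← Finset.mul_sum]
    congr 1
    simp [ite_and]
  by_contra! hcon
  obtain ⟨f0, hf0⟩ : ∃ f, 0 < w f := by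
    by_contra! h
    have := Finset.sum_nonpos fun f (_ : f ∈ (Finset.univ : Finset (Fin n → Fin k))) => h f
    linarith
  have hlt := Finset.sum_lt_sum (s := Finset.univ)
    (f := fun f => w f * ∑ e : Edge n, c e (f e.1.1) (f e.1.2))
    (g := fun f => w f * ∑ e : Edge n, ∑ a, ∑ b, θ e.1.1 a * θ e.1.2 b * c e a b)
    (fun f _ => mul_le_mul_of_nonneg_left (hcon f).le (Finset.prod_nonneg fun i _ => h0 i _))
    ⟨f0, Finset.mem_univ _, mul_lt_mul_of_pos_left (hcon f0) hf0⟩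
  rw [hE, ← Finset.sum_mul, hw1, one_mul] at hlt
  exact lt_irrefl _ hlt

lemma integral_label {m : Type*} [Fintype m] [MeasurableSpace m] [MeasurableSingletonClass m]
    {φ : ℝ → m} (hφ : Measurable φ) (C : m → m → ℝ) :
    ∫ p, C (φ p.1) (φ p.2) ∂sqMeas
      = ∑ a, ∑ b, unitMeas.real (φ ⁻¹' {a}) * unitMeas.real (φ ⁻¹' {b}) * C a b := by
  have hm : Measurable fun p : ℝ × ℝ => (φ p.1, φ p.2) :=
    (hφ.comp measurable_fst).prodMk (hφ.comp measurable_snd)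
  have h1 : sqMeas.map (fun p : ℝ × ℝ => (φ p.1, φ p.2))
      = (unitMeas.map φ).prod (unitMeas.map φ) := by
    rw [sqMeas, Measure.map_prod_map _ _ hφ hφ]; rfl
  have h2 : ∫ p, C (φ p.1) (φ p.2) ∂sqMeas
      = ∫ q, Function.uncurry C q ∂(sqMeas.map (fun p : ℝ × ℝ => (φ p.1, φ p.2))) := by
    rw [integral_map hm.aemeasurable (measurable_of_finite _).aestronglyMeasurable]
    rfl
  have : IsProbabilityMeasure (unitMeas.map φ) :=
    Measure.isProbabilityMeasure_map hφ.aemeasurable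
  rw [h2, h1, integral_prod _ (Integrable.of_finite), integral_fintype (Integrable.of_finite)]
  simp_rw [integral_fintype (Integrable.of_finite),
    map_measureReal_apply hφ (measurableSet_singleton _), smul_eq_mul,
    Function.uncurry_apply_pair, Finset.mul_sum, mul_assoc]

/-- A fractional block model has a labelling giving a graph at least as large a likelihood. -/
lemma exists_labelling_wt_ge {n k : ℕ} [NeZero n] [NeZero k] {A : Fin k → Fin k → ℝ} {η : ℝ}
    (hη : 0 < η) (hs : ∀ i j, A i j = A j i) (hA : ∀ i j, A i j ∈ Set.Icc η (1 - η)) (σ : MPBij)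
    (ξ : Edge n → Bool) :
    ∃ f : Fin n → Fin k, Real.exp ((n:ℝ) ^ 2 / 2
      * llI (stepK (adjM ξ)) (relabel σ (stepK A)) - n / η) ≤ wt (fun i j => A (f i) (f j)) ξ := by
  set φ : ℝ → Fin n × Fin k := fun x => (vtx n x, vtx k (σ.toFun x)) with hφdef
  have hφ : Measurable φ := (measurable_vtx n).prodMk ((measurable_vtx k).comp σ.mp.measurable)
  have hn : (n:ℝ) ≠ 0 := by exact_mod_cast NeZero.ne n
  set θ : Fin n → Fin k → ℝ := fun i a => n * unitMeas.real (φ ⁻¹' {(i, a)}) with hθ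
  have h0 : ∀ i a, 0 ≤ θ i a := fun i a => by positivity
  have h1 : ∀ i, ∑ a, θ i a = 1 := by
    intro i
    rw [hθ, ← Finset.mul_sum, ← measureReal_biUnion_finset]
    · have : (⋃ a ∈ Finset.univ, φ ⁻¹' {(i, a)}) = vtx n ⁻¹' {i} := by
        ext x; simp [hφdef]
      rw [this, unitMeas_real_vtx]
      field_simp
    · intro a _ b _ hab
      refine Set.disjoint_left.2 fun x hx hx' => hab ?_
      have := (Set.mem_singleton_iff.1 hx).symm.trans (Set.mem_singleton_iff.1 hx')
      exact (Prod.ext_iff.1 this).2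
    · exact fun a _ => hφ (measurableSet_singleton _)
  have hint : (n:ℝ) ^ 2 * llI (stepK (adjM ξ)) (relabel σ (stepK A))
      = ∑ i, ∑ j, ∑ a, ∑ b, θ i a * θ j b * ll (adjM ξ i j) (A a b) := by
    have := integral_label hφ fun s t : Fin n × Fin k => ll (adjM ξ s.1 t.1) (A s.2 t.2)
    change llI (stepK (adjM ξ)) (relabel σ (stepK A)) = _ at this
    rw [this]
    simp_rw [Fintype.sum_prod_type, Finset.mul_sum]
    refine Finset.sum_congr rfl fun i _ => ?_
    rw [Finset.sum_comm]
    refine Finset.sum_congr rfl fun j _ => Finset.sum_congr rfl fun a _ =>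
      Finset.sum_congr rfl fun b _ => ?_
    rw [hθ]; ring
  obtain ⟨f, hf⟩ := exists_labelling_ge θ h0 h1 fun e a b => ll (adjM ξ e.1.1 e.1.2) (A a b)
  refine ⟨f, ?_⟩
  have h01 : ∀ i j, A i j ∈ Set.Ioo (0:ℝ) 1 := fun i j =>
    ⟨hη.trans_le (hA i j).1, by linarith [(hA i j).2]⟩
  rw [wt_eq_exp fun i j => h01 _ _, Real.exp_le_exp]
  refine le_trans ?_ hf
  rw [sum_sum_eq_edge] at hint
  have e1 : ∑ e : Edge n, (∑ a, ∑ b, θ e.1.1 a * θ e.1.2 b * ll (adjM ξ e.1.1 e.1.2) (A a b)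
      + ∑ a, ∑ b, θ e.1.2 a * θ e.1.1 b * ll (adjM ξ e.1.2 e.1.1) (A a b))
      = 2 * ∑ e : Edge n, ∑ a, ∑ b, θ e.1.1 a * θ e.1.2 b * ll (adjM ξ e.1.1 e.1.2) (A a b) := by
    rw [Finset.mul_sum]
    refine Finset.sum_congr rfl fun e _ => ?_
    rw [two_mul]
    congr 1
    rw [Finset.sum_comm]
    refine Finset.sum_congr rfl fun a _ => Finset.sum_congr rfl fun b _ => ?_
    rw [adjM_symm ξ e.1.2, hs b]; ring
  have e2 : ∑ i, ∑ a, ∑ b, θ i a * θ i b * ll (adjM ξ i i) (A a b) ≤ n * (1 / η) := by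
    refine (Finset.sum_le_card_nsmul _ _ (1 / η) fun i _ => ?_).trans (by simp)
    calc ∑ a, ∑ b, θ i a * θ i b * ll (adjM ξ i i) (A a b)
        ≤ ∑ a, ∑ b, θ i a * θ i b * (1 / η) := by
          refine Finset.sum_le_sum fun a _ => Finset.sum_le_sum fun b _ => ?_
          exact mul_le_mul_of_nonneg_left ((le_abs_self _).trans
            (abs_ll_le hη (adjM_mem ξ i i) (hA a b))) (mul_nonneg (h0 _ _) (h0 _ _))
      _ = 1 / η := by
          simp_rw [← Finset.sum_mul, ← Finset.mul_sum, h1]; simp [h1]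
  have e3 : (0:ℝ) ≤ n * (1 / η) := by positivity
  rw [e1] at hint
  rw [div_eq_mul_one_div (n:ℝ) η]
  linarith

end
noncomputable section

/-! ### Counting graphs near a graphon: upper bound -/

lemma eventually_pow_mul_exp_le (k : ℕ) (a : ℝ) {ε : ℝ} (hε : 0 < ε) :
    ∀ᶠ n : ℕ in atTop, (k:ℝ) ^ n * Real.exp (a * n) ≤ Real.exp ((n:ℝ) ^ 2 / 2 * ε) := by
  filter_upwards [tendsto_natCast_atTop_atTop.eventually_ge_atTop (2 * (k + a) / ε)] with n hn
  have h1 : (k:ℝ) ^ n ≤ Real.exp (k * n) := by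
    rw [mul_comm, Real.exp_nat_mul]
    exact pow_le_pow_left₀ (by positivity) (by linarith [Real.add_one_le_exp (k:ℝ)]) n
  rw [div_le_iff₀ hε] at hn
  refine (mul_le_mul_of_nonneg_right h1 (Real.exp_pos _).le).trans ?_
  rw [← Real.exp_add, Real.exp_le_exp]
  nlinarith [Nat.cast_nonneg (α := ℝ) n]

lemma card_mul_le_of_forall_exists {n : ℕ} {Λ : Type*} [Fintype Λ]
    (P : Λ → Fin n → Fin n → ℝ) (hP : ∀ f i j, P f i j ∈ Set.Icc (0:ℝ) 1)
    (Ξ : Finset (Edge n → Bool)) {L : ℝ} (h : ∀ ξ ∈ Ξ, ∃ f, L ≤ wt (P f) ξ) :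
    (Ξ.card : ℝ) * L ≤ Fintype.card Λ := by
  calc (Ξ.card : ℝ) * L = ∑ _ξ ∈ Ξ, L := by simp
    _ ≤ ∑ ξ ∈ Ξ, ∑ f, wt (P f) ξ := Finset.sum_le_sum fun ξ hξ => by
        obtain ⟨f, hf⟩ := h ξ hξ
        exact hf.trans (Finset.single_le_sum (f := fun f => wt (P f) ξ)
          (fun f _ => wt_nonneg (hP f) ξ) (Finset.mem_univ f))
    _ ≤ ∑ ξ, ∑ f, wt (P f) ξ := Finset.sum_le_sum_of_subset_of_nonneg (Finset.subset_univ _)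
        fun ξ _ _ => Finset.sum_nonneg fun f _ => wt_nonneg (hP f) ξ
    _ = Fintype.card Λ := by rw [Finset.sum_comm]; simp [sum_wt]

open Classical in
lemma exists_card_near_le {h : ℝ → ℝ → ℝ} (hh : IsGraphon h) {ε : ℝ} (hε : 0 < ε) :
    ∃ r > 0, ∀ᶠ n : ℕ in atTop, ∀ _ : NeZero n,
      ((Finset.univ.filter fun ξ : Edge n → Bool => cutMetric h (stepK (adjM ξ)) < r).card : ℝ)
        ≤ Real.exp ((n:ℝ) ^ 2 / 2 * (-llI h h + ε)) := by
  obtain ⟨k, _, η, A, hη, hAs, hA, hle⟩ := exists_stepK_llI_ge hh (half_pos (half_pos hε))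
  have hk : (0:ℝ) < k := by exact_mod_cast NeZero.pos k
  have hAη : ∀ x y, stepK A x y ∈ Set.Icc η (1 - η) := fun x y => hA _ _
  have hA01 : ∀ i j, A i j ∈ Set.Icc (0:ℝ) 1 := fun i j =>
    ⟨hη.le.trans (hA i j).1, by linarith [(hA i j).2]⟩
  obtain ⟨ρ, hρ, r, hr, hpair⟩ := exists_llI_pairing (isGraphon_stepK hAs hA01) hη hAη
    (half_pos (half_pos hε))
  refine ⟨r, hr, ?_⟩
  filter_upwards [eventually_pow_mul_exp_le k (1 / η) (half_pos hε)] with n hn hn0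
  set L := Real.exp ((n:ℝ) ^ 2 / 2 * (llI h h - ε / 2) - n / η) with hL
  have hcard := card_mul_le_of_forall_exists (Λ := Fin n → Fin k)
    (fun f i j => A (f i) (f j)) (fun f i j => hA01 _ _)
    (Finset.univ.filter fun ξ : Edge n → Bool => cutMetric h (stepK (adjM ξ)) < r) (L := L) ?_
  · rw [← le_div_iff₀ (Real.exp_pos _)] at hcard
    refine hcard.trans ?_
    rw [div_eq_mul_inv, ← Real.exp_neg]
    simp only [Fintype.card_fun, Fintype.card_fin, Nat.cast_pow]
    have e : (n:ℝ) ^ 2 / 2 * (-llI h h + ε) = (n:ℝ) ^ 2 / 2 * (ε / 2)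
        + (n:ℝ) ^ 2 / 2 * (-llI h h + ε / 2) := by ring
    have e' : -((n:ℝ) ^ 2 / 2 * (llI h h - ε / 2) - n / η) = 1 / η * n
        + (n:ℝ) ^ 2 / 2 * (-llI h h + ε / 2) := by ring
    rw [e, e', Real.exp_add, Real.exp_add, ← mul_assoc]
    exact mul_le_mul_of_nonneg_right hn (Real.exp_pos _).le
  · intro ξ hξ
    obtain ⟨σ, hσ⟩ := exists_of_cutMetric_lt (isGraphon_adjM ξ).isKer hh.isKer
      (by rw [cutMetric_comm (isGraphon_adjM ξ).isKer hh.isKer]; exact (Finset.mem_filter.1 hξ).2)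
    obtain ⟨f, hf⟩ := exists_labelling_wt_ge hη hAs hA σ ξ
    refine ⟨f, le_trans ?_ hf⟩
    have h1 := hpair σ (relabel σ (stepK A)) ((isKer_stepK A).relabel σ) (fun x y => hAη _ _)
      (by rw [L1dist, ]; simpa using hρ) _ _ (isGraphon_adjM ξ) (hh.relabel σ) hσ.le
    rw [llI_relabel hh.isKer (isKer_stepK A)] at h1
    rw [hL, Real.exp_le_exp]
    have h2 := (abs_le.1 h1).1
    have h3 : llI h h - ε / 2 ≤ llI (stepK (adjM ξ)) (relabel σ (stepK A)) := by linarith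
    have := mul_le_mul_of_nonneg_left h3 (by positivity : (0:ℝ) ≤ (n:ℝ) ^ 2 / 2)
    linarith

/-! ### Concentration of an inhomogeneous random graph in cut distance -/

lemma sum_wt_mul_exp_le {n : ℕ} {q : Fin n → Fin n → ℝ} (hq : ∀ i j, q i j ∈ Set.Icc (0:ℝ) 1)
    {v : Edge n → ℝ} (hv : ∀ e, |v e| ≤ 1) {s : ℝ} (hs : s ∈ Set.Icc (0:ℝ) 1) :
    ∑ ξ, wt q ξ * Real.exp (s * ∑ e, v e * (bit (ξ e) - q e.1.1 e.1.2))
      ≤ Real.exp (s ^ 2 * Fintype.card (Edge n)) := by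
  have e1 : ∀ ξ : Edge n → Bool,
      wt q ξ * Real.exp (s * ∑ e, v e * (bit (ξ e) - q e.1.1 e.1.2))
      = ∏ e : Edge n, (fun (e : Edge n) b => (if b then q e.1.1 e.1.2 else 1 - q e.1.1 e.1.2)
          * Real.exp (s * (v e * (bit b - q e.1.1 e.1.2)))) e (ξ e) := fun ξ => by
    rw [Finset.mul_sum, Real.exp_sum, wt, ← Finset.prod_mul_distrib]
  simp_rw [e1]
  rw [sum_prod_bool fun (e : Edge n) b => (if b then q e.1.1 e.1.2 else 1 - q e.1.1 e.1.2)
          * Real.exp (s * (v e * (bit b - q e.1.1 e.1.2))), mul_comm, Real.exp_nat_mul]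
  have h01 : ∀ e : Edge n, 0 ≤ q e.1.1 e.1.2 ∧ q e.1.1 e.1.2 ≤ 1 := fun e => hq e.1.1 e.1.2
  refine (Finset.prod_le_prod (g := fun _ => Real.exp (s ^ 2)) (fun e _ => ?_)
    fun e _ => ?_).trans (by simp)
  · have h2 := sub_nonneg.2 (h01 e).2
    have h1 := (h01 e).1
    simp only [if_true, Bool.false_eq_true, if_false]
    positivity
  obtain ⟨hq0, hq1⟩ := h01 e
  have key : ∀ b : ℝ, |b| ≤ 1 → Real.exp (s * (v e * b)) ≤ 1 + s * (v e * b) + s ^ 2 := by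
    intro b hb
    have h1 : |s * (v e * b)| ≤ s := by
      rw [abs_mul, abs_mul, abs_of_nonneg hs.1]
      exact mul_le_of_le_one_right hs.1 (mul_le_one₀ (hv e) (abs_nonneg _) hb)
    have h2 := (abs_le.1 (Real.abs_exp_sub_one_sub_id_le (h1.trans hs.2))).2
    have h3 : (s * (v e * b)) ^ 2 ≤ s ^ 2 := by
      rw [← sq_abs]; exact pow_le_pow_left₀ (abs_nonneg _) h1 2
    linarith
  simp only [bit, if_true, Bool.false_eq_true, if_false]
  have k1 := key (1 - q e.1.1 e.1.2) (abs_le.2 ⟨by linarith, by linarith⟩)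
  have k2 := key (0 - q e.1.1 e.1.2) (abs_le.2 ⟨by linarith, by linarith⟩)
  have k1' := mul_le_mul_of_nonneg_left k1 hq0
  have k2' := mul_le_mul_of_nonneg_left k2 (sub_nonneg.2 hq1)
  have := Real.add_one_le_exp (s ^ 2)
  nlinarith

open Classical in
lemma sum_wt_tail_le {n : ℕ} {q : Fin n → Fin n → ℝ} (hq : ∀ i j, q i j ∈ Set.Icc (0:ℝ) 1)
    {v : Edge n → ℝ} (hv : ∀ e, |v e| ≤ 1) {s : ℝ} (hs : s ∈ Set.Icc (0:ℝ) 1) (t : ℝ) :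
    ∑ ξ with t ≤ ∑ e, v e * (bit (ξ e) - q e.1.1 e.1.2), wt q ξ
      ≤ Real.exp (s ^ 2 * Fintype.card (Edge n) - s * t) := by
  rw [sub_eq_add_neg, Real.exp_add, Real.exp_neg, ← div_eq_mul_inv, le_div_iff₀ (Real.exp_pos _),
    Finset.sum_mul]
  refine le_trans ?_ (sum_wt_mul_exp_le hq hv hs)
  refine (Finset.sum_le_sum fun ξ hξ => mul_le_mul_of_nonneg_left (Real.exp_le_exp.2
    (mul_le_mul_of_nonneg_left (Finset.mem_filter.1 hξ).2 hs.1)) (wt_nonneg hq ξ)).trans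
    (Finset.sum_le_sum_of_subset_of_nonneg (Finset.filter_subset _ _) fun ξ _ _ =>
      mul_nonneg (wt_nonneg hq ξ) (Real.exp_pos _).le)

lemma card_edge_le (n : ℕ) : (Fintype.card (Edge n) : ℝ) ≤ (n:ℝ) ^ 2 / 2 := by
  have := sum_sum_eq_edge (n := n) fun _ _ => (1:ℝ)
  simp only [Finset.sum_const, Finset.card_univ, Fintype.card_fin, nsmul_eq_mul, mul_one] at this
  have h : (0:ℝ) ≤ n := Nat.cast_nonneg n
  nlinarith

lemma sum_le_sum_add_sum_sum {α ι : Type*} [DecidableEq α] [Fintype α] [Fintype ι] (s : Finset α)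
    (t : ι → Finset α) {w : α → ℝ} (hw : ∀ a, 0 ≤ w a)
    (hcover : Finset.univ ⊆ s ∪ Finset.univ.biUnion t) :
    ∑ a, w a ≤ ∑ a ∈ s, w a + ∑ i, ∑ a ∈ t i, w a := by
  have e : ∀ u : Finset α, ∑ a ∈ u, w a = ∑ a, if a ∈ u then w a else 0 := fun u => by
    simp [Finset.sum_ite_mem]
  simp_rw [e]
  rw [Finset.sum_comm, ← Finset.sum_add_distrib, ← e]
  refine Finset.sum_le_sum fun a _ => ?_
  have hs : 0 ≤ (if a ∈ s then w a else 0) := by split_ifs <;> simp [hw a]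
  have ht : ∀ i, 0 ≤ (if a ∈ t i then w a else 0) := fun i => by split_ifs <;> simp [hw a]
  rcases Finset.mem_union.1 (hcover (Finset.mem_univ a)) with h | h
  · rw [if_pos h]
    exact le_add_of_nonneg_right (Finset.sum_nonneg fun i _ => ht i)
  · obtain ⟨i, hi, hai⟩ := Finset.mem_biUnion.1 h
    refine le_trans ?_ (le_add_of_nonneg_left hs)
    refine le_trans ?_ (Finset.single_le_sum (fun i _ => ht i) hi)
    rw [if_pos hai]

open Classical in
lemma eventually_half_le_sum_wt {c : ℝ} (hc : 0 < c) (hc1 : c ≤ 1) :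
    ∀ᶠ n : ℕ in atTop, ∀ q : Fin n → Fin n → ℝ, (∀ i j, q i j = q j i) →
      (∀ i j, q i j ∈ Set.Icc (0:ℝ) 1) →
      1 / 2 ≤ ∑ ξ : Edge n → Bool with
        ∀ S T : Finset (Fin n), |∑ i ∈ S, ∑ j ∈ T, (adjM ξ i j - q i j)| ≤ c * n ^ 2, wt q ξ := by
  have hlim : ∀ᶠ n : ℕ in atTop, 2 * ((4:ℕ):ℝ) ^ n * Real.exp (2 * n)
      ≤ 2 * Real.exp ((n:ℝ) ^ 2 / 2 * (c ^ 2 / 16)) := by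
    filter_upwards [eventually_pow_mul_exp_le 4 2 (show 0 < c ^ 2 / 16 by positivity)] with n hn
    linarith
  filter_upwards [hlim, tendsto_natCast_atTop_atTop.eventually_ge_atTop (2 / c),
    eventually_ge_atTop 1] with n hn hnc hn1 q hqs hq
  have hn1' : (1:ℝ) ≤ n := by exact_mod_cast hn1
  rw [div_le_iff₀ hc] at hnc
  set u : Finset (Fin n) × Finset (Fin n) → Edge n → ℝ := fun ST e =>
    ((if e.1.1 ∈ ST.1 ∧ e.1.2 ∈ ST.2 then 1 else 0)
      + (if e.1.2 ∈ ST.1 ∧ e.1.1 ∈ ST.2 then 1 else 0)) / 2 with hu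
  have hu1 : ∀ ST e, |u ST e| ≤ 1 := by
    intro ST e
    simp only [hu]
    split_ifs <;> norm_num
  set bad : (Finset (Fin n) × Finset (Fin n)) × Bool → Finset (Edge n → Bool) := fun z =>
    Finset.univ.filter fun ξ => c * n ^ 2 / 4 ≤ ∑ e, ((if z.2 then 1 else -1) * u z.1 e)
      * (bit (ξ e) - q e.1.1 e.1.2) with hbad
  have hbadle : ∀ z, ∑ ξ ∈ bad z, wt q ξ ≤ Real.exp (-((n:ℝ) ^ 2 / 2 * (c ^ 2 / 16))) := by
    intro z
    refine (sum_wt_tail_le hq (s := c / 4) (fun e => ?_) ⟨by positivity, by linarith⟩ _).trans ?_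
    · rw [abs_mul]
      split_ifs <;> simpa using hu1 z.1 e
    · rw [Real.exp_le_exp]
      have := mul_le_mul_of_nonneg_left (card_edge_le n) (by positivity : 0 ≤ (c / 4) ^ 2)
      linarith
  set good := Finset.univ.filter fun ξ : Edge n → Bool => ∀ S T : Finset (Fin n),
    |∑ i ∈ S, ∑ j ∈ T, (adjM ξ i j - q i j)| ≤ c * n ^ 2 with hgood
  have hcover : (Finset.univ : Finset (Edge n → Bool)) ⊆ good ∪ Finset.univ.biUnion bad := by
    intro ξ _
    by_contra hcon
    rw [Finset.mem_union, not_or] at hcon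
    obtain ⟨hg, hb⟩ := hcon
    rw [hgood, Finset.mem_filter] at hg
    push Not at hg
    obtain ⟨S, T, hST⟩ := hg (Finset.mem_univ _)
    have e0 : ∑ i ∈ S, ∑ j ∈ T, (adjM ξ i j - q i j)
        = ∑ i, ∑ j, (if i ∈ S ∧ j ∈ T then adjM ξ i j - q i j else 0) := by
      simp [ite_and, Finset.sum_ite_mem]
    have e1 : ∑ i ∈ S, ∑ j ∈ T, (adjM ξ i j - q i j)
        = 2 * ∑ e, u (S, T) e * (bit (ξ e) - q e.1.1 e.1.2)
          + ∑ i, (if i ∈ S ∧ i ∈ T then adjM ξ i i - q i i else 0) := by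
      rw [e0, sum_sum_eq_edge, Finset.mul_sum]
      congr 1
      refine Finset.sum_congr rfl fun e _ => ?_
      rw [adjM_edge, adjM_edge', hqs e.1.2]
      simp only [hu]
      split_ifs <;> ring
    have e2 : |∑ i, (if i ∈ S ∧ i ∈ T then adjM ξ i i - q i i else 0)| ≤ n := by
      refine (Finset.abs_sum_le_sum_abs _ _).trans
        ((Finset.sum_le_card_nsmul _ _ 1 fun i _ => ?_).trans (by simp))
      split_ifs
      · rw [adjM_self, abs_le]; constructor <;> linarith [(hq i i).1, (hq i i).2]
      · simp
    have hb' : ∀ b : Bool, ∑ e, ((if b then 1 else -1) * u (S, T) e)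
        * (bit (ξ e) - q e.1.1 e.1.2) < c * n ^ 2 / 4 := by
      intro b
      by_contra! h
      exact hb (Finset.mem_biUnion.2 ⟨((S, T), b), Finset.mem_univ _,
        Finset.mem_filter.2 ⟨Finset.mem_univ _, h⟩⟩)
    have b1 := hb' true
    have b2 := hb' false
    simp only [if_true, Bool.false_eq_true, if_false, one_mul, neg_mul, Finset.sum_neg_distrib]
      at b1 b2
    rw [e1] at hST
    have h3 := (hST.trans_le (abs_add_le _ _))
    rw [abs_mul, abs_of_pos (two_pos : (0:ℝ) < 2)] at h3
    have h4 : |∑ e, u (S, T) e * (bit (ξ e) - q e.1.1 e.1.2)| ≤ c * n ^ 2 / 4 :=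
      abs_le.2 ⟨by linarith, by linarith⟩
    nlinarith
  clear_value bad good
  have hsum : 1 ≤ ∑ ξ ∈ good, wt q ξ + ∑ z, ∑ ξ ∈ bad z, wt q ξ := by
    rw [← sum_wt q]
    exact sum_le_sum_add_sum_sum good bad (wt_nonneg hq) hcover
  have hz : ∑ z, ∑ ξ ∈ bad z, wt q ξ
      ≤ 2 * 4 ^ n * Real.exp (-((n:ℝ) ^ 2 / 2 * (c ^ 2 / 16))) := by
    refine (Finset.sum_le_sum fun z _ => hbadle z).trans (le_of_eq ?_)
    simp only [Finset.sum_const, Finset.card_univ, Fintype.card_prod,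
      Fintype.card_finset, Fintype.card_fin,
      Fintype.card_bool, nsmul_eq_mul]
    push_cast
    rw [show (4:ℝ) = 2 * 2 by norm_num, mul_pow]; ring
  have hfin : 2 * 4 ^ n * Real.exp (-((n:ℝ) ^ 2 / 2 * (c ^ 2 / 16))) ≤ 1 / 2 := by
    rw [Real.exp_neg, ← div_eq_mul_inv, div_le_iff₀ (Real.exp_pos _)]
    have : (4:ℝ) ≤ Real.exp (2 * n) := by
      have h2 : (1 + 1) ≤ Real.exp 1 := Real.add_one_le_exp 1
      calc (4:ℝ) ≤ Real.exp 1 * Real.exp 1 := by nlinarith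
        _ = Real.exp (1 + 1) := by rw [Real.exp_add]
        _ ≤ _ := Real.exp_le_exp.2 (by linarith)
    push_cast at hn
    have h5 : 2 * (4:ℝ) ^ n * 4 ≤ 2 * 4 ^ n * Real.exp (2 * n) :=
      mul_le_mul_of_nonneg_left this (by positivity)
    linarith
  linarith

end
noncomputable section

/-! ### Probabilities of neighbourhoods in the cut metric -/

lemma eventually_mul_le_sq_mul (a : ℝ) {ε : ℝ} (hε : 0 < ε) :
    ∀ᶠ n : ℕ in atTop, a * n ≤ (n:ℝ) ^ 2 / 2 * ε := by
  filter_upwards [tendsto_natCast_atTop_atTop.eventually_ge_atTop (2 * a / ε)] with n hn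
  rw [div_le_iff₀ hε] at hn
  nlinarith [Nat.cast_nonneg (α := ℝ) n]

lemma llI_relabel_le {g h : ℝ → ℝ → ℝ} (hg : IsKer g) {η : ℝ} (hη : 0 < η)
    (hgη : ∀ x y, g x y ∈ Set.Icc η (1 - η)) (hh : IsGraphon h) (σ τ : MPBij) :
    llI (relabel σ h) (relabel τ g) ≤ llI h h - (IrateTilde g h).toReal := by
  have e1 : llI (relabel σ h) (relabel τ g) = llI (relabel (σ.comp τ.inv) h) g := by
    rw [← llI_relabel (hh.isKer.relabel σ) (hg.relabel τ) τ.inv]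
    exact llI_congr (ae_of_all _ fun _ => rfl) (relabel_inv_ae τ g)
  obtain ⟨h1, h2⟩ := Irate_eq hη (hh.relabel (σ.comp τ.inv)) hg hgη
  have h3 : (IrateTilde g h).toReal ≤ llI h h - llI (relabel (σ.comp τ.inv) h) g := by
    have : IrateTilde g h ≤ Irate g (relabel (σ.comp τ.inv) h) := iInf_le _ _
    rw [h1] at this
    refine (ENNReal.toReal_mono ENNReal.ofReal_ne_top this).trans ?_
    rw [ENNReal.toReal_ofReal h2, llI_relabel hh.isKer hh.isKer]
  rw [e1]
  linarith

open Classical in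
/-- Upper bound for the probability that the random graph is close to a given graphon. -/
lemma exists_sum_wt_near_le {g h : ℝ → ℝ → ℝ} (hg : IsGraphon g) {η : ℝ} (hη : 0 < η)
    (hgη : ∀ x y, g x y ∈ Set.Icc η (1 - η)) (hh : IsGraphon h) {ε : ℝ} (hε : 0 < ε) :
    ∃ r > 0, ∃ ρ > 0, ∀ᶠ n : ℕ in atTop, ∀ _ : NeZero n, ∀ p : Fin n → Fin n → ℝ,
      (∀ i j, p i j = p j i) → (∀ i j, p i j ∈ Set.Icc η (1 - η)) → ∀ τ,
      L1dist (stepK p) (relabel τ g) < ρ →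
      ∑ ξ : Edge n → Bool with cutMetric h (stepK (adjM ξ)) < r, wt p ξ
        ≤ Real.exp (-((n:ℝ) ^ 2 / 2 * ((IrateTilde g h).toReal - ε))) := by
  obtain ⟨ρ, hρ, r1, hr1, hpair⟩ := exists_llI_pairing hg hη hgη (ε := ε / 4) (by positivity)
  obtain ⟨r2, hr2, hcard⟩ := exists_card_near_le hh (ε := ε / 4) (by positivity)
  refine ⟨min r1 r2, lt_min hr1 hr2, min ρ (η * (ε / 4)), lt_min hρ (by positivity), ?_⟩
  filter_upwards [hcard, eventually_mul_le_sq_mul (1 / η) (show 0 < ε / 4 by positivity)]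
    with n hn hlin hn0 p hps hp τ hL
  set M := (IrateTilde g h).toReal with hM
  have hpη : ∀ x y, stepK p x y ∈ Set.Icc η (1 - η) := fun x y => hp _ _
  have hbound : ∀ ξ ∈ Finset.univ.filter fun ξ : Edge n → Bool =>
      cutMetric h (stepK (adjM ξ)) < min r1 r2,
      wt p ξ ≤ Real.exp ((n:ℝ) ^ 2 / 2 * (llI h h - M + 3 * (ε / 4))) := by
    intro ξ hξ
    have hW := isGraphon_adjM ξ
    obtain ⟨σ, hσ⟩ := exists_of_cutMetric_lt hW.isKer hh.isKer
      (by rw [cutMetric_comm hW.isKer hh.isKer]; exact (Finset.mem_filter.1 hξ).2)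
    refine (wt_bounds hps hη hp ξ).2.trans ?_
    rw [Real.exp_le_exp]
    have h1 := hpair τ (stepK p) (isKer_stepK p) hpη (hL.trans_le (min_le_left _ _)) _ _ hW
      (hh.relabel σ) (hσ.le.trans (min_le_left _ _))
    have h2 := abs_llI_sub_le hη (hh.relabel σ) (isKer_stepK p) hpη (hg.isKer.relabel τ)
      fun x y => hgη _ _
    have h3 : L1dist (stepK p) (relabel τ g) / η ≤ ε / 4 := by
      rw [div_le_iff₀ hη]; linarith [hL.trans_le (min_le_right _ _)]
    have h4 := llI_relabel_le hg.isKer hη hgη hh σ τ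
    have h5 : llI (stepK (adjM ξ)) (stepK p) ≤ llI h h - M + 2 * (ε / 4) := by
      linarith [(abs_le.1 h1).2, (abs_le.1 h2).2]
    have h6 := mul_le_mul_of_nonneg_left h5 (by positivity : (0:ℝ) ≤ (n:ℝ) ^ 2 / 2)
    have h7 : (n:ℝ) / η = 1 / η * n := by ring
    linarith
  refine (Finset.sum_le_sum hbound).trans ?_
  rw [Finset.sum_const, nsmul_eq_mul]
  have hsub : ((Finset.univ.filter fun ξ : Edge n → Bool =>
      cutMetric h (stepK (adjM ξ)) < min r1 r2).card : ℝ)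
      ≤ Real.exp ((n:ℝ) ^ 2 / 2 * (-llI h h + ε / 4)) := by
    refine le_trans ?_ (hn hn0)
    exact_mod_cast Finset.card_le_card fun ξ hξ => Finset.mem_filter.2
      ⟨Finset.mem_univ _, lt_of_lt_of_le (Finset.mem_filter.1 hξ).2 (min_le_right _ _)⟩
  refine (mul_le_mul_of_nonneg_right hsub (Real.exp_pos _).le).trans ?_
  rw [← Real.exp_add, Real.exp_le_exp]
  linarith

open Classical in
/-- Lower bound for the probability that the random graph is close to a given graphon. -/
lemma exists_le_sum_wt_near {g h : ℝ → ℝ → ℝ} (hg : IsGraphon g) {η : ℝ} (hη : 0 < η)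
    (hgη : ∀ x y, g x y ∈ Set.Icc η (1 - η)) (hh : IsGraphon h) {ε : ℝ} (hε : 0 < ε)
    {r : ℝ} (hr : 0 < r) :
    ∃ ρ > 0, ∀ᶠ n : ℕ in atTop, ∀ _ : NeZero n, ∀ p : Fin n → Fin n → ℝ,
      (∀ i j, p i j = p j i) → (∀ i j, p i j ∈ Set.Icc η (1 - η)) → ∀ π : Equiv.Perm (Fin n),
      L1dist (stepK p) (relabel (blockPerm π) g) < ρ →
      Real.exp (-((n:ℝ) ^ 2 / 2 * (llI h h - llI h g + ε)))
        ≤ ∑ ξ : Edge n → Bool with cutMetric h (stepK (adjM ξ)) < r, wt p ξ := by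
  obtain ⟨ρ, hρ, r1, hr1, hpair⟩ := exists_llI_pairing hg hη hgη (ε := ε / 8) (by positivity)
  obtain ⟨C, hC, hself⟩ := exists_abs_llI_self_sub_le (ε := ε / 8) (by positivity)
  obtain ⟨δ, hδ0, hδ⟩ : ∃ δ > 0, δ < 1 ∧ δ ≤ r / 4 ∧ δ ≤ r1 / 4 ∧ δ ≤ ε / 8 / (2 * C) := by
    refine ⟨min (1 / 2) (min (r / 4) (min (r1 / 4) (ε / 8 / (2 * C)))), by positivity,
      ?_, ?_, ?_, ?_⟩
    · exact (min_le_left _ _).trans_lt (by norm_num)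
    · exact (min_le_right _ _).trans (min_le_left _ _)
    · exact (min_le_right _ _).trans ((min_le_right _ _).trans (min_le_left _ _))
    · exact (min_le_right _ _).trans ((min_le_right _ _).trans (min_le_right _ _))
  obtain ⟨hδ1, hδr, hδr1, hδC⟩ := hδ
  have hδI : δ ∈ Set.Ioo (0:ℝ) 1 := ⟨hδ0, hδ1⟩
  obtain ⟨hs, hsm⟩ := hh.smooth hδI
  have hδ2 : 0 < δ / 2 := by positivity
  obtain ⟨ρ', hρ', r2, hr2, hpair'⟩ := exists_llI_pairing hs hδ2 hsm (ε := ε / 8) (by positivity)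
  obtain ⟨N, hN⟩ := exists_stepK_near hs.1 hs.2.1 hsm (ε := min δ ρ') (lt_min hδ0 hρ')
  obtain ⟨c, hc0, hc1, hcr, hcr1, hcr2⟩ : ∃ c > 0, c ≤ 1 ∧ c ≤ r / 4 ∧ c ≤ r1 / 4 ∧ c ≤ r2 := by
    refine ⟨min 1 (min (r / 4) (min (r1 / 4) r2)), by positivity, min_le_left _ _, ?_, ?_, ?_⟩
    · exact (min_le_right _ _).trans (min_le_left _ _)
    · exact (min_le_right _ _).trans ((min_le_right _ _).trans (min_le_left _ _))
    · exact (min_le_right _ _).trans ((min_le_right _ _).trans (min_le_right _ _))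
  refine ⟨min ρ (η * (ε / 8)), lt_min hρ (by positivity), ?_⟩
  filter_upwards [eventually_half_le_sum_wt hc0 hc1, eventually_ge_atTop N, eventually_ge_atTop 1,
    eventually_mul_le_sq_mul (1 / η + 1 / (δ / 2) + 1) (show 0 < ε / 8 by positivity)]
    with n hhalf hNn hn1 hlin hn0 p hps hp π hL
  obtain ⟨A, hAs, hA, hAd⟩ := hN n hNn
  set τ := blockPerm π with hτ
  set q : Fin n → Fin n → ℝ := fun i j => A (π i) (π j) with hq
  have hqs : ∀ i j, q i j = q j i := fun i j => hAs _ _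
  have hqI : ∀ i j, q i j ∈ Set.Icc (δ / 2) (1 - δ / 2) := fun i j => hA _ _
  have hq01 : ∀ i j, q i j ∈ Set.Icc (0:ℝ) 1 := fun i j =>
    ⟨hδ2.le.trans (hqI i j).1, by linarith [(hqI i j).2]⟩
  have hqG : IsGraphon (stepK q) := isGraphon_stepK hqs hq01
  have hpη : ∀ x y, stepK p x y ∈ Set.Icc η (1 - η) := fun x y => hp _ _
  have hhτ := hh.relabel τ
  have hqd : L1dist (stepK q) (relabel τ (smooth δ h)) < min δ ρ' := by
    rw [L1dist_comm, ← L1dist_congr (ae_of_all _ fun _ => rfl) (relabel_blockPerm_stepK π A),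
      L1dist_relabel hs.isKer (isKer_stepK A)]
    exact hAd
  have hqh : L1dist (stepK q) (relabel τ h) ≤ 2 * δ := by
    refine (L1dist_triangle hqG.isKer (hs.isKer.relabel τ) hhτ.isKer).trans ?_
    rw [L1dist_relabel hs.isKer hh.isKer, L1dist_comm (smooth δ h)]
    linarith [hqd.trans_le (min_le_left _ _), L1dist_smooth_le hδI hh]
  have hqself : llI (stepK q) (stepK q) ≤ llI h h + 2 * (ε / 8) := by
    have h1 := (abs_le.1 (hself _ _ hqG hhτ)).2
    rw [llI_relabel hh.isKer hh.isKer] at h1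
    have h2 : C * L1dist (stepK q) (relabel τ h) ≤ ε / 8 := by
      rw [le_div_iff₀ (by positivity)] at hδC
      nlinarith
    linarith
  have hhp : llI h g - ε / 8 ≤ llI (relabel τ h) (stepK p) := by
    have h2 := abs_llI_sub_le hη hhτ (isKer_stepK p) hpη (hg.isKer.relabel τ)
      fun x y => hgη _ _
    have h3 : L1dist (stepK p) (relabel τ g) / η ≤ ε / 8 := by
      rw [div_le_iff₀ hη]; linarith [hL.trans_le (min_le_right _ _)]
    rw [llI_relabel hh.isKer hg.isKer] at h2
    linarith [(abs_le.1 h2).1]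
  set D := (n:ℝ) ^ 2 / 2 * (llI h g - llI h h - 5 * (ε / 8)) - n / η - n / (δ / 2) with hD
  have key : ∀ ξ : Edge n → Bool,
      (∀ S T : Finset (Fin n), |∑ i ∈ S, ∑ j ∈ T, (adjM ξ i j - q i j)| ≤ c * n ^ 2) →
      cutMetric h (stepK (adjM ξ)) < r ∧ wt q ξ * Real.exp D ≤ wt p ξ := by
    intro ξ hξ
    have hW := isGraphon_adjM ξ
    have hc := cutDist_stepK_le hξ
    have hWh : cutDist (stepK (adjM ξ)) (relabel τ h) ≤ c + 2 * δ :=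
      (cutDist_triangle hW.isKer hqG.isKer hhτ.isKer).trans
        (add_le_add hc ((cutDist_le_L1dist hqG.isKer hhτ.isKer).trans hqh))
    constructor
    · rw [cutMetric_comm hh.isKer hW.isKer]
      refine (cutMetric_le_relabel_right hW.isKer hh.isKer τ).trans_lt ?_
      linarith
    · have h1 := (abs_le.1 (hpair τ (stepK p) (isKer_stepK p) hpη
        (hL.trans_le (min_le_left _ _)) _ _
        hW hhτ (by linarith))).1
      have h2 := (abs_le.1 (hpair' τ (stepK q) (isKer_stepK q) (fun x y => hqI _ _)
        (hqd.trans_le (min_le_right _ _)) _ _ hW hqG (hc.trans hcr2))).2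
      refine (mul_le_mul_of_nonneg_right (wt_bounds hqs hδ2 hqI ξ).2 (Real.exp_pos _).le).trans
        (le_trans ?_ (wt_bounds hps hη hp ξ).1)
      rw [← Real.exp_add, Real.exp_le_exp, hD]
      have h5 : llI (stepK (adjM ξ)) (stepK q) + (llI h g - llI h h - 5 * (ε / 8))
          ≤ llI (stepK (adjM ξ)) (stepK p) := by linarith
      have h6 := mul_le_mul_of_nonneg_left h5 (by positivity : (0:ℝ) ≤ (n:ℝ) ^ 2 / 2)
      linarith
  have hp01 : ∀ i j, p i j ∈ Set.Icc (0:ℝ) 1 := fun i j =>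
    ⟨hη.le.trans (hp i j).1, by linarith [(hp i j).2]⟩
  have hhalf' := hhalf q hqs hq01
  calc Real.exp (-((n:ℝ) ^ 2 / 2 * (llI h h - llI h g + ε)))
      ≤ 1 / 2 * Real.exp D := by
        have h2 : Real.exp (-1) ≤ 1 / 2 := by
          rw [Real.exp_neg, inv_eq_one_div]
          exact one_div_le_one_div_of_le two_pos (by linarith [Real.add_one_le_exp (1:ℝ)])
        refine le_trans ?_ (mul_le_mul_of_nonneg_right h2 (Real.exp_pos _).le)
        rw [← Real.exp_add, Real.exp_le_exp, hD]
        have hn1' : (1:ℝ) ≤ n := by exact_mod_cast hn1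
        have h7 : (n:ℝ) / η = 1 / η * n := by ring
        have h8 : (n:ℝ) / (δ / 2) = 1 / (δ / 2) * n := by ring
        have h9 : 0 ≤ (n:ℝ) ^ 2 / 2 * (ε / 8) := by positivity
        rw [h7, h8]
        linarith
    _ ≤ (∑ ξ : Edge n → Bool with
        ∀ S T : Finset (Fin n), |∑ i ∈ S, ∑ j ∈ T, (adjM ξ i j - q i j)| ≤ c * n ^ 2, wt q ξ)
          * Real.exp D := mul_le_mul_of_nonneg_right hhalf' (Real.exp_pos _).le
    _ ≤ _ := by
        rw [Finset.sum_mul]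
        refine (Finset.sum_le_sum fun ξ hξ => (key ξ (Finset.mem_filter.1 hξ).2).2).trans
          (Finset.sum_le_sum_of_subset_of_nonneg (fun ξ hξ => Finset.mem_filter.2
            ⟨Finset.mem_univ _, (key ξ (Finset.mem_filter.1 hξ).2).1⟩)
            fun ξ _ _ => wt_nonneg hp01 ξ)

end
noncomputable section

/-! ### Truncated kernels -/

/-- Truncation of a kernel to the interval `[η, 1 - η]`. -/
def clampK (η : ℝ) (g : ℝ → ℝ → ℝ) : ℝ → ℝ → ℝ := fun x y => max η (min (1 - η) (g x y))

lemma clampK_mem {η : ℝ} (hη2 : η ≤ 1 - η) (g : ℝ → ℝ → ℝ) (x y : ℝ) :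
    clampK η g x y ∈ Set.Icc η (1 - η) :=
  ⟨le_max_left _ _, max_le hη2 (min_le_left _ _)⟩

lemma isGraphon_clampK {η : ℝ} (hη : 0 ≤ η) (hη2 : η ≤ 1 - η) {g : ℝ → ℝ → ℝ} (hg : IsGraphon g) :
    IsGraphon (clampK η g) := by
  refine ⟨measurable_const.max (measurable_const.min hg.1), fun x y => ?_, fun x y => ?_⟩
  · simp only [clampK, hg.2.1 x y]
  · have := clampK_mem hη2 g x y
    exact ⟨hη.trans this.1, by linarith [this.2]⟩

lemma clampK_eq_of_mem {η : ℝ} {g : ℝ → ℝ → ℝ} {x y : ℝ} (h : g x y ∈ Set.Icc η (1 - η)) :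
    clampK η g x y = g x y := by
  rw [clampK, min_eq_right h.2, max_eq_right h.1]

lemma abs_sub_clampK_le {η : ℝ} (g : ℝ → ℝ → ℝ) (x y : ℝ) {z : ℝ} (hz : z ∈ Set.Icc η (1 - η)) :
    |g x y - clampK η g x y| ≤ |g x y - z| := by
  obtain ⟨h1, h2⟩ := hz
  unfold clampK
  rcases le_total (1 - η) (g x y) with h | h
  · rw [min_eq_left h, max_eq_right (h1.trans h2), abs_of_nonneg (by linarith),
      abs_of_nonneg (by linarith)]
    linarith
  · rw [min_eq_right h]
    rcases le_total η (g x y) with h' | h'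
    · rw [max_eq_right h']; simp
    · rw [max_eq_left h', abs_of_nonpos (by linarith), abs_of_nonpos (by linarith)]
      linarith

/-! ### Weakly isomorphic graphons -/

lemma exists_relabel_sq_le {a b : ℝ → ℝ → ℝ} (ha : IsGraphon a) (hb : IsGraphon b)
    (hab : cutMetric a b = 0) {ε : ℝ} (hε : 0 < ε) :
    ∃ τ, ∫ p, (relabel τ a p.1 p.2 - b p.1 p.2) ^ 2 ∂sqMeas
      ≤ ∫ p, a p.1 p.2 * a p.1 p.2 ∂sqMeas - ∫ p, b p.1 p.2 * b p.1 p.2 ∂sqMeas + ε := by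
  obtain ⟨N, hN⟩ := exists_stepK_near hb.1 hb.2.1 hb.2.2 (ε := ε / 4) (by positivity)
  obtain ⟨k, _, hNk⟩ : ∃ (n : ℕ) (_ : NeZero n), N ≤ n := ⟨N + 1, inferInstance, by omega⟩
  obtain ⟨B, -, hB, hd⟩ := hN k hNk
  have hk : (0:ℝ) < k := by exact_mod_cast NeZero.pos k
  obtain ⟨τ, hτ⟩ := exists_of_cutMetric_lt hb.isKer ha.isKer (r := ε / 4 / (k * k * 1))
    (by rw [cutMetric_comm hb.isKer ha.isKer, hab]; positivity)
  refine ⟨τ, ?_⟩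
  have haτ := ha.relabel τ
  have kd := haτ.isKer.sub hb.isKer
  have kB := isKer_stepK B
  have h1 : |∫ p, stepK B p.1 p.2 * (relabel τ a p.1 p.2 - b p.1 p.2) ∂sqMeas| ≤ ε / 4 := by
    refine (abs_integral_label_mul_le haτ.isKer hb.isKer (measurable_vtx k) B (b := 1)
      fun i j => ?_).trans ?_
    · rw [abs_of_nonneg (hB i j).1]; exact (hB i j).2
    · rw [cutDist_comm, lt_div_iff₀ (by positivity)] at hτ
      linarith
  have h2 : |∫ p, (b p.1 p.2 - stepK B p.1 p.2) * (relabel τ a p.1 p.2 - b p.1 p.2) ∂sqMeas|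
      ≤ ε / 4 := by
    refine abs_integral_le_integral_abs.trans ?_
    rw [L1dist_eq] at hd
    refine le_trans (integral_mono ((hb.isKer.sub kB).mul kd).integrable.abs
      (hb.isKer.sub kB).integrable.abs fun p => ?_) hd.le
    change |(b p.1 p.2 - stepK B p.1 p.2) * (relabel τ a p.1 p.2 - b p.1 p.2)|
      ≤ |b p.1 p.2 - stepK B p.1 p.2|
    rw [abs_mul]
    refine mul_le_of_le_one_right (abs_nonneg _) (abs_le.2 ⟨?_, ?_⟩) <;>
      linarith [(haτ.2.2 p.1 p.2).1, (haτ.2.2 p.1 p.2).2, (hb.2.2 p.1 p.2).1, (hb.2.2 p.1 p.2).2]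
  have i1 := (kB.mul kd).integrable
  have i2 := ((hb.isKer.sub kB).mul kd).integrable
  have i3 := (haτ.isKer.mul haτ.isKer).integrable
  have i4 := (hb.isKer.mul hb.isKer).integrable
  have i5 : Integrable (fun p => relabel τ a p.1 p.2 * relabel τ a p.1 p.2 - b p.1 p.2 * b p.1 p.2)
    sqMeas := i3.sub i4
  have i6 : Integrable (fun p => relabel τ a p.1 p.2 * relabel τ a p.1 p.2
    - b p.1 p.2 * b p.1 p.2 - 2 * (stepK B p.1 p.2 * (relabel τ a p.1 p.2 - b p.1 p.2))) sqMeas :=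
    i5.sub (i1.const_mul 2)
  have e : ∫ p, (relabel τ a p.1 p.2 - b p.1 p.2) ^ 2 ∂sqMeas
      = ((∫ p, relabel τ a p.1 p.2 * relabel τ a p.1 p.2 ∂sqMeas
        - ∫ p, b p.1 p.2 * b p.1 p.2 ∂sqMeas)
        - 2 * ∫ p, stepK B p.1 p.2 * (relabel τ a p.1 p.2 - b p.1 p.2) ∂sqMeas)
        - 2 * ∫ p, (b p.1 p.2 - stepK B p.1 p.2) * (relabel τ a p.1 p.2 - b p.1 p.2) ∂sqMeas := by
    rw [← integral_const_mul, ← integral_const_mul, ← integral_sub i3 i4,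
      ← integral_sub i5 (i1.const_mul 2), ← integral_sub i6 (i2.const_mul 2)]
    refine integral_congr_ae (ae_of_all _ fun p => ?_)
    dsimp only
    ring
  have e3 : ∫ p, relabel τ a p.1 p.2 * relabel τ a p.1 p.2 ∂sqMeas
      = ∫ p, a p.1 p.2 * a p.1 p.2 ∂sqMeas :=
    τ.integral_comp (f := fun p => a p.1 p.2 * a p.1 p.2)
      (ha.isKer.mul ha.isKer).integrable.aestronglyMeasurable
  rw [e, e3]
  linarith [(abs_le.1 h1).1, (abs_le.1 h2).1]

lemma integral_sq_le_of_cutMetric_eq_zero {a b : ℝ → ℝ → ℝ} (ha : IsGraphon a) (hb : IsGraphon b)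
    (hab : cutMetric a b = 0) :
    ∫ p, b p.1 p.2 * b p.1 p.2 ∂sqMeas ≤ ∫ p, a p.1 p.2 * a p.1 p.2 ∂sqMeas := by
  refine le_of_forall_pos_le_add fun ε hε => ?_
  obtain ⟨τ, hτ⟩ := exists_relabel_sq_le ha hb hab hε
  have : 0 ≤ ∫ p, (relabel τ a p.1 p.2 - b p.1 p.2) ^ 2 ∂sqMeas :=
    integral_nonneg fun p => sq_nonneg _
  linarith

lemma exists_relabel_L1dist_lt {a b : ℝ → ℝ → ℝ} (ha : IsGraphon a) (hb : IsGraphon b)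
    (hab : cutMetric a b = 0) {ε : ℝ} (hε : 0 < ε) : ∃ τ, L1dist b (relabel τ a) < ε := by
  obtain ⟨τ, hτ⟩ := exists_relabel_sq_le ha hb hab (ε := ε * ε / 2) (by positivity)
  have h0 := integral_sq_le_of_cutMetric_eq_zero hb ha
    (by rw [cutMetric_comm hb.isKer ha.isKer, hab])
  refine ⟨τ, ?_⟩
  have haτ := ha.relabel τ
  have kd := haτ.isKer.sub hb.isKer
  have i2 : Integrable (fun p : ℝ × ℝ => (relabel τ a p.1 p.2 - b p.1 p.2) ^ 2) sqMeas := by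
    simpa only [pow_two] using (kd.mul kd).integrable
  have h1 : L1dist (relabel τ a) b
      ≤ ∫ p, (ε / 2 + (relabel τ a p.1 p.2 - b p.1 p.2) ^ 2 * (1 / (2 * ε))) ∂sqMeas := by
    rw [L1dist_eq]
    refine integral_mono kd.integrable.abs ((integrable_const _).add (i2.mul_const _)) fun p => ?_
    change |relabel τ a p.1 p.2 - b p.1 p.2|
      ≤ ε / 2 + (relabel τ a p.1 p.2 - b p.1 p.2) ^ 2 * (1 / (2 * ε))
    rw [mul_one_div, ← sq_abs, div_add_div _ _ two_ne_zero (by positivity),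
      le_div_iff₀ (by positivity)]
    nlinarith [sq_nonneg (ε - |relabel τ a p.1 p.2 - b p.1 p.2|)]
  rw [integral_add (integrable_const _) (i2.mul_const _), integral_mul_const] at h1
  rw [L1dist_comm]
  refine h1.trans_lt ?_
  have h2 : ∫ p, (relabel τ a p.1 p.2 - b p.1 p.2) ^ 2 ∂sqMeas ≤ ε * ε / 2 := by linarith
  have h3 := mul_le_mul_of_nonneg_right h2 (by positivity : 0 ≤ 1 / (2 * ε))
  have h4 : ε * ε / 2 * (1 / (2 * ε)) = ε / 4 := by field_simp; norm_num
  simp only [integral_const, probReal_univ, smul_eq_mul, one_mul]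
  linarith

lemma ae_eq_of_L1dist_eq_zero {h k : ℝ → ℝ → ℝ} (hh : IsKer h) (hk : IsKer k)
    (h0 : L1dist h k = 0) : ∀ᵐ p ∂sqMeas, h p.1 p.2 = k p.1 p.2 := by
  rw [L1dist_eq, integral_eq_zero_iff_of_nonneg (fun p => abs_nonneg _)
    (hh.sub hk).integrable.abs] at h0
  filter_upwards [h0] with p hp
  simpa [sub_eq_zero] using hp

/-- The rate function at an element of the weak isomorphism class of a reference graphon. -/
lemma exists_relabel_rate_le {a b h : ℝ → ℝ → ℝ} (ha : IsGraphon a) {η : ℝ} (hη : 0 < η)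
    (haη : ∀ x y, a x y ∈ Set.Icc η (1 - η)) (hb : IsGraphon b) (hab : cutMetric a b = 0)
    (hh : IsGraphon h) (σ : MPBij) {ε : ℝ} (hε : 0 < ε) :
    ∃ σ', ENNReal.ofReal (llI h h - llI (relabel σ' h) a)
      ≤ Irate b (relabel σ h) + ENNReal.ofReal ε := by
  have hη2 : η ≤ 1 - η := (haη 0 0).1.trans (haη 0 0).2
  have hbG := isGraphon_clampK hη.le hη2 hb
  have hbη := clampK_mem hη2 b
  have h0 : L1dist b (clampK η b) = 0 := by
    refine le_antisymm (le_of_forall_pos_le_add fun ε hε => ?_) (L1dist_nonneg _ _)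
    obtain ⟨τ, hτ⟩ := exists_relabel_L1dist_lt ha hb hab hε
    rw [zero_add]
    refine le_trans ?_ hτ.le
    rw [L1dist_eq, L1dist_eq]
    exact integral_mono (hb.isKer.sub hbG.isKer).integrable.abs
      (hb.isKer.sub (ha.relabel τ).isKer).integrable.abs fun p => abs_sub_clampK_le _ _ _ (haη _ _)
  have hbe := ae_eq_of_L1dist_eq_zero hb.isKer hbG.isKer h0
  obtain ⟨τ, hτ⟩ := exists_relabel_L1dist_lt ha hb hab (ε := η * ε) (by positivity)
  refine ⟨σ.comp τ.inv, ?_⟩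
  rw [Irate_congr hbe]
  obtain ⟨e, hnn⟩ := Irate_eq hη (hh.relabel σ) hbG.isKer hbη
  rw [e, ← ENNReal.ofReal_add hnn hε.le]
  refine ENNReal.ofReal_le_ofReal ?_
  have h1 := abs_llI_sub_le hη (hh.relabel σ) hbG.isKer hbη (ha.relabel τ).isKer
    fun x y => haη _ _
  have h2 : L1dist (clampK η b) (relabel τ a) / η ≤ ε := by
    rw [← L1dist_congr hbe (ae_of_all _ fun _ => rfl), div_le_iff₀ hη]; linarith
  have h3 : llI (relabel σ h) (relabel τ a) = llI (relabel (σ.comp τ.inv) h) a := by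
    rw [← llI_relabel (hh.isKer.relabel σ) (ha.isKer.relabel τ) τ.inv]
    exact llI_congr (ae_of_all _ fun _ => rfl) (relabel_inv_ae τ a)
  rw [llI_relabel hh.isKer hh.isKer, ← h3]
  linarith [(abs_le.1 h1).2]

end

/-! ### The random graph given its types -/

noncomputable section

/-- The edge indicators determined by independent uniforms. -/
def edgeBits {n : ℕ} (p : Fin n → Fin n → ℝ) (u : Fin n × Fin n → ℝ) : Edge n → Bool :=
  open Classical in fun e => decide (u e.1 ≤ p e.1.1 e.1.2)

lemma edgeBits_eq_iff {n : ℕ} {p : Fin n → Fin n → ℝ} {u : Fin n × Fin n → ℝ}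
    {ξ : Edge n → Bool} :
    edgeBits p u = ξ ↔ ∀ e, u e.1 ∈ if ξ e then Set.Iic (p e.1.1 e.1.2)
      else Set.Ioi (p e.1.1 e.1.2) := by
  rw [funext_iff]
  refine forall_congr' fun e => ?_
  cases ξ e <;> simp [edgeBits]

lemma unitMeas_Iic {t : ℝ} (ht : t ∈ Set.Icc (0:ℝ) 1) :
    unitMeas (Set.Iic t) = ENNReal.ofReal t := by
  have : Set.Iic t ∩ Set.Icc 0 1 = Set.Icc 0 t := by
    ext y
    simp only [Set.mem_inter_iff, Set.mem_Iic, Set.mem_Icc]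
    constructor
    · rintro ⟨h1, h2, -⟩
      exact ⟨h2, h1⟩
    · rintro ⟨h1, h2⟩
      exact ⟨h2, h1, h2.trans ht.2⟩
  rw [unitMeas, Measure.restrict_apply measurableSet_Iic, this, Real.volume_Icc, sub_zero]

lemma unitMeas_Ioi {t : ℝ} (ht : t ∈ Set.Icc (0:ℝ) 1) :
    unitMeas (Set.Ioi t) = ENNReal.ofReal (1 - t) := by
  have : Set.Ioi t ∩ Set.Icc 0 1 = Set.Ioc t 1 := by
    ext y
    simp only [Set.mem_inter_iff, Set.mem_Ioi, Set.mem_Icc, Set.mem_Ioc]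
    constructor
    · rintro ⟨h1, -, h2⟩
      exact ⟨h1, h2⟩
    · rintro ⟨h1, h2⟩
      exact ⟨h1, ht.1.trans h1.le, h2⟩
  rw [unitMeas, Measure.restrict_apply measurableSet_Ioi, this, Real.volume_Ioc]

instance isProbabilityMeasure_cubeMeasure (n : ℕ) : IsProbabilityMeasure (cubeMeasure n) := by
  have : IsProbabilityMeasure (volume.restrict (Set.Icc (0:ℝ) 1)) :=
    isProbabilityMeasure_unitMeas
  unfold cubeMeasure
  infer_instance

lemma cubeMeasure_edgeBits_singleton {n : ℕ} {p : Fin n → Fin n → ℝ}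
    (hp : ∀ i j, p i j ∈ Set.Icc (0:ℝ) 1) (ξ : Edge n → Bool) :
    cubeMeasure n (edgeBits p ⁻¹' {ξ}) = ENNReal.ofReal (wt p ξ) := by
  classical
  set s : Fin n × Fin n → Set ℝ := fun q => if h : q.1 < q.2 then
    (if ξ ⟨q, h⟩ then Set.Iic (p q.1 q.2) else Set.Ioi (p q.1 q.2)) else Set.univ with hs
  have h1 : edgeBits p ⁻¹' {ξ} = Set.pi Set.univ s := by
    ext u
    rw [Set.mem_preimage, Set.mem_singleton_iff, edgeBits_eq_iff, Set.mem_univ_pi]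
    constructor
    · intro h q
      by_cases hq : q.1 < q.2
      · simpa [hs, hq] using h ⟨q, hq⟩
      · simp [hs, hq]
    · intro h e
      simpa [hs, e.2] using h e.1
  have h2 : ∀ e : Edge n, unitMeas (s e.1)
      = ENNReal.ofReal (if ξ e then p e.1.1 e.1.2 else 1 - p e.1.1 e.1.2) := fun e => by
    have he : s e.1 = if ξ e then Set.Iic (p e.1.1 e.1.2) else Set.Ioi (p e.1.1 e.1.2) := by
      simp [hs, e.2]
    rw [he]
    split_ifs
    · exact unitMeas_Iic (hp _ _)
    · exact unitMeas_Ioi (hp _ _)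
  have : SigmaFinite (volume.restrict (Set.Icc (0:ℝ) 1)) := inferInstance
  rw [h1, cubeMeasure, Measure.pi_pi, wt, ENNReal.ofReal_prod_of_nonneg]
  · change ∏ q, unitMeas (s q) = _
    rw [← Finset.prod_subset (Finset.subset_univ (Finset.univ.filter fun e : Fin n × Fin n =>
      e.1 < e.2))]
    · rw [Finset.prod_subtype (p := fun e : Fin n × Fin n => e.1 < e.2) _ (fun e => by simp)]
      exact Finset.prod_congr rfl fun e _ => h2 e
    · intro q _ hq
      have hq' : ¬ q.1 < q.2 := by simpa using hq
      simp [hs, hq']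
  · intro e _
    have := hp e.1.1 e.1.2
    split_ifs
    · exact this.1
    · linarith [this.2]

lemma measurableSet_edgeBits_eq {α : Type*} [MeasurableSpace α] {n : ℕ}
    {P : α → Fin n → Fin n → ℝ} (hP : ∀ i j, Measurable fun x => P x i j)
    {U : α → Fin n × Fin n → ℝ} (hU : Measurable U) (ξ : Edge n → Bool) :
    MeasurableSet {x | edgeBits (P x) (U x) = ξ} := by
  have : {x | edgeBits (P x) (U x) = ξ} = ⋂ e, {x | edgeBits (P x) (U x) e = ξ e} := by
    ext x
    simp [funext_iff]
  rw [this]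
  refine MeasurableSet.iInter fun e => ?_
  have h1 : MeasurableSet {x | U x e.1 ≤ P x e.1.1 e.1.2} :=
    measurableSet_le ((measurable_pi_apply _).comp hU) (hP _ _)
  cases hb : ξ e
  · convert h1.compl using 1
    ext x
    simp [edgeBits]
  · convert h1 using 1
    ext x
    simp [edgeBits]

lemma cubeMeasure_edgeBits {n : ℕ} {p : Fin n → Fin n → ℝ}
    (hp : ∀ i j, p i j ∈ Set.Icc (0:ℝ) 1) (A : Finset (Edge n → Bool)) :
    cubeMeasure n (edgeBits p ⁻¹' A) = ENNReal.ofReal (∑ ξ ∈ A, wt p ξ) := by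
  rw [← sum_measure_preimage_singleton (f := edgeBits p) _ fun ξ _ =>
      measurableSet_edgeBits_eq (P := fun _ => p) (fun _ _ => measurable_const) measurable_id ξ,
    ENNReal.ofReal_sum_of_nonneg fun ξ _ => wt_nonneg hp ξ]
  exact Finset.sum_congr rfl fun ξ _ => cubeMeasure_edgeBits_singleton hp ξ

/-! ### The empirical graphon of the random graph -/

/-- The edge probabilities of the random graph with types `x`. -/
def edgeProb (Hfun : ℝ → ℝ → M01 → ℝ) {n : ℕ} (x : Fin n → ↥(Set.Icc (0:ℝ) 1)) (i j : Fin n) :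
    ℝ :=
  Hfun (x i) (x j) (empMeas x)

lemma adjM_edgeBits {n : ℕ} {p : Fin n → Fin n → ℝ} (hs : ∀ i j, p i j = p j i)
    (u : Fin n × Fin n → ℝ) (i j : Fin n) : adjM (edgeBits p u) i j
      = open Classical in if i ≠ j ∧ u (min i j, max i j) ≤ p i j then 1 else 0 := by
  classical
  rcases lt_trichotomy i j with h | h | h
  · simp [adjM, h, edgeBits, bit, h.ne, min_eq_left h.le, max_eq_right h.le]
  · simp [h, adjM_self]
  · simp [adjM, h, h.not_gt, edgeBits, bit, h.ne', min_eq_right h.le, max_eq_left h.le, hs i j]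

lemma isGraphon_empGraphon {n : ℕ} {A : Fin n → Fin n → Prop} (hA : ∀ i j, A i j ↔ A j i) :
    IsGraphon (empGraphon A) := by
  classical
  refine ⟨?_, fun x y => ?_, fun x y => ?_⟩
  · have : Measurable fun p : ℝ × ℝ => (vertexOf n p.1, vertexOf n p.2) :=
      ((measurable_vertexOf n).comp measurable_fst).prodMk
        ((measurable_vertexOf n).comp measurable_snd)
    exact (Measurable.of_discrete (f := fun q : ℕ × ℕ =>
      if h : q.1 - 1 < n ∧ q.2 - 1 < n then
        (if A ⟨q.1 - 1, h.1⟩ ⟨q.2 - 1, h.2⟩ then (1:ℝ) else 0) else 0)).comp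
      this
  · unfold empGraphon
    by_cases h1 : vertexOf n x - 1 < n <;> by_cases h2 : vertexOf n y - 1 < n <;>
      simp [h1, h2, hA ⟨vertexOf n x - 1, _⟩]
  · unfold empGraphon
    split_ifs <;> simp

lemma empGraphon_ae_eq {n : ℕ} [NeZero n] (A : Fin n → Fin n → Prop) :
    ∀ᵐ p ∂sqMeas, empGraphon A p.1 p.2
      = stepK (fun i j => open Classical in if A i j then 1 else 0) p.1 p.2 := by
  filter_upwards [ae_sq_of_ae ae_mem_Ioc] with p hp
  have hv : ∀ {x : ℝ}, x ∈ Set.Ioc (0:ℝ) 1 → ∃ h : vertexOf n x - 1 < n,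
      vtx n x = ⟨vertexOf n x - 1, h⟩ := fun {x} hx => by
    obtain ⟨h1, h2, -, -⟩ := vertexOf_le_iff (NeZero.pos n) hx
    have h : vertexOf n x - 1 < n := by omega
    refine ⟨h, ?_⟩
    ext
    simp only [vtx]
    omega
  obtain ⟨h1, e1⟩ := hv hp.1
  obtain ⟨h2, e2⟩ := hv hp.2
  rw [empGraphon, dif_pos ⟨h1, h2⟩, stepK, e1, e2]

lemma irgtAdj_symm {Hfun : ℝ → ℝ → M01 → ℝ} {n : ℕ}
    (x : Fin n → ↥(Set.Icc (0:ℝ) 1)) (u : Fin n × Fin n → ℝ)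
    (Hsymm : ∀ a b F, Hfun a b F = Hfun b a F) (i j : Fin n) :
    irgtAdj Hfun x u i j ↔ irgtAdj Hfun x u j i := by
  simp only [irgtAdj, min_comm i j, max_comm i j, ne_comm (a := i), Hsymm (x i) (x j)]

lemma empGraphon_irgtAdj_ae_eq {Hfun : ℝ → ℝ → M01 → ℝ} {n : ℕ} [NeZero n]
    (x : Fin n → ↥(Set.Icc (0:ℝ) 1)) (u : Fin n × Fin n → ℝ)
    (Hsymm : ∀ a b F, Hfun a b F = Hfun b a F) :
    ∀ᵐ p ∂sqMeas, empGraphon (irgtAdj Hfun x u) p.1 p.2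
      = stepK (adjM (edgeBits (edgeProb Hfun x) u)) p.1 p.2 := by
  classical
  filter_upwards [empGraphon_ae_eq (irgtAdj Hfun x u)] with p hp
  rw [hp, stepK, stepK, adjM_edgeBits (p := edgeProb Hfun x) fun i j => Hsymm _ _ _]
  exact if_congr Iff.rfl rfl rfl

end

/-! ### Induced graphons of empirical type distributions -/

noncomputable section

lemma empMeas_coe {n : ℕ} [NeZero n] (x : Fin n → ↥(Set.Icc (0:ℝ) 1)) :
    (empMeas x : Measure ↥(Set.Icc (0:ℝ) 1)) = empMeasAux x := by
  have : empMeas x = ⟨empMeasAux x, empMeasAux_isProb (NeZero.ne n) x⟩ := dif_neg (NeZero.ne n)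
  rw [this]
  rfl

lemma cdfM_empMeas {n : ℕ} [NeZero n] (x : Fin n → ↥(Set.Icc (0:ℝ) 1)) (y : ℝ) :
    cdfM (empMeas x) y = ((Finset.univ.filter fun i => (x i : ℝ) ≤ y).card : ℝ) / n := by
  have hm : MeasurableSet {t : ↥(Set.Icc (0:ℝ) 1) | (t : ℝ) ≤ y} :=
    measurableSet_le measurable_subtype_coe measurable_const
  rw [cdfM, empMeas_coe, empMeasAux, Measure.smul_apply, Measure.coe_finsetSum,
    Finset.sum_apply]
  simp only [Measure.dirac_apply' _ hm, Set.indicator_apply, Set.mem_ofPred_eq, Pi.one_apply,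
    Finset.sum_boole, smul_eq_mul, ENNReal.toReal_mul, ENNReal.toReal_inv, ENNReal.toReal_natCast]
  ring

lemma geninv_empMeas {n : ℕ} [NeZero n] {x : Fin n → ↥(Set.Icc (0:ℝ) 1)}
    {π : Equiv.Perm (Fin n)} (hπ : Monotone (x ∘ π)) {u : ℝ} {i : Fin n}
    (hu : u ∈ Set.Ioo ((i:ℝ) / n) (((i:ℝ) + 1) / n)) : geninv (empMeas x) u = x (π i) := by
  have hn : (0:ℝ) < n := by exact_mod_cast NeZero.pos n
  have hcard : ∀ y, (Finset.univ.filter fun j => (x j : ℝ) ≤ y).card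
      = (Finset.univ.filter fun j => (x (π j) : ℝ) ≤ y).card := fun y =>
    (Finset.card_equiv π fun j => by simp).symm
  have : {y | y ∈ Set.Icc (0:ℝ) 1 ∧ u < cdfM (empMeas x) y} = Set.Icc (x (π i) : ℝ) 1 := by
    ext y
    simp only [Set.mem_ofPred_eq, Set.mem_Icc, cdfM_empMeas, hcard]
    constructor
    · rintro ⟨⟨h0, h1⟩, h⟩
      refine ⟨?_, h1⟩
      by_contra! hy
      have hle : (Finset.univ.filter fun j => (x (π j) : ℝ) ≤ y).card ≤ i := by
        rw [← Fin.card_Iio i]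
        refine Finset.card_le_card fun j hj => ?_
        rw [Finset.mem_filter] at hj
        rw [Finset.mem_Iio]
        by_contra! hij
        have h2 : (x (π i) : ℝ) ≤ x (π j) := hπ hij
        linarith [hj.2]
      have h3 : ((Finset.univ.filter fun j => (x (π j) : ℝ) ≤ y).card : ℝ) / n ≤ (i:ℝ) / n := by
        gcongr
      linarith [hu.1]
    · rintro ⟨h0, h1⟩
      refine ⟨⟨(x (π i)).2.1.trans h0, h1⟩, hu.2.trans_le ?_⟩
      have hle : (i:ℕ) + 1 ≤ (Finset.univ.filter fun j => (x (π j) : ℝ) ≤ y).card := by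
        rw [← Fin.card_Iic i]
        refine Finset.card_le_card fun j hj => ?_
        rw [Finset.mem_Iic] at hj
        rw [Finset.mem_filter]
        exact ⟨Finset.mem_univ _, le_trans (hπ hj : x (π j) ≤ x (π i)) h0⟩
      have hle' : (i:ℝ) + 1 ≤ ((Finset.univ.filter fun j => (x (π j) : ℝ) ≤ y).card : ℝ) := by
        exact_mod_cast hle
      gcongr
  rw [geninv, this, csInf_Icc (x (π i)).2.2]

lemma ae_geninv_empMeas {n : ℕ} [NeZero n] {x : Fin n → ↥(Set.Icc (0:ℝ) 1)}
    {π : Equiv.Perm (Fin n)} (hπ : Monotone (x ∘ π)) :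
    ∀ᵐ u ∂unitMeas, geninv (empMeas x) u = x (π (vtx n u)) := by
  have hfin : (Set.range fun i : Fin n => ((i:ℝ) + 1) / n).Finite := Set.finite_range _
  have h0 : ∀ᵐ u ∂unitMeas, u ∉ Set.range fun i : Fin n => ((i:ℝ) + 1) / n :=
    ae_restrict_of_ae (compl_mem_ae_iff.2 (hfin.measure_zero _))
  filter_upwards [h0, ae_mem_Ioc] with u hu hu1
  have hb := vtx_mem_block (n := n) hu1
  exact geninv_empMeas hπ ⟨hb.1, lt_of_le_of_ne hb.2 fun h => hu ⟨_, h.symm⟩⟩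

lemma inducedGraphon_empMeas {Hfun : ℝ → ℝ → M01 → ℝ} {n : ℕ} [NeZero n]
    {x : Fin n → ↥(Set.Icc (0:ℝ) 1)} {π : Equiv.Perm (Fin n)} (hπ : Monotone (x ∘ π)) :
    ∀ᵐ p ∂sqMeas, inducedGraphon Hfun (empMeas x) p.1 p.2
      = stepK (fun i j => edgeProb Hfun x (π i) (π j)) p.1 p.2 := by
  filter_upwards [ae_sq_of_ae (ae_geninv_empMeas hπ)] with p hp
  rw [inducedGraphon, hp.1, hp.2]
  rfl

lemma exists_monotone_comp {n : ℕ} (x : Fin n → ↥(Set.Icc (0:ℝ) 1)) :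
    ∃ π : Equiv.Perm (Fin n), Monotone (x ∘ π) :=
  ⟨Tuple.sort x, Tuple.monotone_sort x⟩

lemma exists_perm_L1dist_edgeProb {Hfun : ℝ → ℝ → M01 → ℝ} {n : ℕ} [NeZero n]
    (hG : ∀ F : M01, IsGraphon (inducedGraphon Hfun F)) (x : Fin n → ↥(Set.Icc (0:ℝ) 1)) :
    ∃ π : Equiv.Perm (Fin n), ∀ g, IsKer g →
      L1dist (stepK (edgeProb Hfun x)) (relabel (blockPerm π) g)
        = L1dist (inducedGraphon Hfun (empMeas x)) g := by
  obtain ⟨π, hπ⟩ := exists_monotone_comp x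
  refine ⟨π⁻¹, fun g hg => ?_⟩
  rw [← L1dist_relabel (hG _).isKer hg (blockPerm π⁻¹)]
  refine L1dist_congr ?_ (ae_of_all _ fun _ => rfl)
  filter_upwards [(blockPerm π⁻¹).ae (inducedGraphon_empMeas (Hfun := Hfun) hπ),
    relabel_blockPerm_stepK π⁻¹ fun i j => edgeProb Hfun x (π i) (π j)] with p h1 h2
  rw [relabel, h1]
  refine Eq.trans ?_ h2.symm
  simp [stepK]

lemma frequently_vtx {n : ℕ} [NeZero n] (i j : Fin n) :
    ∃ᵐ p ∂sqMeas, vtx n p.1 = i ∧ vtx n p.2 = j := by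
  rw [frequently_ae_iff]
  have : {p : ℝ × ℝ | vtx n p.1 = i ∧ vtx n p.2 = j} = (vtx n ⁻¹' {i}) ×ˢ (vtx n ⁻¹' {j}) := rfl
  rw [this, sqMeas, Measure.prod_prod, unitMeas_vtx, unitMeas_vtx]
  have hn : (0:ℝ) < n := by exact_mod_cast NeZero.pos n
  simp only [ne_eq, mul_eq_zero, ENNReal.ofReal_eq_zero, or_self, not_le]
  positivity

lemma edgeProb_mem {Hfun : ℝ → ℝ → M01 → ℝ} {n : ℕ} [NeZero n]
    (x : Fin n → ↥(Set.Icc (0:ℝ) 1)) {s : Set ℝ}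
    (hs : ∀ᵐ p ∂sqMeas, inducedGraphon Hfun (empMeas x) p.1 p.2 ∈ s) (i j : Fin n) :
    edgeProb Hfun x i j ∈ s := by
  obtain ⟨π, hπ⟩ := exists_monotone_comp x
  obtain ⟨p, ⟨h1, h2⟩, h3, h4⟩ := ((frequently_vtx (π⁻¹ i) (π⁻¹ j)).and_eventually
    (hs.and (inducedGraphon_empMeas (Hfun := Hfun) hπ))).exists
  rw [h4, stepK, h1, h2] at h3
  simpa using h3

/-! ### Measurability in the types -/

lemma continuous_empMeas (n : ℕ) [NeZero n] :
    Continuous fun x : Fin n → ↥(Set.Icc (0:ℝ) 1) => empMeas x := by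
  rw [continuous_iff_continuousAt]
  intro x₀
  rw [ContinuousAt, ProbabilityMeasure.tendsto_iff_forall_integral_tendsto]
  intro f
  have h : ∀ x : Fin n → ↥(Set.Icc (0:ℝ) 1),
      ∫ t, f t ∂(empMeas x : Measure ↥(Set.Icc (0:ℝ) 1)) = (n:ℝ)⁻¹ * ∑ i, f (x i) := fun x => by
    rw [empMeas_coe, empMeasAux, integral_smul_measure,
      integral_finsetSum_measure fun i _ => f.integrable _]
    simp
  simp only [h]
  have : Continuous fun x : Fin n → ↥(Set.Icc (0:ℝ) 1) => (n:ℝ)⁻¹ * ∑ i, f (x i) := by fun_prop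
  exact this.tendsto x₀

lemma continuous_setIntegral_inducedGraphon {Hfun : ℝ → ℝ → M01 → ℝ}
    (hG : ∀ F : M01, IsGraphon (inducedGraphon Hfun F))
    (hcont : ∀ F₀ : M01, Tendsto (fun F => L1dist (inducedGraphon Hfun F) (inducedGraphon Hfun F₀))
      (nhds F₀) (nhds 0)) (A : Set (ℝ × ℝ)) :
    Continuous fun F => ∫ p in A, inducedGraphon Hfun F p.1 p.2 ∂sqMeas := by
  rw [continuous_iff_continuousAt]
  intro F₀
  rw [ContinuousAt, tendsto_iff_dist_tendsto_zero]
  refine squeeze_zero (fun _ => dist_nonneg) (fun F => ?_) (hcont F₀)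
  rw [Real.dist_eq, ← integral_sub (hG F).isKer.integrable.integrableOn
    (hG F₀).isKer.integrable.integrableOn]
  exact abs_rectInt_le_L1dist (hG F).isKer (hG F₀).isKer A

lemma measurable_edgeProb {Hfun : ℝ → ℝ → M01 → ℝ} {n : ℕ} [NeZero n]
    (hG : ∀ F : M01, IsGraphon (inducedGraphon Hfun F))
    (hcont : ∀ F₀ : M01, Tendsto (fun F => L1dist (inducedGraphon Hfun F) (inducedGraphon Hfun F₀))
      (nhds F₀) (nhds 0)) (i j : Fin n) :
    Measurable fun x : Fin n → ↥(Set.Icc (0:ℝ) 1) => edgeProb Hfun x i j := by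
  set Q : Equiv.Perm (Fin n) → (Fin n → ↥(Set.Icc (0:ℝ) 1)) → ℝ := fun π x => (n:ℝ) ^ 2 *
    ∫ p in (vtx n ⁻¹' {π⁻¹ i}) ×ˢ (vtx n ⁻¹' {π⁻¹ j}),
      inducedGraphon Hfun (empMeas x) p.1 p.2 ∂sqMeas with hQ
  have hQc : ∀ π, Continuous (Q π) := fun π =>
    continuous_const.mul ((continuous_setIntegral_inducedGraphon hG hcont _).comp
      (continuous_empMeas n))
  have hn : (n:ℝ) ≠ 0 := by exact_mod_cast NeZero.ne n
  have hQe : ∀ (π : Equiv.Perm (Fin n)) (x), Monotone (x ∘ π) →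
      Q π x = edgeProb Hfun x i j := fun π x hπ => by
    have hm : MeasurableSet ((vtx n ⁻¹' {π⁻¹ i}) ×ˢ (vtx n ⁻¹' {π⁻¹ j})) :=
      (measurable_vtx n (measurableSet_singleton _)).prod
        (measurable_vtx n (measurableSet_singleton _))
    have h1 : ∫ p in (vtx n ⁻¹' {π⁻¹ i}) ×ˢ (vtx n ⁻¹' {π⁻¹ j}),
        inducedGraphon Hfun (empMeas x) p.1 p.2 ∂sqMeas
        = ∫ _ in (vtx n ⁻¹' {π⁻¹ i}) ×ˢ (vtx n ⁻¹' {π⁻¹ j}), edgeProb Hfun x i j ∂sqMeas := by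
      refine setIntegral_congr_ae hm ?_
      filter_upwards [inducedGraphon_empMeas (Hfun := Hfun) hπ] with p hp hpm
      have e1 : vtx n p.1 = π⁻¹ i := hpm.1
      have e2 : vtx n p.2 = π⁻¹ j := hpm.2
      rw [hp, stepK, e1, e2]
      simp
    rw [hQ]
    dsimp only
    rw [h1, setIntegral_const, smul_eq_mul, sqMeas, measureReal_prod_prod, unitMeas_real_vtx,
      unitMeas_real_vtx]
    field_simp
  have hD : ∀ π : Equiv.Perm (Fin n),
      MeasurableSet {x : Fin n → ↥(Set.Icc (0:ℝ) 1) | Monotone (x ∘ π)} := fun π => by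
    have : {x : Fin n → ↥(Set.Icc (0:ℝ) 1) | Monotone (x ∘ π)}
        = ⋂ k, ⋂ l, ⋂ (_ : k ≤ l), {x | x (π k) ≤ x (π l)} := by
      ext x
      simp [Monotone]
    rw [this]
    exact MeasurableSet.iInter fun k => MeasurableSet.iInter fun l => MeasurableSet.iInter fun _ =>
      measurableSet_le (measurable_pi_apply _) (measurable_pi_apply _)
  intro t ht
  have : (fun x : Fin n → ↥(Set.Icc (0:ℝ) 1) => edgeProb Hfun x i j) ⁻¹' t
      = ⋃ π : Equiv.Perm (Fin n), {x | Monotone (x ∘ π)} ∩ Q π ⁻¹' t := by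
    ext x
    simp only [Set.mem_preimage, Set.mem_iUnion, Set.mem_inter_iff, Set.mem_ofPred_eq]
    constructor
    · intro hx
      obtain ⟨π, hπ⟩ := exists_monotone_comp x
      exact ⟨π, hπ, by rwa [hQe π x hπ]⟩
    · rintro ⟨π, hπ, hx⟩
      rwa [hQe π x hπ] at hx
  rw [this]
  exact MeasurableSet.iUnion fun π => (hD π).inter ((hQc π).measurable ht)

end

/-! ### Joint law of the type distribution and the graph -/

noncomputable section

lemma cutMetric_congr_right {h k m : ℝ → ℝ → ℝ} (hkm : ∀ᵐ p ∂sqMeas, k p.1 p.2 = m p.1 p.2) :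
    cutMetric h k = cutMetric h m := by
  unfold cutMetric
  congr 1; ext σ; congr 1; ext τ
  exact cutDist_congr (ae_of_all _ fun _ => rfl) (τ.ae hkm)

section Joint

variable {Hfun : ℝ → ℝ → M01 → ℝ} {n : ℕ} {h : ℝ → ℝ → ℝ} {r : ℝ} {V : Set M01}

/-- The event that the type distribution lies in `V` and the graph is `r`-close to `h`. -/
def nearEvent (Hfun : ℝ → ℝ → M01 → ℝ) (n : ℕ) (V : Set M01) (h : ℝ → ℝ → ℝ) (r : ℝ) :
    Set ((Fin n → ↥(Set.Icc (0:ℝ) 1)) × (Fin n × Fin n → ℝ)) :=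
  {ω | empMeas ω.1 ∈ V ∧ cutMetric h (empGraphon (irgtAdj Hfun ω.1 ω.2)) < r}

open Classical in
lemma mem_nearEvent [NeZero n] (Hsymm : ∀ a b F, Hfun a b F = Hfun b a F)
    (ω : (Fin n → ↥(Set.Icc (0:ℝ) 1)) × (Fin n × Fin n → ℝ)) :
    ω ∈ nearEvent Hfun n V h r ↔ empMeas ω.1 ∈ V ∧ edgeBits (edgeProb Hfun ω.1) ω.2 ∈
      (Finset.univ.filter fun ξ : Edge n → Bool => cutMetric h (stepK (adjM ξ)) < r) := by
  rw [nearEvent, Set.mem_ofPred_eq,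
    cutMetric_congr_right (empGraphon_irgtAdj_ae_eq ω.1 ω.2 Hsymm)]
  simp

lemma measurableSet_nearEvent [NeZero n] (Hsymm : ∀ a b F, Hfun a b F = Hfun b a F)
    (hG : ∀ F : M01, IsGraphon (inducedGraphon Hfun F))
    (hcont : ∀ F₀ : M01, Tendsto (fun F => L1dist (inducedGraphon Hfun F) (inducedGraphon Hfun F₀))
      (nhds F₀) (nhds 0))
    (hV : MeasurableSet ((fun x : Fin n → ↥(Set.Icc (0:ℝ) 1) => empMeas x) ⁻¹' V)) :
    MeasurableSet (nearEvent Hfun n V h r) := by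
  classical
  have : nearEvent Hfun n V h r = (Prod.fst ⁻¹' ((fun x => empMeas x) ⁻¹' V)) ∩
      ⋃ ξ ∈ (Finset.univ.filter fun ξ : Edge n → Bool => cutMetric h (stepK (adjM ξ)) < r),
        {ω | edgeBits (edgeProb Hfun ω.1) ω.2 = ξ} := by
    ext ω
    rw [mem_nearEvent Hsymm]
    simp
  rw [this]
  refine (measurable_fst hV).inter (Finset.measurableSet_biUnion _ fun ξ _ => ?_)
  exact measurableSet_edgeBits_eq
    (fun i j => (measurable_edgeProb hG hcont i j).comp measurable_fst)
    measurable_snd ξ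

open Classical in
lemma cubeMeasure_nearEvent [NeZero n] (Hsymm : ∀ a b F, Hfun a b F = Hfun b a F)
    (Hrange : ∀ a b F, Hfun a b F ∈ Set.Icc (0:ℝ) 1) (x : Fin n → ↥(Set.Icc (0:ℝ) 1)) :
    cubeMeasure n (Prod.mk x ⁻¹' nearEvent Hfun n V h r) = if empMeas x ∈ V then
      ENNReal.ofReal (∑ ξ : Edge n → Bool with cutMetric h (stepK (adjM ξ)) < r,
        wt (edgeProb Hfun x) ξ) else 0 := by
  split_ifs with hx
  · rw [← cubeMeasure_edgeBits (p := edgeProb Hfun x) fun i j => Hrange _ _ _]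
    congr 1
    ext u
    rw [Set.mem_preimage, mem_nearEvent Hsymm]
    exact and_iff_right hx
  · convert measure_empty (μ := cubeMeasure n)
    ext u
    simp [nearEvent, hx]

variable (ν : Measure (Fin n → ↥(Set.Icc (0:ℝ) 1)))

open Classical in
lemma prod_nearEvent_le [NeZero n] (Hsymm : ∀ a b F, Hfun a b F = Hfun b a F)
    (Hrange : ∀ a b F, Hfun a b F ∈ Set.Icc (0:ℝ) 1)
    (hG : ∀ F : M01, IsGraphon (inducedGraphon Hfun F))
    (hcont : ∀ F₀ : M01, Tendsto (fun F => L1dist (inducedGraphon Hfun F) (inducedGraphon Hfun F₀))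
      (nhds F₀) (nhds 0))
    (hV : MeasurableSet ((fun x : Fin n → ↥(Set.Icc (0:ℝ) 1) => empMeas x) ⁻¹' V)) {b : ℝ}
    (hb : ∀ x : Fin n → ↥(Set.Icc (0:ℝ) 1), empMeas x ∈ V →
      ∑ ξ : Edge n → Bool with cutMetric h (stepK (adjM ξ)) < r, wt (edgeProb Hfun x) ξ ≤ b) :
    ν.prod (cubeMeasure n) (nearEvent Hfun n V h r)
      ≤ ν ((fun x => empMeas x) ⁻¹' V) * ENNReal.ofReal b := by
  rw [Measure.prod_apply (measurableSet_nearEvent Hsymm hG hcont hV), mul_comm,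
    ← lintegral_indicator_const hV]
  refine lintegral_mono fun x => ?_
  rw [cubeMeasure_nearEvent Hsymm Hrange]
  by_cases hx : empMeas x ∈ V
  · simpa [hx, Set.indicator] using ENNReal.ofReal_le_ofReal (hb x hx)
  · simp [hx]

open Classical in
lemma le_prod_nearEvent [NeZero n] (Hsymm : ∀ a b F, Hfun a b F = Hfun b a F)
    (Hrange : ∀ a b F, Hfun a b F ∈ Set.Icc (0:ℝ) 1)
    (hG : ∀ F : M01, IsGraphon (inducedGraphon Hfun F))
    (hcont : ∀ F₀ : M01, Tendsto (fun F => L1dist (inducedGraphon Hfun F) (inducedGraphon Hfun F₀))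
      (nhds F₀) (nhds 0))
    (hV : MeasurableSet ((fun x : Fin n → ↥(Set.Icc (0:ℝ) 1) => empMeas x) ⁻¹' V)) {b : ℝ}
    (hb : ∀ x : Fin n → ↥(Set.Icc (0:ℝ) 1), empMeas x ∈ V →
      b ≤ ∑ ξ : Edge n → Bool with cutMetric h (stepK (adjM ξ)) < r, wt (edgeProb Hfun x) ξ) :
    ν ((fun x => empMeas x) ⁻¹' V) * ENNReal.ofReal b
      ≤ ν.prod (cubeMeasure n) (nearEvent Hfun n V h r) := by
  rw [Measure.prod_apply (measurableSet_nearEvent Hsymm hG hcont hV), mul_comm,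
    ← lintegral_indicator_const hV]
  refine lintegral_mono fun x => ?_
  rw [cubeMeasure_nearEvent Hsymm Hrange]
  by_cases hx : empMeas x ∈ V
  · simpa [hx, Set.indicator] using ENNReal.ofReal_le_ofReal (hb x hx)
  · simp [hx]

end Joint

/-! ### Exponential rates -/

lemma log_ofReal_exp (t : ℝ) : ENNReal.log (ENNReal.ofReal (Real.exp t)) = (t : EReal) := by
  rw [ENNReal.log_ofReal, if_neg (not_le.2 (Real.exp_pos t)), Real.log_exp]

lemma inv_mul_log_le_iff {a : ℝ} (ha : 0 < a) (x : ℝ≥0∞) (k : ℝ) :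
    ((a⁻¹ : ℝ) : EReal) * ENNReal.log x ≤ ((-k : ℝ) : EReal)
      ↔ x ≤ ENNReal.ofReal (Real.exp (-(a * k))) := by
  rw [← ENNReal.log_le_log_iff, log_ofReal_exp, EReal.coe_inv, ← EReal.div_eq_inv_mul,
    EReal.div_le_iff_le_mul (by exact_mod_cast ha) (EReal.coe_ne_top a), ← EReal.coe_mul,
    mul_neg]

lemma le_inv_mul_log_iff {a : ℝ} (ha : 0 < a) (x : ℝ≥0∞) (k : ℝ) :
    ((-k : ℝ) : EReal) ≤ ((a⁻¹ : ℝ) : EReal) * ENNReal.log x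
      ↔ ENNReal.ofReal (Real.exp (-(a * k))) ≤ x := by
  rw [← ENNReal.log_le_log_iff, log_ofReal_exp, EReal.coe_inv, ← EReal.div_eq_inv_mul,
    EReal.le_div_iff_mul_le (by exact_mod_cast ha) (EReal.coe_ne_top a), ← EReal.coe_mul,
    neg_mul, mul_comm k]

lemma eventually_le_exp_of_limsup {a : ℕ → ℝ} (ha : Tendsto a atTop atTop) {x : ℕ → ℝ≥0∞}
    {I : EReal} (hI : atTop.limsup (fun n => (((a n)⁻¹ : ℝ) : EReal) * ENNReal.log (x n)) ≤ -I)
    {k : ℝ} (hk : (k : EReal) < I) :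
    ∀ᶠ n in atTop, x n ≤ ENNReal.ofReal (Real.exp (-(a n * k))) := by
  have h : atTop.limsup (fun n => (((a n)⁻¹ : ℝ) : EReal) * ENNReal.log (x n))
      < ((-k : ℝ) : EReal) := by
    refine hI.trans_lt ?_
    rw [EReal.coe_neg]
    exact EReal.neg_lt_neg_iff.2 hk
  filter_upwards [eventually_lt_of_limsup_lt h, ha.eventually_gt_atTop 0] with n hn han
  exact (inv_mul_log_le_iff han _ _).1 hn.le

lemma eventually_exp_le_of_liminf {a : ℕ → ℝ} (ha : Tendsto a atTop atTop) {x : ℕ → ℝ≥0∞}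
    {I : EReal} (hI : -I ≤ atTop.liminf (fun n => (((a n)⁻¹ : ℝ) : EReal) * ENNReal.log (x n)))
    {k : ℝ} (hk : I < (k : EReal)) :
    ∀ᶠ n in atTop, ENNReal.ofReal (Real.exp (-(a n * k))) ≤ x n := by
  have h : ((-k : ℝ) : EReal)
      < atTop.liminf (fun n => (((a n)⁻¹ : ℝ) : EReal) * ENNReal.log (x n)) := by
    refine lt_of_lt_of_le ?_ hI
    rw [EReal.coe_neg]
    exact EReal.neg_lt_neg_iff.2 hk
  filter_upwards [eventually_lt_of_lt_liminf h, ha.eventually_gt_atTop 0] with n hn han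
  exact (le_inv_mul_log_iff han _ _).1 hn.le

lemma limsup_le_of_eventually_le_exp {a : ℕ → ℝ} (ha : Tendsto a atTop atTop) {x : ℕ → ℝ≥0∞}
    {I : EReal} (H : ∀ k : ℝ, (k : EReal) < I →
      ∀ᶠ n in atTop, x n ≤ ENNReal.ofReal (Real.exp (-(a n * k)))) :
    atTop.limsup (fun n => (((a n)⁻¹ : ℝ) : EReal) * ENNReal.log (x n)) ≤ -I := by
  refine EReal.le_of_forall_lt_iff_le.1 fun z hz => ?_
  have hz' : ((-z : ℝ) : EReal) < I := by
    rw [EReal.coe_neg]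
    exact EReal.neg_lt_comm.1 hz
  refine limsup_le_of_le (by isBoundedDefault) ?_
  filter_upwards [H _ hz', ha.eventually_gt_atTop 0] with n hn han
  simpa using (inv_mul_log_le_iff han _ _).2 hn

lemma le_liminf_of_eventually_exp_le {a : ℕ → ℝ} (ha : Tendsto a atTop atTop) {x : ℕ → ℝ≥0∞}
    {I : EReal} (H : ∀ k : ℝ, I < (k : EReal) →
      ∀ᶠ n in atTop, ENNReal.ofReal (Real.exp (-(a n * k))) ≤ x n) :
    -I ≤ atTop.liminf (fun n => (((a n)⁻¹ : ℝ) : EReal) * ENNReal.log (x n)) := by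
  refine EReal.ge_of_forall_gt_iff_ge.1 fun z hz => ?_
  have hz' : I < ((-z : ℝ) : EReal) := by
    rw [EReal.coe_neg]
    exact EReal.lt_neg_comm.1 hz
  refine le_liminf_of_le (by isBoundedDefault) ?_
  filter_upwards [H _ hz', ha.eventually_gt_atTop 0] with n hn han
  simpa using (le_inv_mul_log_iff han _ _).2 hn

lemma binom2_eq (n : ℕ) : binom2 n = (n:ℝ) ^ 2 / 2 * (1 - (n:ℝ)⁻¹) := by
  rcases Nat.eq_zero_or_pos n with rfl | hn
  · simp [binom2]
  · have : (n:ℝ) ≠ 0 := by positivity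
    rw [binom2]
    field_simp

lemma tendsto_binom2 : Tendsto binom2 atTop atTop := by
  have h1 : Tendsto (fun n : ℕ => (n:ℝ) ^ 2 / 2) atTop atTop :=
    ((tendsto_pow_atTop two_ne_zero).comp tendsto_natCast_atTop_atTop).atTop_div_const two_pos
  have h2 : Tendsto (fun n : ℕ => 1 - (n:ℝ)⁻¹) atTop (nhds 1) := by
    simpa using (tendsto_const_nhds (x := (1:ℝ))).sub (tendsto_inv_atTop_nhds_zero_nat (𝕜 := ℝ))
  exact (h1.atTop_mul_pos one_pos h2).congr fun n => (binom2_eq n).symm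

lemma tendsto_sq_div_binom2 :
    Tendsto (fun n : ℕ => (n:ℝ) ^ 2 / 2 / binom2 n) atTop (nhds 1) := by
  have h2 : Tendsto (fun n : ℕ => (1 - (n:ℝ)⁻¹)⁻¹) atTop (nhds 1) := by
    simpa using ((tendsto_const_nhds (x := (1:ℝ))).sub
      (tendsto_inv_atTop_nhds_zero_nat (𝕜 := ℝ))).inv₀ (by simp)
  refine h2.congr' ?_
  filter_upwards [eventually_gt_atTop 0] with n hn
  have : (n:ℝ) ≠ 0 := by positivity
  rw [binom2_eq]
  field_simp

lemma tendsto_total_rate {ℓ : ℕ → ℝ} {c : ℝ}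
    (hrate : Tendsto (fun n => ℓ n / binom2 n) atTop (nhds c)) (s t : ℝ) :
    Tendsto (fun n : ℕ => (ℓ n * s + (n:ℝ) ^ 2 / 2 * t) / binom2 n) atTop (nhds (c * s + t)) := by
  have := (hrate.mul_const s).add (tendsto_sq_div_binom2.mul_const t)
  rw [one_mul] at this
  refine this.congr fun n => ?_
  ring

lemma eventually_binom2_mul_le {ℓ : ℕ → ℝ} {c : ℝ}
    (hrate : Tendsto (fun n => ℓ n / binom2 n) atTop (nhds c)) {s t M : ℝ} (hM : M < c * s + t) :
    ∀ᶠ n : ℕ in atTop, binom2 n * M ≤ ℓ n * s + (n:ℝ) ^ 2 / 2 * t := by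
  filter_upwards [(tendsto_total_rate hrate s t).eventually_const_lt hM,
    tendsto_binom2.eventually_gt_atTop 0] with n hn hb
  rw [lt_div_iff₀ hb] at hn
  linarith

lemma eventually_le_binom2_mul {ℓ : ℕ → ℝ} {c : ℝ}
    (hrate : Tendsto (fun n => ℓ n / binom2 n) atTop (nhds c)) {s t M : ℝ} (hM : c * s + t < M) :
    ∀ᶠ n : ℕ in atTop, ℓ n * s + (n:ℝ) ^ 2 / 2 * t ≤ binom2 n * M := by
  filter_upwards [(tendsto_total_rate hrate s t).eventually_lt_const hM,
    tendsto_binom2.eventually_gt_atTop 0] with n hn hb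
  rw [div_lt_iff₀ hb] at hn
  linarith

end

/-! ### Local estimates and the large deviation principle -/

noncomputable section

section Main

variable {Hfun : ℝ → ℝ → M01 → ℝ} {ν : ∀ n : ℕ, Measure (Fin n → ↥(Set.Icc (0:ℝ) 1))}
  {ℓ : ℕ → ℝ} {K : M01 → ℝ≥0∞} {c η : ℝ}

lemma clampK_ae_eq {g : ℝ → ℝ → ℝ} (hg : ∀ᵐ p ∂sqMeas, g p.1 p.2 ∈ Set.Icc η (1 - η)) :
    ∀ᵐ p ∂sqMeas, clampK η g p.1 p.2 = g p.1 p.2 := by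
  filter_upwards [hg] with p hp
  exact clampK_eq_of_mem hp

lemma exists_L1dist_edgeProb_clampK (hG : ∀ F : M01, IsGraphon (inducedGraphon Hfun F))
    (hη : 0 ≤ η) (hη2 : η ≤ 1 - η) {F : M01}
    (hF : ∀ᵐ p ∂sqMeas, inducedGraphon Hfun F p.1 p.2 ∈ Set.Icc η (1 - η))
    {n : ℕ} [NeZero n] (x : Fin n → ↥(Set.Icc (0:ℝ) 1)) :
    ∃ π : Equiv.Perm (Fin n), L1dist (stepK (edgeProb Hfun x))
      (relabel (blockPerm π) (clampK η (inducedGraphon Hfun F)))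
        = L1dist (inducedGraphon Hfun (empMeas x)) (inducedGraphon Hfun F) := by
  obtain ⟨π, hπ⟩ := exists_perm_L1dist_edgeProb hG x
  refine ⟨π, ?_⟩
  rw [hπ _ (isGraphon_clampK hη hη2 (hG F)).isKer]
  exact L1dist_congr (ae_of_all _ fun _ => rfl) (clampK_ae_eq hF)

lemma exists_real_lt_rate (hc : 0 < c) {k : ℝ≥0∞} {i M : ℝ} (hi : 0 ≤ i)
    (hM : (M : EReal) < ((ENNReal.ofReal c * k + ENNReal.ofReal i : ℝ≥0∞) : EReal)) :
    ∃ y : ℝ, M < c * y + i ∧ (ENNReal.ofReal y = 0 ∨ ENNReal.ofReal y < k) := by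
  by_cases hk : k = 0
  · refine ⟨0, ?_, Or.inl (by simp)⟩
    rw [hk, mul_zero, zero_add, EReal.coe_ennreal_ofReal, max_eq_left hi] at hM
    simpa using hM
  have hlt : ENNReal.ofReal ((M - i) / c) < k := by
    by_cases hT : k = ∞
    · simp [hT]
    · have hk0 : 0 < k.toReal := ENNReal.toReal_pos hk hT
      rw [← ENNReal.ofReal_toReal hT, ENNReal.ofReal_lt_ofReal_iff hk0, div_lt_iff₀ hc]
      rw [← ENNReal.ofReal_toReal hT, ← ENNReal.ofReal_mul hc.le,
        ← ENNReal.ofReal_add (by positivity) hi, EReal.coe_ennreal_ofReal,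
        max_eq_left (by positivity), EReal.coe_lt_coe_iff] at hM
      linarith
  obtain ⟨y, hy0, hy1, hy2⟩ := ENNReal.lt_iff_exists_real_btwn.1 hlt
  refine ⟨y, ?_, Or.inr hy2⟩
  have := (ENNReal.ofReal_lt_ofReal_iff'.1 hy1).1
  rw [div_lt_iff₀ hc] at this
  linarith

lemma exists_nhds_prod_nearEvent_le (Hsymm : ∀ a b F, Hfun a b F = Hfun b a F)
    (Hrange : ∀ a b F, Hfun a b F ∈ Set.Icc (0:ℝ) 1)
    (hG : ∀ F : M01, IsGraphon (inducedGraphon Hfun F)) (hK : LowerSemicontinuous K)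
    (hLDP : SatisfiesLDP (fun n => ν n) (fun _ x => empMeas x) ℓ K)
    (hcont : ∀ F₀ : M01, Tendsto (fun F => L1dist (inducedGraphon Hfun F) (inducedGraphon Hfun F₀))
      (nhds F₀) (nhds 0))
    (hc : 0 < c) (hrate : Tendsto (fun n => ℓ n / binom2 n) atTop (nhds c))
    (hη : 0 < η) (hη2 : η ≤ 1 - η)
    (hAB : ∀ F : M01, ∀ᵐ p ∂sqMeas, inducedGraphon Hfun F p.1 p.2 ∈ Set.Icc η (1 - η))
    (F : M01) {h : ℝ → ℝ → ℝ} (hh : IsGraphon h) {M : ℝ}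
    (hM : (M : EReal) < ((ENNReal.ofReal c * K F + IrateTilde (inducedGraphon Hfun F) h : ℝ≥0∞)
      : EReal)) :
    ∃ V ∈ nhds F, ∃ r > 0, ∀ᶠ n in atTop, (ν n).prod (cubeMeasure n) (nearEvent Hfun n V h r)
      ≤ ENNReal.ofReal (Real.exp (-(binom2 n * M))) := by
  classical
  set a := clampK η (inducedGraphon Hfun F) with ha_def
  have ha : IsGraphon a := isGraphon_clampK hη.le hη2 (hG F)
  have haη := clampK_mem hη2 (inducedGraphon Hfun F)
  have hI : IrateTilde (inducedGraphon Hfun F) h = IrateTilde a h :=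
    iInf_congr fun σ => (Irate_congr (clampK_ae_eq (hAB F))).symm
  have hfin : IrateTilde a h ≠ ∞ := by
    refine ne_top_of_le_ne_top ?_ (iInf_le _ (Classical.arbitrary MPBij))
    rw [(Irate_eq hη (hh.relabel _) ha.isKer haη).1]
    exact ENNReal.ofReal_ne_top
  set i := (IrateTilde a h).toReal with hi_def
  rw [hI, ← ENNReal.ofReal_toReal hfin] at hM
  obtain ⟨y, hMy, hy⟩ := exists_real_lt_rate hc ENNReal.toReal_nonneg hM
  have hylsc : ∀ᶠ F' in nhds F, ENNReal.ofReal y ≤ K F' := by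
    rcases hy with hy | hy
    · exact Eventually.of_forall fun F' => by simp [hy]
    · exact (hK F _ hy).mono fun _ => le_of_lt
  obtain ⟨ε, hε, hMε⟩ : ∃ ε > 0, M < c * (y - ε) + (i - ε) := by
    refine ⟨(c * y + i - M) / (2 * (c + 1)), by apply div_pos <;> linarith, ?_⟩
    have : (c + 1) * ((c * y + i - M) / (2 * (c + 1))) = (c * y + i - M) / 2 := by
      field_simp
    linarith
  obtain ⟨r, hr, ρ, hρ, hsum⟩ := exists_sum_wt_near_le ha hη haη hh hε
  obtain ⟨V, hVF, hVc, hV⟩ := exists_mem_nhds_isClosed_subset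
    (hylsc.and ((hcont F).eventually_lt_const hρ))
  refine ⟨V, hVF, r, hr, ?_⟩
  have hν := eventually_le_exp_of_limsup hLDP.1 (hLDP.2.1 V hVc) (k := y - ε) <| by
    refine lt_of_lt_of_le (b := ((y : ℝ) : EReal)) (by exact_mod_cast sub_lt_self y hε) ?_
    refine le_iInf₂ fun F' hF' => ?_
    refine le_trans ?_ (EReal.coe_ennreal_le_coe_ennreal_iff.2 (hV hF').1)
    rw [EReal.coe_ennreal_ofReal]
    exact_mod_cast le_max_left _ _
  filter_upwards [hν, hsum, eventually_binom2_mul_le hrate hMε, eventually_gt_atTop 0]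
    with n hν hsum hexp hn
  have : NeZero n := ⟨hn.ne'⟩
  refine (prod_nearEvent_le (ν n) Hsymm Hrange hG hcont
    (hVc.preimage (continuous_empMeas n)).measurableSet
    (b := Real.exp (-((n:ℝ) ^ 2 / 2 * (i - ε)))) fun x hx => ?_).trans ?_
  · obtain ⟨π, hπ⟩ := exists_L1dist_edgeProb_clampK hG hη.le hη2 (hAB F) x
    exact hsum this _ (fun i j => Hsymm _ _ _) (edgeProb_mem x (hAB _)) _
      (hπ.trans_lt (hV hx).2)
  · refine (mul_le_mul_left hν _).trans ?_
    rw [← ENNReal.ofReal_mul (Real.exp_nonneg _), ← Real.exp_add]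
    refine ENNReal.ofReal_le_ofReal (Real.exp_le_exp.2 ?_)
    linarith

lemma eventually_le_prod_nearEvent (Hsymm : ∀ a b F, Hfun a b F = Hfun b a F)
    (Hrange : ∀ a b F, Hfun a b F ∈ Set.Icc (0:ℝ) 1)
    (hG : ∀ F : M01, IsGraphon (inducedGraphon Hfun F))
    (hLDP : SatisfiesLDP (fun n => ν n) (fun _ x => empMeas x) ℓ K)
    (hcont : ∀ F₀ : M01, Tendsto (fun F => L1dist (inducedGraphon Hfun F) (inducedGraphon Hfun F₀))
      (nhds F₀) (nhds 0))
    (hc : 0 < c) (hrate : Tendsto (fun n => ℓ n / binom2 n) atTop (nhds c))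
    (hη : 0 < η) (hη2 : η ≤ 1 - η)
    (hAB : ∀ F : M01, ∀ᵐ p ∂sqMeas, inducedGraphon Hfun F p.1 p.2 ∈ Set.Icc η (1 - η))
    {F : M01} (hKF : K F ≠ ∞) {h : ℝ → ℝ → ℝ} (hh : IsGraphon h) {M : ℝ}
    (hM : c * (K F).toReal + (llI h h - llI h (clampK η (inducedGraphon Hfun F))) < M)
    {r : ℝ} (hr : 0 < r) :
    ∀ᶠ n in atTop, ENNReal.ofReal (Real.exp (-(binom2 n * M)))
      ≤ (ν n).prod (cubeMeasure n) (nearEvent Hfun n Set.univ h r) := by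
  classical
  set a := clampK η (inducedGraphon Hfun F) with ha_def
  have ha : IsGraphon a := isGraphon_clampK hη.le hη2 (hG F)
  have haη := clampK_mem hη2 (inducedGraphon Hfun F)
  set κ := (K F).toReal with hκ
  set i := llI h h - llI h a with hi_def
  obtain ⟨ε, hε, hMε⟩ : ∃ ε > 0, c * (κ + ε) + (i + ε) < M := by
    refine ⟨(M - c * κ - i) / (2 * (c + 1)), by apply div_pos <;> linarith, ?_⟩
    have : (c + 1) * ((M - c * κ - i) / (2 * (c + 1))) = (M - c * κ - i) / 2 := by
      field_simp
    linarith
  obtain ⟨ρ, hρ, hsum⟩ := exists_le_sum_wt_near ha hη haη hh hε hr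
  obtain ⟨U, hU, hUo, hFU⟩ := mem_nhds_iff.1 ((hcont F).eventually_lt_const hρ)
  have hν := eventually_exp_le_of_liminf hLDP.1 (hLDP.2.2 U hUo) (k := κ + ε) <| by
    refine (iInf₂_le F hFU).trans_lt ?_
    rw [← ENNReal.ofReal_toReal hKF, EReal.coe_ennreal_ofReal, max_eq_left ENNReal.toReal_nonneg]
    exact_mod_cast lt_add_of_pos_right κ hε
  filter_upwards [hν, hsum, eventually_le_binom2_mul hrate hMε, eventually_gt_atTop 0]
    with n hν hsum hexp hn
  have : NeZero n := ⟨hn.ne'⟩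
  refine le_trans ?_ ((le_prod_nearEvent (ν n) Hsymm Hrange hG hcont
    (hUo.preimage (continuous_empMeas n)).measurableSet
    (b := Real.exp (-((n:ℝ) ^ 2 / 2 * (i + ε)))) fun x hx => ?_).trans
      (measure_mono fun ω hω => ⟨Set.mem_univ _, hω.2⟩))
  · refine le_trans ?_ (mul_le_mul_left hν _)
    rw [← ENNReal.ofReal_mul (Real.exp_nonneg _), ← Real.exp_add]
    refine ENNReal.ofReal_le_ofReal (Real.exp_le_exp.2 ?_)
    linarith
  · obtain ⟨π, hπ⟩ := exists_L1dist_edgeProb_clampK hG hη.le hη2 (hAB F) x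
    exact hsum this _ (fun i j => Hsymm _ _ _) (edgeProb_mem x (hAB _)) _ (hπ.trans_lt (hU hx))

end Main

end

/-! ### Compactness argument for the upper bound -/

noncomputable section

/-- The empirical graphon of an inhomogeneous random graph, as a point of graphon space. -/
def irgtGraphon {Hfun : ℝ → ℝ → M01 → ℝ} (Hsymm : ∀ a b F, Hfun a b F = Hfun b a F) {n : ℕ}
    (ω : (Fin n → ↥(Set.Icc (0:ℝ) 1)) × (Fin n × Fin n → ℝ)) : Graphon :=
  ⟨empGraphon (irgtAdj Hfun ω.1 ω.2), isGraphon_empGraphon (irgtAdj_symm ω.1 ω.2 Hsymm)⟩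

lemma isClosed_graphon_of_deltaClosedIn {C : Set (ℝ → ℝ → ℝ)} (hC : DeltaClosedIn C) :
    IsClosed {h : Graphon | h.1 ∈ C} := by
  rw [← isOpen_compl_iff, Metric.isOpen_iff]
  intro h hh
  obtain ⟨ε, hε, H⟩ := hC.2 h.1 h.2 hh
  exact ⟨ε, hε, fun g hg => H g.1 g.2 hg⟩

section Main

variable {Hfun : ℝ → ℝ → M01 → ℝ} {ν : ∀ n : ℕ, Measure (Fin n → ↥(Set.Icc (0:ℝ) 1))}
  {M : ℝ}

lemma exists_nat_mul_exp_bound (Hsymm : ∀ a b F, Hfun a b F = Hfun b a F) {C : Set Graphon}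
    (hC : IsClosed C)
    (H : ∀ F : M01, ∀ h ∈ C, ∃ V ∈ nhds F, ∃ r > 0, ∀ᶠ n in atTop,
      (ν n).prod (cubeMeasure n) (nearEvent Hfun n V h.1 r)
        ≤ ENNReal.ofReal (Real.exp (-(binom2 n * M)))) :
    ∃ m : ℕ, ∀ᶠ n in atTop, (ν n).prod (cubeMeasure n) (irgtGraphon Hsymm ⁻¹' C)
      ≤ m * ENNReal.ofReal (Real.exp (-(binom2 n * M))) := by
  have key : ∃ m : ℕ, ∀ᶠ n in atTop, (ν n).prod (cubeMeasure n)
      {ω | (empMeas ω.1, irgtGraphon Hsymm ω) ∈ (Set.univ : Set M01) ×ˢ C}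
      ≤ m * ENNReal.ofReal (Real.exp (-(binom2 n * M))) := by
    refine (isCompact_univ.prod hC.isCompact).induction_on
      (p := fun s : Set (M01 × Graphon) => ∃ m : ℕ, ∀ᶠ n in atTop, (ν n).prod (cubeMeasure n)
        {ω | (empMeas ω.1, irgtGraphon Hsymm ω) ∈ s}
        ≤ m * ENNReal.ofReal (Real.exp (-(binom2 n * M)))) ⟨0, by simp⟩ ?_ ?_ ?_
    · rintro s t hst ⟨m, hm⟩
      exact ⟨m, hm.mono fun n hn => le_trans (measure_mono fun ω hω => hst hω) hn⟩
    · rintro s t ⟨m, hm⟩ ⟨k, hk⟩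
      refine ⟨m + k, ?_⟩
      filter_upwards [hm, hk] with n hm hk
      rw [Nat.cast_add, add_mul]
      exact (measure_union_le _ _).trans (add_le_add hm hk)
    · rintro ⟨F, h⟩ ⟨-, hh⟩
      obtain ⟨V, hV, r, hr, hVr⟩ := H F h hh
      refine ⟨V ×ˢ Metric.ball h r,
        mem_nhdsWithin_of_mem_nhds (prod_mem_nhds hV (Metric.ball_mem_nhds h hr)), 1, ?_⟩
      filter_upwards [hVr] with n hn
      rw [Nat.cast_one, one_mul]
      refine le_trans (measure_mono ?_) hn
      intro ω hω
      refine ⟨hω.1, ?_⟩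
      have := hω.2
      rw [Metric.mem_ball, dist_comm] at this
      exact this
  obtain ⟨m, hm⟩ := key
  refine ⟨m, hm.mono fun n hn => le_trans (measure_mono ?_) hn⟩
  intro ω hω
  exact ⟨Set.mem_univ _, hω⟩

lemma eventually_nat_mul_exp_le (m : ℕ) {M M' : ℝ} (hM : M < M') :
    ∀ᶠ n in atTop, (m : ℝ≥0∞) * ENNReal.ofReal (Real.exp (-(binom2 n * M')))
      ≤ ENNReal.ofReal (Real.exp (-(binom2 n * M))) := by
  have h1 : Tendsto (fun n => Real.exp (binom2 n * (M' - M))) atTop atTop :=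
    Real.tendsto_exp_atTop.comp (tendsto_binom2.atTop_mul_const (sub_pos.2 hM))
  filter_upwards [h1.eventually_ge_atTop (m : ℝ)] with n hn
  rw [← ENNReal.ofReal_natCast, ← ENNReal.ofReal_mul (Nat.cast_nonneg m)]
  refine ENNReal.ofReal_le_ofReal ?_
  calc (m : ℝ) * Real.exp (-(binom2 n * M'))
      ≤ Real.exp (binom2 n * (M' - M)) * Real.exp (-(binom2 n * M')) := by gcongr
    _ = Real.exp (-(binom2 n * M)) := by
      rw [← Real.exp_add]
      congr 1
      ring

/-- A near-optimal triple in the variational formula for the rate function. -/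
lemma exists_rate_lt {K : M01 → ℝ≥0∞} {c : ℝ} (hc : 0 < c) {h : ℝ → ℝ → ℝ}
    {x : ℝ≥0∞}
    (hx : ⨅ g ∈ GraphonSet, (ENNReal.ofReal c *
      (⨅ F ∈ {F : M01 | cutMetric (inducedGraphon Hfun F) g = 0}, K F) + IrateTilde g h) < x) :
    ∃ g ∈ GraphonSet, ∃ F, cutMetric (inducedGraphon Hfun F) g = 0 ∧ ∃ σ,
      ENNReal.ofReal c * K F + Irate g (relabel σ h) < x := by
  obtain ⟨g, hx⟩ := iInf_lt_iff.1 hx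
  obtain ⟨hg, hx⟩ := iInf_lt_iff.1 hx
  refine ⟨g, hg, ?_⟩
  by_contra! H
  refine hx.not_ge ?_
  have hc0 : ENNReal.ofReal c ≠ 0 := by simpa using hc
  rw [IrateTilde, ENNReal.mul_iInf_of_ne hc0 ENNReal.ofReal_ne_top, ENNReal.iInf_add]
  refine le_iInf fun F => ?_
  rw [ENNReal.mul_iInf_of_ne hc0 ENNReal.ofReal_ne_top, ENNReal.iInf_add]
  refine le_iInf fun hF => ?_
  rw [ENNReal.add_iInf]
  exact le_iInf fun σ => H F hF σ

end Main

end
/-- **Theorem 2.4(ii)** (LDP for IRGTs, balanced regime).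
If (a) the empirical type distributions `F_n` satisfy the LDP on `M([0,1])` with speed `ℓ(n)`
and lower-semicontinuous rate function `K`, (b) `F ↦ g^{[F]}` is continuous from `M([0,1])`
to `(W, ‖·‖_{L¹})`, (c) `ℓ(n)/(n(n-1)/2) → c ∈ (0,∞)`, and (d) the induced graphons are
uniformly away from the boundary, then the laws of the classes `h̃^{G_n}` satisfy the LDP on
`(W̃, δ_□)` with speed `n(n-1)/2` and rate function
`I*(h̃) = inf_{g̃} [c J(g̃) + Ĩ_g(h̃)]`. -/
theorem statement1
    (Hfun : ℝ → ℝ → M01 → ℝ)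
    (Hsymm : ∀ a b F, Hfun a b F = Hfun b a F)
    (Hrange : ∀ a b F, Hfun a b F ∈ Set.Icc (0:ℝ) 1)
    (hGraphon : ∀ F : M01, IsGraphon (inducedGraphon Hfun F))
    (ν : ∀ n : ℕ, Measure (Fin n → ↥(Set.Icc (0:ℝ) 1)))
    [∀ n, IsProbabilityMeasure (ν n)]
    (ℓ : ℕ → ℝ) (K : M01 → ℝ≥0∞) (hK : LowerSemicontinuous K)
    (hLDPtypes : SatisfiesLDP (fun n => ν n) (fun n x => empMeas x) ℓ K)
    (hcont : ∀ F₀ : M01,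
      Tendsto (fun F => L1dist (inducedGraphon Hfun F) (inducedGraphon Hfun F₀))
        (nhds F₀) (nhds 0))
    (c : ℝ) (hc : 0 < c)
    (hrate : Tendsto (fun n => ℓ n / binom2 n) atTop (nhds c))
    (hAB : ∃ η > (0:ℝ), ∀ F : M01,
      ∀ᵐ p ∂(volume.restrict unitSq), inducedGraphon Hfun F p.1 p.2 ∈ Set.Icc η (1 - η)) :
    GraphonLDP (fun n => (ν n).prod (cubeMeasure n))
      (fun n ω => empGraphon (irgtAdj Hfun ω.1 ω.2)) binom2
      (fun h => ⨅ g ∈ GraphonSet,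
        (ENNReal.ofReal c * (⨅ F ∈ {F : M01 | cutMetric (inducedGraphon Hfun F) g = 0}, K F)
          + IrateTilde g h)) := by
  obtain ⟨η, hη, hAB⟩ := hAB
  simp only [restrict_unitSq] at hAB
  have hη2 : η ≤ 1 - η := by
    obtain ⟨p, hp⟩ := (hAB (empMeas (Fin.elim0 ·))).exists
    exact hp.1.trans hp.2
  refine ⟨tendsto_binom2, fun C hC => ?_, fun O hO => ?_⟩
  · refine limsup_le_of_eventually_le_exp tendsto_binom2 fun M hM => ?_
    obtain ⟨M', hMM', hM'⟩ := EReal.lt_iff_exists_real_btwn.1 hM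
    obtain ⟨m, hm⟩ := exists_nat_mul_exp_bound (ν := ν) (M := M') Hsymm
      (isClosed_graphon_of_deltaClosedIn hC) fun F h hh => by
        refine exists_nhds_prod_nearEvent_le Hsymm Hrange hGraphon hK hLDPtypes hcont hc hrate hη
          hη2 hAB F h.2 (hM'.trans_le ((iInf₂_le h.1 hh).trans ?_))
        refine EReal.coe_ennreal_le_coe_ennreal_iff.2
          ((iInf₂_le (inducedGraphon Hfun F) (hGraphon F)).trans ?_)
        gcongr
        exact iInf₂_le F (cutMetric_self (hGraphon F).isKer)
    filter_upwards [hm, eventually_nat_mul_exp_le m (EReal.coe_lt_coe_iff.1 hMM')] with n h1 h2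
    exact h1.trans h2
  · refine le_liminf_of_eventually_exp_le tendsto_binom2 fun M hM => ?_
    obtain ⟨h, hM⟩ := iInf_lt_iff.1 hM
    obtain ⟨hh, hM⟩ := iInf_lt_iff.1 hM
    have hhG : IsGraphon h := hO.1 hh
    have hM0 : 0 < M := by exact_mod_cast (EReal.coe_ennreal_nonneg _).trans_lt hM
    rw [← max_eq_left hM0.le, ← EReal.coe_ennreal_ofReal,
      EReal.coe_ennreal_lt_coe_ennreal_iff] at hM
    obtain ⟨g, hg, F, hFg, σ, hlt⟩ := exists_rate_lt hc hM
    have hfin := (hlt.trans ENNReal.ofReal_lt_top).ne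
    have hKF : K F ≠ ∞ := fun hT => hfin (by simp [hT, hc])
    have hIσ : Irate g (relabel σ h) ≠ ∞ := fun hT => hfin (by simp [hT])
    rw [← ENNReal.ofReal_toReal hKF, ← ENNReal.ofReal_toReal hIσ, ← ENNReal.ofReal_mul hc.le,
      ← ENNReal.ofReal_add (by positivity) ENNReal.toReal_nonneg,
      ENNReal.ofReal_lt_ofReal_iff hM0] at hlt
    have ha := isGraphon_clampK hη.le hη2 (hGraphon F)
    have haη := clampK_mem hη2 (inducedGraphon Hfun F)
    have hag : cutMetric (clampK η (inducedGraphon Hfun F)) g = 0 := by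
      rw [cutMetric_comm ha.isKer hg.isKer, cutMetric_congr_right (clampK_ae_eq (hAB F)),
        cutMetric_comm hg.isKer (hGraphon F).isKer, hFg]
    obtain ⟨ε, hε, hεM⟩ : ∃ ε > 0, c * (K F).toReal + (Irate g (relabel σ h)).toReal + ε < M :=
      ⟨(M - (c * (K F).toReal + (Irate g (relabel σ h)).toReal)) / 2, by linarith, by linarith⟩
    obtain ⟨σ', hσ'⟩ := exists_relabel_rate_le ha hη haη hg hag hhG σ hε
    rw [← ENNReal.ofReal_toReal hIσ, ← ENNReal.ofReal_add ENNReal.toReal_nonneg hε.le,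
      ENNReal.ofReal_le_ofReal_iff (by positivity)] at hσ'
    have hh' := hhG.relabel σ'
    obtain ⟨r, hr, hball⟩ := hO.2 h hh
    refine (eventually_le_prod_nearEvent Hsymm Hrange hGraphon hLDPtypes hcont hc hrate hη hη2 hAB
      hKF hh' (M := M) ?_ hr).mono fun n hn => hn.trans (measure_mono fun ω hω => ?_)
    · rw [llI_relabel hhG.isKer hhG.isKer]
      linarith
    · have hωG := isGraphon_empGraphon (irgtAdj_symm ω.1 ω.2 Hsymm)
      have hhh' : cutMetric (relabel σ' h) h = 0 := by
        refine le_antisymm ?_ (cutMetric_nonneg hh'.isKer hhG.isKer)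
        refine (cutMetric_le_relabel_right hh'.isKer hhG.isKer σ').trans ?_
        exact (cutDist_le_L1dist hh'.isKer hh'.isKer).trans (by simp [L1dist])
      refine hball _ hωG ((cutMetric_triangle hωG.isKer hh'.isKer hhG.isKer).trans_lt ?_)
      rw [hhh', add_zero, cutMetric_comm hωG.isKer hh'.isKer]
      exact hω.2
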